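/- Let d ∈ ℕ, α ∈ (0, min(2,d)) and δ ∈ (0, d-α). For every s ∈ ℝ, every x ∈ ℝ^d \ {0} and every φ ∈ C_c^∞(ℝ×ℝ^d), one has ∫_s^∞ ∫_{ℝ^d} p̃(u-s,x,z) [∂_u φ(u,z) - ((-Δ_z+1)^{α/2} φ)(u,z) + V_δ(z) φ(u,z)] dz du = -φ(s,x), where the double integral converges absolutely; here ((-Δ_z+1)^{α/2} φ)(u,z) = φ(u,z) - lim_{ε→0⁺} ∫_{|w|>ε} (φ(u,z+w) - φ(u,z)) ν(w) dw. -/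

import Mathlib

open MeasureTheory Real Set Filter RealInnerProductSpace

noncomputable section

/-- Euclidean space `ℝ^d`. -/
abbrev Ed (d : ℕ) := EuclideanSpace ℝ (Fin d)

/-- Modified Bessel function of the second kind `K_ν(r)`. -/
def besselK (ν r : ℝ) : ℝ :=
  (1 / 2) * (r / 2) ^ ν * ∫ u in Ioi (0 : ℝ), u ^ (-ν - 1) * Real.exp (-u - r ^ 2 / (4 * u))

/-- Relativistic `α`-stable heat kernel with mass parameter `m`:
`p^m(t,x,y) = (2π)^{-d} ∫ exp(-i⟨y-x,z⟩) exp(-t(|z|²+m^{2/α})^{α/2}) dz`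
(the integral is real, and equals the cosine integral below). -/
def relKernel (d : ℕ) (α m t : ℝ) (x y : Ed d) : ℝ :=
  (2 * π) ^ (-(d : ℝ)) *
    ∫ z : Ed d, Real.cos ⟪y - x, z⟫ * Real.exp (-t * (‖z‖ ^ 2 + m ^ (2 / α)) ^ (α / 2))

/-- Fractional (`α`-stable) heat kernel `p⁰(t,x,y)`. -/
def fracKernel (d : ℕ) (α t : ℝ) (x y : Ed d) : ℝ :=
  (2 * π) ^ (-(d : ℝ)) * ∫ z : Ed d, Real.cos ⟪y - x, z⟫ * Real.exp (-t * ‖z‖ ^ α)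

/-- The summands of the perturbation series. -/
def pertN (d : ℕ) (k : ℝ → Ed d → Ed d → ℝ) (q : Ed d → ℝ) : ℕ → ℝ → Ed d → Ed d → ℝ
  | 0 => k
  | n + 1 => fun t x y =>
      ∫ s in Ioo (0 : ℝ) t, ∫ z : Ed d, pertN d k q n s x z * q z * k (t - s) z y

/-- Schrödinger perturbation of a transition density `k` by a potential `q`. -/
def pert (d : ℕ) (k : ℝ → Ed d → Ed d → ℝ) (q : Ed d → ℝ) (t : ℝ) (x y : Ed d) : ℝ :=
  ∑' n : ℕ, pertN d k q n t x y

/-- Radial profile of the potential `V_β`. -/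
def VProf (d : ℕ) (α β r : ℝ) : ℝ :=
  2 ^ (α / 2) * Real.Gamma (((d : ℝ) - β) / 2) / Real.Gamma (((d : ℝ) - β - α) / 2) *
    (besselK ((β + α) / 2) r / besselK (β / 2) r) * r ^ (-(α / 2))

/-- The potential `V_β(x)`. -/
def Vbeta (d : ℕ) (α β : ℝ) (x : Ed d) : ℝ := VProf d α β ‖x‖

/-- The Hardy constant `κ_β` for the fractional Laplacian. -/
def kappa (d : ℕ) (α β : ℝ) : ℝ :=
  2 ^ α * Real.Gamma ((β + α) / 2) * Real.Gamma (((d : ℝ) - β) / 2) /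
    (Real.Gamma (β / 2) * Real.Gamma (((d : ℝ) - β - α) / 2))

/-- `h^m_β(x) = ∫_0^∞ t^{(d-α-β)/α} p^m(t,x,0) dt`. -/
def hBetaM (d : ℕ) (α m β : ℝ) (x : Ed d) : ℝ :=
  ∫ t in Ioi (0 : ℝ), t ^ (((d : ℝ) - α - β) / α) * relKernel d α m t x 0

/-- `h_β = h^1_β`. -/
def hBeta (d : ℕ) (α β : ℝ) (x : Ed d) : ℝ := hBetaM d α 1 β x

/-- `V^m_β(x) = ((d-α-β)/α) h^m_{β+α}(x)/h^m_β(x)`. -/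
def VbetaM (d : ℕ) (α m β : ℝ) (x : Ed d) : ℝ :=
  (((d : ℝ) - α - β) / α) * hBetaM d α m (β + α) x / hBetaM d α m β x

/-- The function `H⁰(t,x)`. -/
def Hzero (d : ℕ) (α δ t : ℝ) (x : Ed d) : ℝ :=
  if δ ≤ ((d : ℝ) - α) / 2 then 1 + t ^ (δ / α) * ‖x‖ ^ (-δ)
  else 1 + t ^ (((d : ℝ) - α - δ) / α) * ‖x‖ ^ (-((d : ℝ) - α - δ))

/-- Density of the Lévy measure of the relativistic `α`-stable operator (mass 1). -/
def levyNu (d : ℕ) (α : ℝ) (x : Ed d) : ℝ :=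
  2 ^ ((α - (d : ℝ)) / 2 + 1) * π ^ (-(d : ℝ) / 2) * |Real.Gamma (-α / 2)|⁻¹ *
    besselK (((d : ℝ) + α) / 2) ‖x‖ / ‖x‖ ^ (((d : ℝ) + α) / 2)

/-- The operator `(-Δ+1)^{α/2}` acting on a test function, via the principal-value
integral against the Lévy density `ν` (mass 1, killing rate 1). -/
def relFracOp (d : ℕ) (α : ℝ) (φ : ℝ × Ed d → ℝ) (u : ℝ) (z : Ed d) : ℝ :=
  φ (u, z) - limUnder (nhdsWithin (0 : ℝ) (Ioi 0)) (fun ε : ℝ =>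
    ∫ w in {w : Ed d | ε < ‖w‖}, (φ (u, z + w) - φ (u, z)) * levyNu d α w)



/-! ### Part 1: Gaussian integrals, the symbol -/

/-- The symbol. -/
def psi {d : ℕ} (α : ℝ) (ξ : Ed d) : ℝ := (‖ξ‖ ^ 2 + 1) ^ (α / 2)

lemma psi_cont {d : ℕ} (α : ℝ) : Continuous (psi α : Ed d → ℝ) := by
  unfold psi
  refine Continuous.rpow_const (by fun_prop) (fun x => Or.inl (by positivity))

lemma psi_ge_one {d : ℕ} {α : ℝ} (hα : 0 < α) (ξ : Ed d) : 1 ≤ psi α ξ := by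
  unfold psi
  exact Real.one_le_rpow (by nlinarith [sq_nonneg ‖ξ‖]) (by linarith)

lemma psi_le {d : ℕ} {α : ℝ} (hα2 : α < 2) (ξ : Ed d) : psi α ξ ≤ 1 + ‖ξ‖ ^ 2 := by
  unfold psi
  calc (‖ξ‖ ^ 2 + 1) ^ (α / 2) ≤ (‖ξ‖ ^ 2 + 1) ^ (1 : ℝ) :=
        Real.rpow_le_rpow_of_exponent_le (by nlinarith [sq_nonneg ‖ξ‖]) (by linarith)
    _ = _ := by rw [Real.rpow_one]; ring

lemma relKernel_eq (d : ℕ) (α t : ℝ) (x y : Ed d) :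
    relKernel d α 1 t x y = (2 * π) ^ (-(d : ℝ)) *
      ∫ z : Ed d, Real.cos ⟪y - x, z⟫ * Real.exp (-t * psi α z) := by
  simp [relKernel, psi]

lemma integrable_exp_psi {d : ℕ} {α t : ℝ} (hα : 0 < α) (ht : 0 < t) :
    Integrable (fun ξ : Ed d => Real.exp (-t * psi α ξ)) := by
  obtain ⟨k, hk⟩ := exists_nat_gt ((d : ℝ) / α)
  have hk' : (d : ℝ) < k * α := by rwa [div_lt_iff₀ hα] at hk
  have h1 := (integrable_rpow_neg_one_add_norm_sq (E := Ed d) (μ := volume) (r := k * α)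
    (by simpa using hk')).const_mul ((Nat.factorial k : ℝ) / t ^ k)
  refine h1.mono' (by have := psi_cont (d := d) α; fun_prop) (Eventually.of_forall fun ξ => ?_)
  rw [Real.norm_eq_abs, abs_of_pos (Real.exp_pos _)]
  have hp : 0 < psi α ξ := lt_of_lt_of_le one_pos (psi_ge_one hα ξ)
  have h2 := Real.pow_div_factorial_le_exp (x := t * psi α ξ) (by positivity) k
  have h3 : (1 + ‖ξ‖ ^ 2) ^ (-(k * α) / 2) = (psi α ξ ^ k)⁻¹ := by
    unfold psi
    rw [← Real.rpow_natCast _ k, ← Real.rpow_mul (by positivity), ← Real.rpow_neg (by positivity),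
      add_comm]
    congr 1; ring
  rw [h3, neg_mul, Real.exp_neg]
  have h4 : (Nat.factorial k : ℝ) / t ^ k * (psi α ξ ^ k)⁻¹
      = ((t * psi α ξ) ^ k / (Nat.factorial k : ℝ))⁻¹ := by
    rw [mul_pow]; field_simp
  rw [h4]
  exact inv_anti₀ (by positivity) h2

lemma integrable_psi_exp_psi {d : ℕ} {α t : ℝ} (hα : 0 < α) (ht : 0 < t) :
    Integrable (fun ξ : Ed d => psi α ξ * Real.exp (-t * psi α ξ)) := by
  refine ((integrable_exp_psi (d := d) hα (half_pos ht)).const_mul (2 / t)).mono'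
    (by have := psi_cont (d := d) α; fun_prop) (Eventually.of_forall fun ξ => ?_)
  have hp : 0 < psi α ξ := lt_of_lt_of_le one_pos (psi_ge_one hα ξ)
  rw [Real.norm_eq_abs, abs_of_pos (by positivity)]
  have h := Real.add_one_le_exp (t / 2 * psi α ξ)
  have h1 : Real.exp (-t * psi α ξ)
      = Real.exp (-(t / 2) * psi α ξ) * Real.exp (-(t / 2) * psi α ξ) := by
    rw [← Real.exp_add]; congr 1; ring
  have h2 : Real.exp (t / 2 * psi α ξ) * Real.exp (-(t / 2) * psi α ξ) = 1 := by
    rw [← Real.exp_add]; simp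
  have h3 : psi α ξ * Real.exp (-(t / 2) * psi α ξ) ≤ 2 / t := by
    rw [le_div_iff₀ ht]
    have := mul_le_mul_of_nonneg_right h (Real.exp_pos (-(t / 2) * psi α ξ)).le
    rw [h2] at this
    nlinarith [Real.exp_pos (-(t / 2) * psi α ξ)]
  rw [h1, ← mul_assoc]
  exact mul_le_mul_of_nonneg_right h3 (Real.exp_pos _).le

lemma integrable_gauss {d : ℕ} {b : ℝ} (hb : 0 < b) :
    Integrable (fun ξ : Ed d => Real.exp (-b * ‖ξ‖ ^ 2)) := by
  have h := GaussianFourier.integrable_cexp_neg_mul_sq_norm_add (V := Ed d) (b := (b : ℂ))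
    (by simpa using hb) 0 0
  have := h.re
  refine this.congr (Eventually.of_forall fun ξ => ?_)
  simp only [inner_zero_left, Complex.ofReal_zero, mul_zero, add_zero]
  have : -(b : ℂ) * (‖ξ‖ : ℂ) ^ 2 = ((-b * ‖ξ‖ ^ 2 : ℝ) : ℂ) := by push_cast; ring
  rw [this]
  exact Complex.exp_ofReal_re _

lemma integral_gauss {d : ℕ} {b : ℝ} (hb : 0 < b) :
    ∫ ξ : Ed d, Real.exp (-b * ‖ξ‖ ^ 2) = (π / b) ^ ((d : ℝ) / 2) := by
  have := GaussianFourier.integral_rexp_neg_mul_sq_norm (V := Ed d) hb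
  simpa using this

lemma gauss_cos {d : ℕ} {b : ℝ} (hb : 0 < b) (w : Ed d) (θ : ℝ) :
    ∫ v : Ed d, Real.cos (⟪w, v⟫ + θ) * Real.exp (-b * ‖v‖ ^ 2)
      = Real.cos θ * ((π / b) ^ ((d : ℝ) / 2) * Real.exp (-‖w‖ ^ 2 / (4 * b))) := by
  have h := GaussianFourier.integral_cexp_neg_mul_sq_norm_add (V := Ed d) (b := (b : ℂ))
    (by simpa using hb) Complex.I w
  have hi := GaussianFourier.integrable_cexp_neg_mul_sq_norm_add (V := Ed d) (b := (b : ℂ))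
    (by simpa using hb) Complex.I w
  have h2 : ∀ v : Ed d, Real.cos (⟪w, v⟫ + θ) * Real.exp (-b * ‖v‖ ^ 2)
      = (Complex.exp (θ * Complex.I) *
        Complex.exp (-(b : ℂ) * ‖v‖ ^ 2 + Complex.I * ⟪w, v⟫)).re := by
    intro v
    rw [← Complex.exp_add]
    have : θ * Complex.I + (-(b : ℂ) * (‖v‖ : ℂ) ^ 2 + Complex.I * (⟪w, v⟫ : ℝ))
        = ((-b * ‖v‖ ^ 2 : ℝ) : ℂ) + ((⟪w, v⟫ + θ : ℝ) : ℂ) * Complex.I := by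
      push_cast; ring
    rw [this, Complex.exp_re]
    simp only [Complex.add_re, Complex.ofReal_re, Complex.mul_re, Complex.I_re, Complex.ofReal_im,
      Complex.I_im, Complex.add_im, Complex.mul_im]
    ring_nf
  simp_rw [h2]
  have h3 := integral_re (𝕜 := ℂ) (hi.const_mul (Complex.exp (θ * Complex.I)))
  simp only [RCLike.re_eq_complex_re] at h3
  rw [h3, integral_const_mul, h]
  have h4 : ((π : ℂ) / b) ^ ((Module.finrank ℝ (Ed d) : ℂ) / 2) = (((π / b) ^ ((d : ℝ) / 2) : ℝ) : ℂ) := by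
    rw [Complex.ofReal_cpow (by positivity)]
    simp
  have h5 : Complex.I ^ 2 * (‖w‖ : ℂ) ^ 2 / (4 * (b : ℂ)) = ((-‖w‖ ^ 2 / (4 * b) : ℝ) : ℂ) := by
    rw [Complex.I_sq]; push_cast; ring
  rw [h4, h5, ← Complex.ofReal_exp, ← Complex.ofReal_mul, Complex.re_mul_ofReal,
    Complex.exp_ofReal_mul_I_re]

lemma gauss_cos0 {d : ℕ} {b : ℝ} (hb : 0 < b) (w : Ed d) :
    ∫ v : Ed d, Real.cos ⟪w, v⟫ * Real.exp (-b * ‖v‖ ^ 2)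
      = (π / b) ^ ((d : ℝ) / 2) * Real.exp (-‖w‖ ^ 2 / (4 * b)) := by
  have := gauss_cos hb w 0
  simpa using this

/-- Measurability of the kernel. -/
lemma relKernel_meas (d : ℕ) (α : ℝ) :
    Measurable (fun q : ℝ × Ed d × Ed d => relKernel d α 1 q.1 q.2.1 q.2.2) := by
  simp_rw [relKernel_eq]
  refine Measurable.const_mul ?_ _
  have : StronglyMeasurable (Function.uncurry fun (q : ℝ × Ed d × Ed d) (z : Ed d) =>
      Real.cos ⟪q.2.2 - q.2.1, z⟫ * Real.exp (-q.1 * psi α z)) := by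
    apply Continuous.stronglyMeasurable
    have := psi_cont (d := d) α
    unfold Function.uncurry
    fun_prop
  exact (this.integral_prod_right).measurable


/-! ### Part 2: Bernstein representation of the symbol and positivity of the kernel -/

lemma abs_Gamma_neg {a : ℝ} (h0 : 0 < a) (h1 : a < 1) :
    |Real.Gamma (-a)| = Real.Gamma (1 - a) / a := by
  have h := Real.Gamma_add_one (s := -a) (by linarith)
  have hp : 0 < Real.Gamma (1 - a) := Real.Gamma_pos_of_pos (by linarith)
  have h2 : Real.Gamma (-a) = -(Real.Gamma (1 - a) / a) := by
    rw [show 1 - a = -a + 1 by ring, h]; field_simp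
  rw [h2, abs_neg, abs_of_pos (by positivity)]

lemma integrableOn_gam {c r : ℝ} (hc : 0 < c) (hr : 0 < r) :
    IntegrableOn (fun u : ℝ => u ^ (c - 1) * Real.exp (-(r * u))) (Ioi 0) := by
  have := integrableOn_rpow_mul_exp_neg_mul_rpow (p := 1) (s := c - 1) (b := r) (by linarith)
    one_pos hr
  simpa [neg_mul] using this

/-- The Levy density of the relativistic subordinator. -/
def kap (a u : ℝ) : ℝ := |Real.Gamma (-a)|⁻¹ * (u ^ (-a - 1) * Real.exp (-u))

lemma kap_meas (a : ℝ) : Measurable (kap a) := by unfold kap; fun_prop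

lemma kap_nonneg (a : ℝ) {u : ℝ} (hu : 0 < u) : 0 ≤ kap a u := by unfold kap; positivity

lemma bern_aux {a r : ℝ} (h0 : 0 < a) (h1 : a < 1) (hr : 0 ≤ r) :
    IntegrableOn (fun u : ℝ => u ^ (-a - 1) * Real.exp (-u) * (1 - Real.exp (-(u * r)))) (Ioi 0) ∧
    ∫ u in Ioi (0 : ℝ), u ^ (-a - 1) * Real.exp (-u) * (1 - Real.exp (-(u * r)))
      = Real.Gamma (1 - a) / a * ((1 + r) ^ a - 1) := by
  have hle : (1 : ℝ) ≤ 1 + r := by linarith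
  have hG : Integrable (fun q : ℝ × ℝ => (q.1 ^ ((1 - a) - 1) * Real.exp (-(1 * q.1))) * (1 : ℝ))
      ((volume.restrict (Ioi 0)).prod (volume.restrict (Ioc 1 (1 + r)))) :=
    Integrable.mul_prod (f := fun u : ℝ => u ^ ((1 - a) - 1) * Real.exp (-(1 * u)))
      (g := fun _ : ℝ => (1 : ℝ)) (integrableOn_gam (by linarith) one_pos) (integrable_const _)
  have hF : Integrable (Function.uncurry fun (u s : ℝ) => u ^ ((1 - a) - 1) * Real.exp (-(s * u)))
      ((volume.restrict (Ioi 0)).prod (volume.restrict (Ioc 1 (1 + r)))) := by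
    refine hG.mono' (Measurable.aestronglyMeasurable (by unfold Function.uncurry; fun_prop)) ?_
    rw [Measure.prod_restrict]
    refine (ae_restrict_iff' (measurableSet_Ioi.prod measurableSet_Ioc)).2
      (Eventually.of_forall ?_)
    rintro ⟨u, s⟩ ⟨hu, hs⟩
    simp only [mem_Ioi, mem_Ioc] at hu hs
    simp only [Function.uncurry, Real.norm_eq_abs, mul_one]
    rw [abs_of_nonneg (by positivity)]
    gcongr
    exact hs.1.le
  have key : ∀ u ∈ Ioi (0 : ℝ), ∫ s in Ioc 1 (1 + r), u ^ ((1 - a) - 1) * Real.exp (-(s * u))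
      = u ^ (-a - 1) * Real.exp (-u) * (1 - Real.exp (-(u * r))) := by
    intro u hu
    simp only [mem_Ioi] at hu
    rw [integral_const_mul, ← intervalIntegral.integral_of_le hle]
    have : ∫ s in (1 : ℝ)..(1 + r), Real.exp (-(s * u))
        = (Real.exp (-u) - Real.exp (-((1 + r) * u))) / u := by
      have hd : ∀ s ∈ uIcc (1 : ℝ) (1 + r),
          HasDerivAt (fun s : ℝ => -Real.exp (-(s * u)) / u) (Real.exp (-(s * u))) s := by
        intro s _
        have h2 := (((((hasDerivAt_id s).mul_const u).neg).exp).neg).div_const u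
        refine h2.congr_deriv ?_
        simp only [id, Pi.neg_apply]; field_simp
      rw [intervalIntegral.integral_eq_sub_of_hasDerivAt hd
        (Continuous.intervalIntegrable (by fun_prop) _ _)]
      simp only [one_mul]; ring
    rw [this]
    have e1 : u ^ ((1 - a) - 1) = u ^ (-a - 1) * u := by
      rw [show (1 - a) - 1 = (-a - 1) + 1 by ring, Real.rpow_add_one hu.ne']
    have e2 : Real.exp (-((1 + r) * u)) = Real.exp (-u) * Real.exp (-(u * r)) := by
      rw [← Real.exp_add]; congr 1; ring
    rw [e1, e2]; field_simp
  constructor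
  · have := hF.integral_prod_left
    exact IntegrableOn.congr_fun this (fun u hu => key u hu) measurableSet_Ioi
  · rw [← setIntegral_congr_fun measurableSet_Ioi key, integral_integral_swap hF]
    have : ∀ s ∈ Ioc 1 (1 + r), ∫ u in Ioi (0 : ℝ), u ^ ((1 - a) - 1) * Real.exp (-(s * u))
        = Real.Gamma (1 - a) * s ^ (a - 1) := by
      intro s hs
      have hs0 : 0 < s := by linarith [hs.1]
      rw [Real.integral_rpow_mul_exp_neg_mul_Ioi (by linarith) hs0, one_div,
        Real.inv_rpow hs0.le, ← Real.rpow_neg hs0.le, mul_comm]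
      congr 2; ring
    rw [setIntegral_congr_fun measurableSet_Ioc this, integral_const_mul,
      ← intervalIntegral.integral_of_le hle, integral_rpow (Or.inl (by linarith))]
    simp only [sub_add_cancel, Real.one_rpow]
    ring

lemma bern {a r : ℝ} (h0 : 0 < a) (h1 : a < 1) (hr : 0 ≤ r) :
    IntegrableOn (fun u : ℝ => kap a u * (1 - Real.exp (-(u * r)))) (Ioi 0) ∧
    ∫ u in Ioi (0 : ℝ), kap a u * (1 - Real.exp (-(u * r))) = (1 + r) ^ a - 1 := by
  obtain ⟨hi, he⟩ := bern_aux h0 h1 hr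
  have e : ∀ u, kap a u * (1 - Real.exp (-(u * r))) = |Real.Gamma (-a)|⁻¹ *
      (u ^ (-a - 1) * Real.exp (-u) * (1 - Real.exp (-(u * r)))) := fun u => by unfold kap; ring
  simp_rw [e]
  refine ⟨hi.const_mul _, ?_⟩
  rw [integral_const_mul, he, abs_Gamma_neg h0 h1]
  have hp : 0 < Real.Gamma (1 - a) := Real.Gamma_pos_of_pos (by linarith)
  field_simp

/-- Functions whose Gaussian-regularised Fourier transforms are nonnegative. -/
def PosF {d : ℕ} (f : Ed d → ℝ) : Prop :=
  Measurable f ∧ (∃ C, ∀ ξ, |f ξ| ≤ C) ∧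
    ∀ s > 0, ∀ y : Ed d, 0 ≤ ∫ ξ : Ed d, Real.cos ⟪y, ξ⟫ * Real.exp (-s * ‖ξ‖ ^ 2) * f ξ

lemma PosF.one {d : ℕ} : PosF (fun _ : Ed d => (1 : ℝ)) := by
  refine ⟨measurable_const, ⟨1, by simp⟩, fun s hs y => ?_⟩
  simp only [mul_one]
  rw [gauss_cos0 hs]
  positivity

lemma PosF.integrable {d : ℕ} {f : Ed d → ℝ} (hf : PosF f) {s : ℝ} (hs : 0 < s) (y : Ed d) :
    Integrable (fun ξ : Ed d => Real.cos ⟪y, ξ⟫ * Real.exp (-s * ‖ξ‖ ^ 2) * f ξ) := by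
  obtain ⟨hm, ⟨C, hC⟩, -⟩ := hf
  refine ((integrable_gauss (d := d) hs).const_mul C).mono'
    (Measurable.aestronglyMeasurable (by fun_prop)) (Eventually.of_forall fun ξ => ?_)
  rw [Real.norm_eq_abs, abs_mul, abs_mul, abs_of_pos (Real.exp_pos _)]
  calc |Real.cos ⟪y, ξ⟫| * Real.exp (-s * ‖ξ‖ ^ 2) * |f ξ|
      ≤ 1 * Real.exp (-s * ‖ξ‖ ^ 2) * C := by
        gcongr
        · exact Real.abs_cos_le_one _
        · exact hC ξ
    _ = _ := by ring

lemma PosF.add {d : ℕ} {f g : Ed d → ℝ} (hf : PosF f) (hg : PosF g) :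
    PosF (fun ξ => f ξ + g ξ) := by
  refine ⟨hf.1.add hg.1, ?_, fun s hs y => ?_⟩
  · obtain ⟨C, hC⟩ := hf.2.1
    obtain ⟨D, hD⟩ := hg.2.1
    exact ⟨C + D, fun ξ => (abs_add_le _ _).trans (add_le_add (hC ξ) (hD ξ))⟩
  · simp_rw [mul_add]
    rw [integral_add (hf.integrable hs y) (hg.integrable hs y)]
    exact add_nonneg (hf.2.2 s hs y) (hg.2.2 s hs y)

lemma PosF.smul {d : ℕ} {f : Ed d → ℝ} (hf : PosF f) {c : ℝ} (hc : 0 ≤ c) :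
    PosF (fun ξ => c * f ξ) := by
  refine ⟨hf.1.const_mul c, ?_, fun s hs y => ?_⟩
  · obtain ⟨C, hC⟩ := hf.2.1
    exact ⟨c * C, fun ξ => by rw [abs_mul, abs_of_nonneg hc]; exact mul_le_mul_of_nonneg_left (hC ξ) hc⟩
  · have : ∀ ξ, Real.cos ⟪y, ξ⟫ * Real.exp (-s * ‖ξ‖ ^ 2) * (c * f ξ)
        = c * (Real.cos ⟪y, ξ⟫ * Real.exp (-s * ‖ξ‖ ^ 2) * f ξ) := fun ξ => by ring
    simp_rw [this]
    rw [integral_const_mul]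
    exact mul_nonneg hc (hf.2.2 s hs y)

lemma PosF.lim {d : ℕ} {F : ℕ → Ed d → ℝ} {f : Ed d → ℝ} (hF : ∀ n, PosF (F n)) {C : ℝ}
    (hC : ∀ n ξ, |F n ξ| ≤ C) (hl : ∀ ξ, Tendsto (fun n => F n ξ) atTop (nhds (f ξ))) :
    PosF f := by
  refine ⟨measurable_of_tendsto_metrizable (fun n => (hF n).1) (tendsto_pi_nhds.2 hl),
    ⟨C, fun ξ => le_of_tendsto (hl ξ).abs (Eventually.of_forall fun n => hC n ξ)⟩,
    fun s hs y => ?_⟩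
  have := tendsto_integral_of_dominated_convergence
    (F := fun n ξ => Real.cos ⟪y, ξ⟫ * Real.exp (-s * ‖ξ‖ ^ 2) * F n ξ)
    (f := fun ξ => Real.cos ⟪y, ξ⟫ * Real.exp (-s * ‖ξ‖ ^ 2) * f ξ) (μ := volume)
    (fun ξ => C * Real.exp (-s * ‖ξ‖ ^ 2)) (fun n => ((hF n).integrable hs y).1)
    ((integrable_gauss (d := d) hs).const_mul C) (fun n => Eventually.of_forall fun ξ => ?_)
    (Eventually.of_forall fun ξ => (hl ξ).const_mul _)
  · exact ge_of_tendsto this (Eventually.of_forall fun n => (hF n).2.2 s hs y)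
  · rw [Real.norm_eq_abs, abs_mul, abs_mul, abs_of_pos (Real.exp_pos _)]
    calc |Real.cos ⟪y, ξ⟫| * Real.exp (-s * ‖ξ‖ ^ 2) * |F n ξ|
        ≤ 1 * Real.exp (-s * ‖ξ‖ ^ 2) * C := by
          gcongr
          · exact Real.abs_cos_le_one _
          · exact hC n ξ
      _ = _ := by ring

lemma integrableOn_kap_Ioi {a e : ℝ} (ha : 0 < a) (he : 0 < e) : IntegrableOn (kap a) (Ioi e) := by
  have h1 := (integrableOn_gam (c := 1) (r := 1) one_pos one_pos).mono_set
    (Ioi_subset_Ioi he.le)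
  refine (h1.const_mul (|Real.Gamma (-a)|⁻¹ * e ^ (-a - 1))).mono'
    (kap_meas a).aestronglyMeasurable ?_
  refine (ae_restrict_iff' measurableSet_Ioi).2 (Eventually.of_forall fun u hu => ?_)
  have hu0 : 0 < u := lt_trans he hu
  rw [Real.norm_eq_abs, abs_of_nonneg (kap_nonneg a hu0)]
  unfold kap
  simp only [sub_self, Real.rpow_zero, one_mul]
  rw [mul_assoc]
  have := Real.rpow_le_rpow_of_nonpos he (le_of_lt hu) (by linarith : -a - 1 ≤ 0)
  gcongr

/-- truncated mixture of Gaussians -/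
def mix {d : ℕ} (a e : ℝ) (ξ : Ed d) : ℝ :=
  ∫ u in Ioi e, kap a u * Real.exp (-u * ‖ξ‖ ^ 2)

lemma integrableOn_mix {d : ℕ} {a e : ℝ} (ha : 0 < a) (he : 0 < e) (ξ : Ed d) :
    IntegrableOn (fun u => kap a u * Real.exp (-u * ‖ξ‖ ^ 2)) (Ioi e) := by
  refine (integrableOn_kap_Ioi ha he).mono'
    ((kap_meas a).mul (by fun_prop)).aestronglyMeasurable ?_
  refine (ae_restrict_iff' measurableSet_Ioi).2 (Eventually.of_forall fun u hu => ?_)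
  have hu0 : 0 < u := lt_trans he hu
  have := kap_nonneg a hu0
  rw [Real.norm_eq_abs, abs_of_nonneg (by positivity)]
  refine mul_le_of_le_one_right this ?_
  rw [Real.exp_le_one_iff]
  nlinarith [sq_nonneg ‖ξ‖]

lemma mix_nonneg {d : ℕ} {a e : ℝ} (he : 0 < e) (ξ : Ed d) : 0 ≤ mix a e ξ :=
  setIntegral_nonneg measurableSet_Ioi fun u hu =>
    mul_nonneg (kap_nonneg a (lt_trans he hu)) (Real.exp_pos _).le

lemma mix_le {d : ℕ} {a e : ℝ} (ha : 0 < a) (he : 0 < e) (ξ : Ed d) :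
    mix a e ξ ≤ ∫ u in Ioi e, kap a u := by
  refine setIntegral_mono_on (integrableOn_mix ha he ξ) (integrableOn_kap_Ioi ha he)
    measurableSet_Ioi fun u hu => ?_
  have hu0 : 0 < u := lt_trans he hu
  refine mul_le_of_le_one_right (kap_nonneg a hu0) ?_
  rw [Real.exp_le_one_iff]
  nlinarith [sq_nonneg ‖ξ‖]

lemma mix_meas {d : ℕ} (a e : ℝ) : Measurable (mix a e : Ed d → ℝ) := by
  unfold mix
  have : StronglyMeasurable (Function.uncurry fun (ξ : Ed d) (u : ℝ) =>
      kap a u * Real.exp (-u * ‖ξ‖ ^ 2)) := by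
    apply Measurable.stronglyMeasurable
    unfold Function.uncurry
    have := kap_meas a
    fun_prop
  exact this.integral_prod_right.measurable

lemma PosF.mul_mix {d : ℕ} {f : Ed d → ℝ} (hf : PosF f) {a e : ℝ} (ha : 0 < a) (he : 0 < e) :
    PosF (fun ξ => f ξ * mix a e ξ) := by
  obtain ⟨C, hC⟩ := hf.2.1
  have hC0 : 0 ≤ C := (abs_nonneg _).trans (hC 0)
  refine ⟨hf.1.mul (mix_meas a e), ⟨C * ∫ u in Ioi e, kap a u, fun ξ => ?_⟩, fun s hs y => ?_⟩
  · rw [abs_mul, abs_of_nonneg (mix_nonneg he ξ)]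
    exact mul_le_mul (hC ξ) (mix_le ha he ξ) (mix_nonneg he ξ) hC0
  · have hF : Integrable (Function.uncurry fun (ξ : Ed d) (u : ℝ) =>
        (Real.cos ⟪y, ξ⟫ * Real.exp (-s * ‖ξ‖ ^ 2) * f ξ) * (kap a u * Real.exp (-u * ‖ξ‖ ^ 2)))
        (volume.prod (volume.restrict (Ioi e))) := by
      have h0 := ((hf.integrable hs y).norm).mul_prod (integrableOn_kap_Ioi ha he)
      refine h0.mono' ?_ ?_
      · apply Measurable.aestronglyMeasurable
        unfold Function.uncurry
        have := kap_meas a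
        have := hf.1
        fun_prop
      · have : ∀ᵐ q : Ed d × ℝ ∂(volume.prod (volume.restrict (Ioi e))), e < q.2 := by
          have h3 : (volume : Measure (Ed d)).prod (volume.restrict (Ioi e))
            = (volume.prod volume).restrict (univ ×ˢ Ioi e) := by
            rw [← Measure.prod_restrict, Measure.restrict_univ]
          rw [h3]
          refine (ae_restrict_iff' (MeasurableSet.univ.prod measurableSet_Ioi)).2
            (Eventually.of_forall fun q hq => hq.2)
        filter_upwards [this] with q hq
        have hu0 : 0 < q.2 := lt_trans he hq
        simp only [Function.uncurry]
        rw [norm_mul]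
        refine mul_le_mul_of_nonneg_left ?_ (norm_nonneg _)
        have := kap_nonneg a hu0
        rw [Real.norm_eq_abs, abs_of_nonneg (by positivity)]
        refine mul_le_of_le_one_right this ?_
        rw [Real.exp_le_one_iff]
        nlinarith [sq_nonneg ‖q.1‖]
    have e1 : ∀ ξ : Ed d, Real.cos ⟪y, ξ⟫ * Real.exp (-s * ‖ξ‖ ^ 2) * (f ξ * mix a e ξ)
        = ∫ u in Ioi e, (Real.cos ⟪y, ξ⟫ * Real.exp (-s * ‖ξ‖ ^ 2) * f ξ) *
          (kap a u * Real.exp (-u * ‖ξ‖ ^ 2)) := by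
      intro ξ
      rw [integral_const_mul]; unfold mix; ring
    simp_rw [e1]
    rw [integral_integral_swap hF]
    refine setIntegral_nonneg measurableSet_Ioi fun u hu => ?_
    have hu0 : 0 < u := lt_trans he hu
    have e2 : ∀ ξ : Ed d, (Real.cos ⟪y, ξ⟫ * Real.exp (-s * ‖ξ‖ ^ 2) * f ξ) *
          (kap a u * Real.exp (-u * ‖ξ‖ ^ 2)) = kap a u *
          (Real.cos ⟪y, ξ⟫ * Real.exp (-(s + u) * ‖ξ‖ ^ 2) * f ξ) := by
      intro ξ
      have : Real.exp (-(s + u) * ‖ξ‖ ^ 2) = Real.exp (-s * ‖ξ‖ ^ 2) * Real.exp (-u * ‖ξ‖ ^ 2) := by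
        rw [← Real.exp_add]; congr 1; ring
      rw [this]; ring
    simp_rw [e2]
    rw [integral_const_mul]
    exact mul_nonneg (kap_nonneg a hu0) (hf.2.2 _ (by linarith) y)

lemma PosF.exp_mix {d : ℕ} {a e t : ℝ} (ha : 0 < a) (he : 0 < e) (ht : 0 ≤ t) :
    PosF (fun ξ : Ed d => Real.exp (t * mix a e ξ)) := by
  have hpow : ∀ k : ℕ, PosF (fun ξ : Ed d => mix a e ξ ^ k) := by
    intro k
    induction k with
    | zero => simpa using PosF.one
    | succ k ih => simpa [pow_succ] using ih.mul_mix ha he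
  have hsum : ∀ n : ℕ, PosF (fun ξ : Ed d => ∑ k ∈ Finset.range n,
      (t * mix a e ξ) ^ k / (Nat.factorial k : ℝ)) := by
    intro n
    induction n with
    | zero => simpa using PosF.one.smul (le_refl (0 : ℝ)) (d := d)
    | succ n ih =>
      simp_rw [Finset.sum_range_succ]
      refine ih.add ?_
      have := (hpow n).smul (c := t ^ n / (Nat.factorial n : ℝ)) (by positivity)
      convert! this using 2
      rw [mul_pow]; ring
  refine PosF.lim (C := Real.exp (t * ∫ u in Ioi e, kap a u)) hsum (fun n ξ => ?_) (fun ξ => ?_)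
  · have h0 : 0 ≤ t * mix a e ξ := mul_nonneg ht (mix_nonneg he ξ)
    rw [abs_of_nonneg (Finset.sum_nonneg fun k _ => by positivity)]
    refine (Real.sum_le_exp_of_nonneg h0 n).trans (Real.exp_le_exp.2 ?_)
    exact mul_le_mul_of_nonneg_left (mix_le ha he ξ) ht
  · have := NormedSpace.expSeries_div_hasSum_exp (𝔸 := ℝ) (t * mix a e ξ)
    rw [← Real.exp_eq_exp_ℝ] at this
    exact this.tendsto_sum_nat

lemma PosF.exp_psi {d : ℕ} {α t : ℝ} (h0 : 0 < α) (h2 : α < 2) (ht : 0 ≤ t) :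
    PosF (fun ξ : Ed d => Real.exp (-t * psi α ξ)) := by
  have ha : 0 < α / 2 := by linarith
  have ha1 : α / 2 < 1 := by linarith
  set e : ℕ → ℝ := fun n => 1 / ((n : ℝ) + 1) with he_def
  have he : ∀ n, 0 < e n := fun n => Nat.one_div_pos_of_nat
  have hfin : ∀ n, ∀ ξ : Ed d, ∫ u in Ioi (e n), kap (α / 2) u * (1 - Real.exp (-(u * ‖ξ‖ ^ 2)))
      = (∫ u in Ioi (e n), kap (α / 2) u) - mix (α / 2) (e n) ξ := by
    intro n ξ
    unfold mix
    rw [← integral_sub (integrableOn_kap_Ioi ha (he n)) (integrableOn_mix ha (he n) ξ)]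
    refine integral_congr_ae (Eventually.of_forall fun u => ?_)
    simp only [neg_mul]; ring
  refine PosF.lim (F := fun n ξ => Real.exp (-t * (1 + ∫ u in Ioi (e n), kap (α / 2) u)) *
    Real.exp (t * mix (α / 2) (e n) ξ)) (C := 1) (fun n => ?_) (fun n ξ => ?_) (fun ξ => ?_)
  · exact (PosF.exp_mix ha (he n) ht).smul (Real.exp_pos _).le
  · rw [abs_of_pos (by positivity), ← Real.exp_add, Real.exp_le_one_iff]
    have := mix_le ha (he n) ξ
    nlinarith
  · have hr : (0 : ℝ) ≤ ‖ξ‖ ^ 2 := by positivity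
    obtain ⟨hi, hv⟩ := bern ha ha1 hr
    have hlim : Tendsto (fun n => ∫ u in Ioi (e n), kap (α / 2) u * (1 - Real.exp (-(u * ‖ξ‖ ^ 2))))
        atTop (nhds (∫ u in Ioi (0 : ℝ), kap (α / 2) u * (1 - Real.exp (-(u * ‖ξ‖ ^ 2))))) := by
      have hU : (⋃ n, Ioi (e n)) = Ioi (0 : ℝ) := by
        ext u
        simp only [mem_iUnion, mem_Ioi]
        constructor
        · rintro ⟨n, hn⟩; exact (he n).trans hn
        · intro hu; exact exists_nat_one_div_lt hu
      have := tendsto_setIntegral_of_monotone (s := fun n => Ioi (e n)) (μ := volume)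
        (f := fun u => kap (α / 2) u * (1 - Real.exp (-(u * ‖ξ‖ ^ 2))))
        (fun n => measurableSet_Ioi) (fun n m hnm => Ioi_subset_Ioi
          (Nat.one_div_le_one_div hnm)) (by rw [hU]; exact hi)
      rwa [hU] at this
    rw [hv] at hlim
    have hcont : Tendsto (fun n => Real.exp (-t * (1 + ∫ u in Ioi (e n),
        kap (α / 2) u * (1 - Real.exp (-(u * ‖ξ‖ ^ 2)))))) atTop
        (nhds (Real.exp (-t * (1 + ((1 + ‖ξ‖ ^ 2) ^ (α / 2) - 1))))) :=
      (Real.continuous_exp.tendsto _).comp ((hlim.const_add 1).const_mul (-t))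
    have e3 : (-t * (1 + ((1 + ‖ξ‖ ^ 2) ^ (α / 2) - 1))) = -t * psi α ξ := by
      unfold psi; rw [add_comm (‖ξ‖ ^ 2) 1]; ring
    rw [e3] at hcont
    refine hcont.congr fun n => ?_
    rw [hfin, ← Real.exp_add]; congr 1; ring

lemma relKernel_nonneg {d : ℕ} {α t : ℝ} (h0 : 0 < α) (h2 : α < 2) (ht : 0 < t) (x y : Ed d) :
    0 ≤ relKernel d α 1 t x y := by
  rw [relKernel_eq]
  refine mul_nonneg (by positivity) ?_
  have hP := PosF.exp_psi (d := d) h0 h2 ht.le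
  have := tendsto_integral_of_dominated_convergence
    (F := fun (n : ℕ) (ξ : Ed d) => Real.cos ⟪y - x, ξ⟫ * Real.exp (-(1 / ((n : ℝ) + 1)) * ‖ξ‖ ^ 2) *
      Real.exp (-t * psi α ξ))
    (f := fun ξ => Real.cos ⟪y - x, ξ⟫ * Real.exp (-t * psi α ξ)) (μ := volume)
    (fun ξ => Real.exp (-t * psi α ξ)) (fun n => (hP.integrable Nat.one_div_pos_of_nat _).1)
    (integrable_exp_psi h0 ht) (fun n => Eventually.of_forall fun ξ => ?_)
    (Eventually.of_forall fun ξ => ?_)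
  · exact ge_of_tendsto this (Eventually.of_forall fun n =>
      hP.2.2 _ Nat.one_div_pos_of_nat _)
  · rw [Real.norm_eq_abs, abs_mul, abs_mul, abs_of_pos (Real.exp_pos _), abs_of_pos (Real.exp_pos _)]
    refine mul_le_of_le_one_left (Real.exp_pos _).le ?_
    refine mul_le_one₀ (Real.abs_cos_le_one _) (Real.exp_pos _).le ?_
    rw [Real.exp_le_one_iff]
    have : 0 < 1 / ((n : ℝ) + 1) := Nat.one_div_pos_of_nat
    nlinarith [sq_nonneg ‖ξ‖]
  · have h1 : Tendsto (fun n : ℕ => Real.exp (-(1 / ((n : ℝ) + 1)) * ‖ξ‖ ^ 2)) atTop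
        (nhds (Real.exp (-0 * ‖ξ‖ ^ 2))) :=
      (Real.continuous_exp.tendsto _).comp
        ((tendsto_one_div_add_atTop_nhds_zero_nat (𝕜 := ℝ)).neg.mul_const _)
    simp only [neg_zero, zero_mul, Real.exp_zero] at h1
    have := (h1.const_mul (Real.cos ⟪y - x, ξ⟫)).mul_const (Real.exp (-t * psi α ξ))
    simpa using this


/-! ### Part 3: the kernel acting on Gaussians -/

/-- Regularised Fourier integral. -/
def GG {d : ℕ} (α t v : ℝ) (x : Ed d) : ℝ :=
  ∫ ξ : Ed d, Real.cos ⟪x, ξ⟫ * Real.exp (-v * ‖ξ‖ ^ 2) * Real.exp (-t * psi α ξ)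

lemma GG_nonneg {d : ℕ} {α t v : ℝ} (h0 : 0 < α) (h2 : α < 2) (ht : 0 ≤ t) (hv : 0 < v)
    (x : Ed d) : 0 ≤ GG α t v x := (PosF.exp_psi h0 h2 ht).2.2 v hv x

lemma kernel_gauss {d : ℕ} {α t v : ℝ} (h0 : 0 < α) (ht : 0 < t) (hv : 0 < v)
    (x a : Ed d) :
    Integrable (fun y : Ed d => relKernel d α 1 t x y * Real.exp (-(1 / (4 * v)) * ‖y - a‖ ^ 2)) ∧
    ∫ y : Ed d, relKernel d α 1 t x y * Real.exp (-(1 / (4 * v)) * ‖y - a‖ ^ 2)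
      = (v / π) ^ ((d : ℝ) / 2) * GG α t v (a - x) := by
  set b : ℝ := 1 / (4 * v) with hb_def
  have hb : 0 < b := by positivity
  have hpc := psi_cont (d := d) α
  have hF : Integrable (Function.uncurry fun (y ξ : Ed d) =>
      (Real.exp (-b * ‖y - a‖ ^ 2)) * (Real.cos ⟪y - x, ξ⟫ * Real.exp (-t * psi α ξ)))
      (volume.prod volume) := by
    have h1 := ((integrable_gauss (d := d) hb).comp_sub_right a).mul_prod
      (integrable_exp_psi (d := d) h0 ht)
    refine h1.mono' ?_ (Eventually.of_forall fun q => ?_)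
    · apply Continuous.aestronglyMeasurable
      unfold Function.uncurry
      fun_prop
    · simp only [Function.uncurry]
      rw [Real.norm_eq_abs, abs_mul, abs_mul, abs_of_pos (Real.exp_pos _),
        abs_of_pos (Real.exp_pos _)]
      refine mul_le_mul_of_nonneg_left ?_ (Real.exp_pos _).le
      exact mul_le_of_le_one_left (Real.exp_pos _).le (Real.abs_cos_le_one _)
  have e1 : ∀ y : Ed d, relKernel d α 1 t x y * Real.exp (-b * ‖y - a‖ ^ 2)
      = (2 * π) ^ (-(d : ℝ)) * ∫ ξ : Ed d,
      (Real.exp (-b * ‖y - a‖ ^ 2)) * (Real.cos ⟪y - x, ξ⟫ * Real.exp (-t * psi α ξ)) := by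
    intro y
    rw [relKernel_eq, integral_const_mul]; ring
  simp_rw [e1]
  refine ⟨hF.integral_prod_left.const_mul _, ?_⟩
  rw [integral_const_mul, integral_integral_swap hF]
  have e2 : ∀ ξ : Ed d, ∫ y : Ed d,
      (Real.exp (-b * ‖y - a‖ ^ 2)) * (Real.cos ⟪y - x, ξ⟫ * Real.exp (-t * psi α ξ))
      = (π / b) ^ ((d : ℝ) / 2) *
        (Real.cos ⟪a - x, ξ⟫ * Real.exp (-v * ‖ξ‖ ^ 2) * Real.exp (-t * psi α ξ)) := by
    intro ξ
    have e3 : ∀ y : Ed d, (Real.exp (-b * ‖y - a‖ ^ 2)) *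
        (Real.cos ⟪y - x, ξ⟫ * Real.exp (-t * psi α ξ)) = (fun y' : Ed d =>
          Real.exp (-t * psi α ξ) * (Real.cos (⟪ξ, y'⟫ + ⟪a - x, ξ⟫) *
            Real.exp (-b * ‖y'‖ ^ 2))) (y - a) := by
      intro y
      simp only
      have : ⟪ξ, y - a⟫ + ⟪a - x, ξ⟫ = ⟪y - x, ξ⟫ := by
        rw [real_inner_comm, ← inner_add_left]; congr 1; abel
      rw [this]; ring
    simp_rw [e3]
    rw [integral_sub_right_eq_self (fun y' : Ed d =>
          Real.exp (-t * psi α ξ) * (Real.cos (⟪ξ, y'⟫ + ⟪a - x, ξ⟫) *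
            Real.exp (-b * ‖y'‖ ^ 2))) a, integral_const_mul, gauss_cos hb]
    have : -‖ξ‖ ^ 2 / (4 * b) = -v * ‖ξ‖ ^ 2 := by rw [hb_def]; field_simp
    rw [this]; ring
  simp_rw [e2]
  rw [integral_const_mul, ← mul_assoc]
  unfold GG
  congr 1
  have e4 : π / b = (2 * π) ^ 2 * (v / π) := by rw [hb_def]; field_simp; norm_num
  have hpi := Real.pi_pos
  have e5 : ((2 * π) ^ 2 * (v / π)) ^ ((d : ℝ) / 2) = (2 * π) ^ (d : ℝ) * (v / π) ^ ((d : ℝ) / 2) := by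
    rw [Real.mul_rpow (x := (2 * π) ^ 2) (by positivity) (by positivity),
      ← Real.rpow_natCast (2 * π) 2, ← Real.rpow_mul (by positivity)]
    congr 2; push_cast; ring
  have e6 : 0 < (2 * π) ^ (d : ℝ) := by positivity
  rw [e4, e5, Real.rpow_neg (by positivity)]
  field_simp

lemma gauss_norm_const {d : ℕ} {v : ℝ} (hv : 0 < v) :
    (v / π) ^ ((d : ℝ) / 2) * (π / v) ^ ((d : ℝ) / 2) = 1 := by
  have hpi := Real.pi_pos
  rw [← Real.mul_rpow (by positivity) (by positivity)]
  rw [show v / π * (π / v) = 1 by field_simp, Real.one_rpow]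

lemma integrable_GG {d : ℕ} {α t v : ℝ} (h0 : 0 < α) (h2 : α < 2) (ht : 0 ≤ t) (hv : 0 < v)
    (x : Ed d) : Integrable (fun ξ : Ed d =>
      Real.cos ⟪x, ξ⟫ * Real.exp (-v * ‖ξ‖ ^ 2) * Real.exp (-t * psi α ξ)) :=
  (PosF.exp_psi h0 h2 ht).integrable hv x

lemma kernel_gauss_le_one {d : ℕ} {α t v : ℝ} (h0 : 0 < α) (h2 : α < 2) (ht : 0 < t) (hv : 0 < v)
    (x a : Ed d) :
    ∫ y : Ed d, relKernel d α 1 t x y * Real.exp (-(1 / (4 * v)) * ‖y - a‖ ^ 2) ≤ 1 := by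
  rw [(kernel_gauss h0 ht hv x a).2, ← gauss_norm_const (d := d) hv, ← integral_gauss hv]
  refine mul_le_mul_of_nonneg_left ?_ (by have := Real.pi_pos; positivity)
  refine integral_mono (integrable_GG h0 h2 ht.le hv _) (integrable_gauss hv) fun ξ => ?_
  simp only
  have h1 : Real.exp (-t * psi α ξ) ≤ 1 := by
    rw [Real.exp_le_one_iff]; nlinarith [psi_ge_one h0 ξ]
  have h3 := Real.cos_le_one ⟪a - x, ξ⟫
  have h4 := Real.exp_pos (-v * ‖ξ‖ ^ 2)
  have h5 := Real.exp_pos (-t * psi α ξ)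
  calc _ ≤ 1 * Real.exp (-v * ‖ξ‖ ^ 2) * Real.exp (-t * psi α ξ) := by gcongr
    _ ≤ 1 * Real.exp (-v * ‖ξ‖ ^ 2) * 1 := by gcongr
    _ = _ := by ring

lemma kernel_gauss_ge {d : ℕ} {α t v : ℝ} (h0 : 0 < α) (h2 : α < 2) (ht : 0 < t) (hv : 0 < v)
    (x a : Ed d) :
    Real.exp (-t) - (t + ‖a - x‖ ^ 2 / 2) * (2 / v) * 2 ^ ((d : ℝ) / 2) ≤
    ∫ y : Ed d, relKernel d α 1 t x y * Real.exp (-(1 / (4 * v)) * ‖y - a‖ ^ 2) := by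
  rw [(kernel_gauss h0 ht hv x a).2]
  have hpi := Real.pi_pos
  set K : ℝ := t + ‖a - x‖ ^ 2 / 2 with hK
  have hK0 : 0 ≤ K := by positivity
  have hlow : ∫ ξ : Ed d, (Real.exp (-t) * Real.exp (-v * ‖ξ‖ ^ 2) -
      K * (2 / v) * Real.exp (-(v / 2) * ‖ξ‖ ^ 2)) ≤ GG α t v (a - x) := by
    refine integral_mono (((integrable_gauss hv).const_mul _).sub
      ((integrable_gauss (half_pos hv)).const_mul _)) (integrable_GG h0 h2 ht.le hv _) fun ξ => ?_
    simp only
    set E := Real.exp (-v * ‖ξ‖ ^ 2) with hE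
    set c := Real.cos ⟪a - x, ξ⟫ with hc
    have hE0 : 0 < E := Real.exp_pos _
    have hr : 0 ≤ ‖ξ‖ ^ 2 := by positivity
    have h3 : ‖ξ‖ ^ 2 * E ≤ (2 / v) * Real.exp (-(v / 2) * ‖ξ‖ ^ 2) := by
      have h4 := Real.add_one_le_exp (v / 2 * ‖ξ‖ ^ 2)
      have h5 : E = Real.exp (-(v / 2) * ‖ξ‖ ^ 2) * Real.exp (-(v / 2) * ‖ξ‖ ^ 2) := by
        rw [hE, ← Real.exp_add]; congr 1; ring
      have h6 : Real.exp (v / 2 * ‖ξ‖ ^ 2) * Real.exp (-(v / 2) * ‖ξ‖ ^ 2) = 1 := by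
        rw [← Real.exp_add]; simp
      have hp := Real.exp_pos (-(v / 2) * ‖ξ‖ ^ 2)
      have h7 : ‖ξ‖ ^ 2 * Real.exp (-(v / 2) * ‖ξ‖ ^ 2) ≤ 2 / v := by
        rw [le_div_iff₀ hv]
        have := mul_le_mul_of_nonneg_right h4 hp.le
        rw [h6] at this
        nlinarith
      rw [h5, ← mul_assoc]
      exact mul_le_mul_of_nonneg_right h7 hp.le
    have hpsi1 : Real.exp (-t * psi α ξ) ≤ 1 := by
      rw [Real.exp_le_one_iff]; nlinarith [psi_ge_one h0 ξ]
    have hpsi2 : Real.exp (-t) * (1 - t * ‖ξ‖ ^ 2) ≤ Real.exp (-t * psi α ξ) := by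
      have h8 : -t + -(t * ‖ξ‖ ^ 2) ≤ -t * psi α ξ := by nlinarith [psi_le h2 ξ]
      refine le_trans ?_ (Real.exp_le_exp.2 h8)
      rw [Real.exp_add]
      refine mul_le_mul_of_nonneg_left ?_ (Real.exp_pos _).le
      linarith [Real.add_one_le_exp (-(t * ‖ξ‖ ^ 2))]
    have hcos : 1 - c ≤ ‖a - x‖ ^ 2 / 2 * ‖ξ‖ ^ 2 := by
      have h9 := Real.one_sub_sq_div_two_le_cos (x := ⟪a - x, ξ⟫)
      have h10 : ⟪a - x, ξ⟫ ^ 2 ≤ (‖a - x‖ * ‖ξ‖) ^ 2 :=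
        sq_le_sq' (by have := abs_le.1 (abs_real_inner_le_norm (a - x) ξ); linarith [this.1])
          (real_inner_le_norm _ _)
      rw [mul_pow] at h10
      linarith
    have hc1 : c ≤ 1 := Real.cos_le_one _
    have het : Real.exp (-t) ≤ 1 := by rw [Real.exp_le_one_iff]; linarith
    have hq0 := Real.exp_pos (-t * psi α ξ)
    have hmain : Real.exp (-t) - K * ‖ξ‖ ^ 2 ≤ c * Real.exp (-t * psi α ξ) := by
      have h11 : Real.exp (-t * psi α ξ) - (1 - c) ≤ c * Real.exp (-t * psi α ξ) := by nlinarith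
      have h12 : Real.exp (-t) * (t * ‖ξ‖ ^ 2) ≤ t * ‖ξ‖ ^ 2 :=
        mul_le_of_le_one_left (by positivity) het
      rw [hK]; nlinarith
    have := mul_le_mul_of_nonneg_right hmain hE0.le
    have h13 := mul_le_mul_of_nonneg_left h3 hK0
    nlinarith
  rw [integral_sub ((integrable_gauss hv).const_mul _)
      ((integrable_gauss (half_pos hv)).const_mul _), integral_const_mul, integral_const_mul,
      integral_gauss hv, integral_gauss (half_pos hv)] at hlow
  have hA : 0 ≤ (v / π) ^ ((d : ℝ) / 2) := by positivity
  have := mul_le_mul_of_nonneg_left hlow hA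
  refine le_trans (le_of_eq ?_) this
  have e5 : (π / (v / 2)) ^ ((d : ℝ) / 2) = 2 ^ ((d : ℝ) / 2) * (π / v) ^ ((d : ℝ) / 2) := by
    rw [← Real.mul_rpow (by positivity) (by positivity)]; congr 1; field_simp
  rw [e5, mul_sub]
  have e6 := gauss_norm_const (d := d) hv
  linear_combination (K * (2 / v) * 2 ^ ((d : ℝ) / 2) - Real.exp (-t)) * e6

lemma relKernel_meas_right {d : ℕ} (α t : ℝ) (x : Ed d) :
    Measurable (fun y : Ed d => relKernel d α 1 t x y) :=
  (relKernel_meas d α).comp (f := fun y : Ed d => (t, x, y)) (by fun_prop)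

lemma kernel_mass {d : ℕ} {α t : ℝ} (h0 : 0 < α) (h2 : α < 2) (ht : 0 < t) (x : Ed d) :
    ∫⁻ y : Ed d, ENNReal.ofReal (relKernel d α 1 t x y) ≤ 1 := by
  have hm := relKernel_meas_right α t x
  have hlim : ∀ y : Ed d, Tendsto (fun n : ℕ => ENNReal.ofReal (relKernel d α 1 t x y *
      Real.exp (-(1 / (4 * ((n : ℝ) + 1))) * ‖y - x‖ ^ 2))) atTop
      (nhds (ENNReal.ofReal (relKernel d α 1 t x y))) := by
    intro y
    refine ENNReal.tendsto_ofReal ?_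
    have h1 : Tendsto (fun n : ℕ => -(1 / 4 * (1 / ((n : ℝ) + 1))) * ‖y - x‖ ^ 2) atTop
        (nhds (-(1 / 4 * 0) * ‖y - x‖ ^ 2)) :=
      (((tendsto_one_div_add_atTop_nhds_zero_nat (𝕜 := ℝ)).const_mul (1 / 4)).neg).mul_const _
    have h2 := ((Real.continuous_exp.tendsto _).comp h1).const_mul (relKernel d α 1 t x y)
    simp only [mul_zero, neg_zero, zero_mul, Real.exp_zero, mul_one] at h2
    refine h2.congr fun n => ?_
    simp only [Function.comp]
    congr 3
    field_simp
  calc ∫⁻ y : Ed d, ENNReal.ofReal (relKernel d α 1 t x y)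
      = ∫⁻ y : Ed d, liminf (fun n : ℕ => ENNReal.ofReal (relKernel d α 1 t x y *
      Real.exp (-(1 / (4 * ((n : ℝ) + 1))) * ‖y - x‖ ^ 2))) atTop :=
        lintegral_congr fun y => ((hlim y).liminf_eq).symm
    _ ≤ liminf (fun n : ℕ => ∫⁻ y : Ed d, ENNReal.ofReal (relKernel d α 1 t x y *
      Real.exp (-(1 / (4 * ((n : ℝ) + 1))) * ‖y - x‖ ^ 2))) atTop :=
        lintegral_liminf_le (fun n => by fun_prop)
    _ ≤ 1 := by
      refine liminf_le_of_le (by isBoundedDefault) fun b hb => ?_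
      obtain ⟨n, hn⟩ := hb.exists
      refine hn.trans ?_
      rw [← ofReal_integral_eq_lintegral_ofReal
        (kernel_gauss h0 ht (by positivity : (0 : ℝ) < (n : ℝ) + 1) x x).1
        (Eventually.of_forall fun y => mul_nonneg (relKernel_nonneg h0 h2 ht x y)
          (Real.exp_pos _).le)]
      exact ENNReal.ofReal_le_one.2 (kernel_gauss_le_one h0 h2 ht (by positivity) x x)

lemma kernel_integrable {d : ℕ} {α t : ℝ} (h0 : 0 < α) (h2 : α < 2) (ht : 0 < t) (x : Ed d) :
    Integrable (fun y : Ed d => relKernel d α 1 t x y) := by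
  refine ⟨(relKernel_meas_right α t x).aestronglyMeasurable, ?_⟩
  rw [hasFiniteIntegral_iff_ofReal (Eventually.of_forall fun y => relKernel_nonneg h0 h2 ht x y)]
  exact (kernel_mass h0 h2 ht x).trans_lt ENNReal.one_lt_top

lemma kernel_integral_le {d : ℕ} {α t : ℝ} (h0 : 0 < α) (h2 : α < 2) (ht : 0 < t) (x : Ed d) :
    ∫ y : Ed d, relKernel d α 1 t x y ≤ 1 := by
  rw [integral_eq_lintegral_of_nonneg_ae
    (Eventually.of_forall fun y => relKernel_nonneg h0 h2 ht x y)
    (relKernel_meas_right α t x).aestronglyMeasurable]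
  exact ENNReal.toReal_le_of_le_ofReal zero_le_one (by simpa using kernel_mass h0 h2 ht x)


/-! ### Part 4: the supersolution -/

/-- Regularised ground state. -/
def Hf (d : ℕ) (b ε : ℝ) (y : Ed d) : ENNReal :=
  ∫⁻ w in Ioi (0 : ℝ), ENNReal.ofReal (w ^ (b - 1) *
    ((w + ε) ^ (-((d : ℝ) / 2)) * Real.exp (-(w + ε) - ‖y‖ ^ 2 / (4 * (w + ε)))))

lemma Hf_meas (d : ℕ) (b ε : ℝ) : Measurable (Hf d b ε) := by
  unfold Hf
  refine Measurable.lintegral_prod_right' (f := fun q : Ed d × ℝ => ENNReal.ofReal (q.2 ^ (b - 1) *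
    ((q.2 + ε) ^ (-((d : ℝ) / 2)) * Real.exp (-(q.2 + ε) - ‖q.1‖ ^ 2 / (4 * (q.2 + ε)))))) ?_
  fun_prop

/-- Fourier side of the ground state. -/
def JJ {d : ℕ} (α t b ε : ℝ) (x : Ed d) : ℝ :=
  ∫ ξ : Ed d, Real.cos ⟪x, ξ⟫ * Real.exp (-t * psi α ξ) *
    (Real.exp (-ε * (1 + ‖ξ‖ ^ 2)) * ((1 / (1 + ‖ξ‖ ^ 2)) ^ b * Real.Gamma b))

lemma mixA {d : ℕ} {α t b ε : ℝ} (h0 : 0 < α) (h2 : α < 2) (ht : 0 ≤ t) (hb : 0 < b) (hε : 0 < ε)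
    (x : Ed d) :
    0 ≤ JJ α t b ε x ∧
    ∫⁻ w in Ioi (0 : ℝ), ENNReal.ofReal (w ^ (b - 1) * Real.exp (-(w + ε)) * GG α t (w + ε) x)
      = ENNReal.ofReal (JJ α t b ε x) := by
  have hpc := psi_cont (d := d) α
  have hF : Integrable (Function.uncurry fun (w : ℝ) (ξ : Ed d) =>
      (w ^ (b - 1) * Real.exp (-(w + ε))) * (Real.cos ⟪x, ξ⟫ * Real.exp (-(w + ε) * ‖ξ‖ ^ 2) *
        Real.exp (-t * psi α ξ))) ((volume.restrict (Ioi 0)).prod volume) := by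
    have h1 := (integrableOn_gam hb one_pos).integrable.mul_prod (integrable_gauss (d := d) hε)
    refine h1.mono' (Measurable.aestronglyMeasurable (by unfold Function.uncurry; fun_prop)) ?_
    have : ∀ᵐ q : ℝ × Ed d ∂((volume.restrict (Ioi 0)).prod volume), 0 < q.1 := by
      have h3 : ((volume : Measure ℝ).restrict (Ioi 0)).prod (volume : Measure (Ed d))
        = (volume.prod volume).restrict (Ioi 0 ×ˢ univ) := by
        rw [← Measure.prod_restrict, Measure.restrict_univ]
      rw [h3]
      refine (ae_restrict_iff' (measurableSet_Ioi.prod MeasurableSet.univ)).2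
        (Eventually.of_forall fun q hq => hq.1)
    filter_upwards [this] with q hq
    simp only [Function.uncurry]
    have hw : 0 ≤ q.1 ^ (b - 1) := by positivity
    rw [Real.norm_eq_abs, abs_mul, abs_mul, abs_mul, abs_mul, abs_of_pos (Real.exp_pos _),
      abs_of_pos (Real.exp_pos _), abs_of_pos (Real.exp_pos _), abs_of_nonneg hw]
    have e1 : Real.exp (-t * psi α q.2) ≤ 1 := by
      rw [Real.exp_le_one_iff]; nlinarith [psi_ge_one h0 q.2]
    have e2 : Real.exp (-(q.1 + ε) * ‖q.2‖ ^ 2) ≤ Real.exp (-ε * ‖q.2‖ ^ 2) := by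
      rw [Real.exp_le_exp]; nlinarith [sq_nonneg ‖q.2‖, mul_nonneg hq.le (sq_nonneg ‖q.2‖)]
    have e3 : Real.exp (-(q.1 + ε)) ≤ Real.exp (-(1 * q.1)) := by
      rw [Real.exp_le_exp]; linarith
    have e4 := Real.abs_cos_le_one ⟪x, q.2⟫
    calc _ ≤ q.1 ^ (b - 1) * Real.exp (-(1 * q.1)) * (1 * Real.exp (-ε * ‖q.2‖ ^ 2) * 1) := by
          gcongr
      _ = _ := by ring
  have hintg : IntegrableOn (fun w => w ^ (b - 1) * Real.exp (-(w + ε)) * GG α t (w + ε) x)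
      (Ioi 0) := by
    have := hF.integral_prod_left
    refine this.congr (Eventually.of_forall fun w => ?_)
    simp only [GG, Function.uncurry]
    rw [integral_const_mul]
  have hnn : ∀ w ∈ Ioi (0 : ℝ), 0 ≤ w ^ (b - 1) * Real.exp (-(w + ε)) * GG α t (w + ε) x := by
    intro w hw
    have hw' : 0 < w := hw
    have := GG_nonneg (d := d) h0 h2 ht (by linarith : 0 < w + ε) x
    positivity
  have hval : ∫ w in Ioi (0 : ℝ), w ^ (b - 1) * Real.exp (-(w + ε)) * GG α t (w + ε) x
      = JJ α t b ε x := by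
    have e1 : ∀ w : ℝ, w ^ (b - 1) * Real.exp (-(w + ε)) * GG α t (w + ε) x = ∫ ξ : Ed d,
      (w ^ (b - 1) * Real.exp (-(w + ε))) * (Real.cos ⟪x, ξ⟫ * Real.exp (-(w + ε) * ‖ξ‖ ^ 2) *
        Real.exp (-t * psi α ξ)) := by
      intro w; unfold GG; rw [integral_const_mul]
    simp_rw [e1]
    rw [integral_integral_swap hF]
    unfold JJ
    refine integral_congr_ae (Eventually.of_forall fun ξ => ?_)
    simp only
    rw [← Real.integral_rpow_mul_exp_neg_mul_Ioi hb (by positivity : 0 < 1 + ‖ξ‖ ^ 2),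
      ← integral_const_mul, ← integral_const_mul]
    refine integral_congr_ae (Eventually.of_forall fun w => ?_)
    simp only
    have : Real.exp (-(w + ε)) * Real.exp (-(w + ε) * ‖ξ‖ ^ 2)
        = Real.exp (-ε * (1 + ‖ξ‖ ^ 2)) * Real.exp (-((1 + ‖ξ‖ ^ 2) * w)) := by
      rw [← Real.exp_add, ← Real.exp_add]; congr 1; ring
    linear_combination (w ^ (b - 1) * Real.cos ⟪x, ξ⟫ * Real.exp (-t * psi α ξ)) * this
  constructor
  · rw [← hval]; exact setIntegral_nonneg measurableSet_Ioi hnn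
  · rw [← hval, ofReal_integral_eq_lintegral_ofReal hintg
      ((ae_restrict_iff' measurableSet_Ioi).2 (Eventually.of_forall hnn))]

lemma JJ_neg {d : ℕ} (α t b ε : ℝ) (x : Ed d) : JJ α t b ε (-x) = JJ α t b ε x := by
  unfold JJ; simp [inner_neg_left]

lemma Hf_eq {d : ℕ} {α b ε : ℝ} (h0 : 0 < α) (h2 : α < 2) (hb : 0 < b) (hε : 0 < ε) (y : Ed d) :
    Hf d b ε y = ENNReal.ofReal (π ^ (-((d : ℝ) / 2)) * JJ α 0 b ε y) := by
  have hpi := Real.pi_pos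
  rw [ENNReal.ofReal_mul (by positivity), ← (mixA h0 h2 le_rfl hb hε y).2,
    ← lintegral_const_mul' _ _ ENNReal.ofReal_ne_top]
  unfold Hf
  refine setLIntegral_congr_fun measurableSet_Ioi fun w hw => ?_
  have hw' : 0 < w := hw
  have hv : 0 < w + ε := by linarith
  rw [← ENNReal.ofReal_mul (by positivity)]
  congr 1
  have : GG α 0 (w + ε) y = (π / (w + ε)) ^ ((d : ℝ) / 2) * Real.exp (-‖y‖ ^ 2 / (4 * (w + ε))) := by
    unfold GG; simp only [neg_zero, zero_mul, Real.exp_zero, mul_one]; rw [gauss_cos0 hv]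
  rw [this, Real.div_rpow hpi.le hv.le, Real.rpow_neg hv.le, Real.rpow_neg hpi.le,
    sub_eq_add_neg (-(w + ε)), Real.exp_add, neg_div]
  have : 0 < π ^ ((d : ℝ) / 2) := by positivity
  have : 0 < (w + ε) ^ ((d : ℝ) / 2) := by positivity
  field_simp

lemma kernel_Hf {d : ℕ} {α t b ε : ℝ} (h0 : 0 < α) (h2 : α < 2) (ht : 0 < t) (hb : 0 < b)
    (hε : 0 < ε) (x : Ed d) :
    ∫⁻ y, ENNReal.ofReal (relKernel d α 1 t x y) * Hf d b ε y
      = ENNReal.ofReal (π ^ (-((d : ℝ) / 2)) * JJ α t b ε x) := by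
  have hpi := Real.pi_pos
  have hm := relKernel_meas_right α t x
  rw [ENNReal.ofReal_mul (by positivity), ← JJ_neg, ← (mixA h0 h2 ht.le hb hε (-x)).2,
    ← lintegral_const_mul' _ _ ENNReal.ofReal_ne_top]
  unfold Hf
  simp_rw [← lintegral_const_mul' _ _ ENNReal.ofReal_ne_top]
  rw [lintegral_lintegral_swap (by unfold Function.uncurry; fun_prop)]
  refine setLIntegral_congr_fun measurableSet_Ioi fun w hw => ?_
  have hw' : 0 < w := hw
  have hv : 0 < w + ε := by linarith
  obtain ⟨ki, kv⟩ := kernel_gauss h0 ht hv x 0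
  have e1 : ∀ y : Ed d, ENNReal.ofReal (relKernel d α 1 t x y) * ENNReal.ofReal (w ^ (b - 1) *
      ((w + ε) ^ (-((d : ℝ) / 2)) * Real.exp (-(w + ε) - ‖y‖ ^ 2 / (4 * (w + ε)))))
      = ENNReal.ofReal (w ^ (b - 1) * ((w + ε) ^ (-((d : ℝ) / 2)) * Real.exp (-(w + ε)))) *
        ENNReal.ofReal (relKernel d α 1 t x y * Real.exp (-(1 / (4 * (w + ε))) * ‖y - 0‖ ^ 2)) := by
    intro y
    have := relKernel_nonneg h0 h2 ht x y
    rw [← ENNReal.ofReal_mul this, ← ENNReal.ofReal_mul (by positivity)]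
    congr 1
    have : Real.exp (-(w + ε) - ‖y‖ ^ 2 / (4 * (w + ε))) = Real.exp (-(w + ε)) *
        Real.exp (-(1 / (4 * (w + ε))) * ‖y - 0‖ ^ 2) := by
      rw [← Real.exp_add, sub_zero]; congr 1; ring
    rw [this]; ring
  simp_rw [e1]
  rw [lintegral_const_mul' _ _ ENNReal.ofReal_ne_top, ← ofReal_integral_eq_lintegral_ofReal ki
    (Eventually.of_forall fun y => mul_nonneg (relKernel_nonneg h0 h2 ht x y)
          (Real.exp_pos _).le), kv, ← ENNReal.ofReal_mul (by positivity),
          ← ENNReal.ofReal_mul (by positivity), zero_sub]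
  congr 1
  rw [Real.div_rpow hv.le hpi.le, Real.rpow_neg hv.le, Real.rpow_neg hpi.le]
  have : 0 < π ^ ((d : ℝ) / 2) := by positivity
  have : 0 < (w + ε) ^ ((d : ℝ) / 2) := by positivity
  field_simp

lemma JJ_integrable {d : ℕ} {α t b ε : ℝ} (h0 : 0 < α) (ht : 0 ≤ t) (hb : 0 < b) (hε : 0 < ε)
    (x : Ed d) : Integrable (fun ξ : Ed d => Real.cos ⟪x, ξ⟫ * Real.exp (-t * psi α ξ) *
    (Real.exp (-ε * (1 + ‖ξ‖ ^ 2)) * ((1 / (1 + ‖ξ‖ ^ 2)) ^ b * Real.Gamma b))) := by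
  have hpc := psi_cont (d := d) α
  have hG := Real.Gamma_pos_of_pos hb
  refine ((integrable_gauss (d := d) hε).const_mul (Real.Gamma b)).mono'
    (Measurable.aestronglyMeasurable (by fun_prop)) (Eventually.of_forall fun ξ => ?_)
  have hr : 0 ≤ ‖ξ‖ ^ 2 := by positivity
  have hq : 0 ≤ (1 / (1 + ‖ξ‖ ^ 2)) ^ b := by positivity
  rw [Real.norm_eq_abs, abs_mul, abs_mul, abs_mul, abs_mul, abs_of_pos (Real.exp_pos _),
    abs_of_pos (Real.exp_pos _), abs_of_pos hG, abs_of_nonneg hq]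
  have e1 : Real.exp (-t * psi α ξ) ≤ 1 := by
    rw [Real.exp_le_one_iff]; nlinarith [psi_ge_one h0 ξ]
  have e2 : Real.exp (-ε * (1 + ‖ξ‖ ^ 2)) ≤ Real.exp (-ε * ‖ξ‖ ^ 2) := by
    rw [Real.exp_le_exp]; nlinarith
  have e3 : (1 / (1 + ‖ξ‖ ^ 2)) ^ b ≤ 1 := by
    refine Real.rpow_le_one (by positivity) ?_ hb.le
    rw [div_le_one (by positivity)]; linarith
  have e4 := Real.abs_cos_le_one ⟪x, ξ⟫
  calc _ ≤ 1 * 1 * (Real.exp (-ε * ‖ξ‖ ^ 2) * (1 * Real.Gamma b)) := by gcongr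
    _ = _ := by ring

lemma JJ_time {d : ℕ} {α t b ε : ℝ} (h0 : 0 < α) (ht : 0 < t) (hb : α / 2 < b)
    (hε : 0 < ε) (x : Ed d) :
    IntegrableOn (fun s => JJ α s (b - α / 2) ε x) (Ioo 0 t) ∧
    ∫ s in Ioo 0 t, JJ α s (b - α / 2) ε x
      = Real.Gamma (b - α / 2) / Real.Gamma b * (JJ α 0 b ε x - JJ α t b ε x) := by
  have hpc := psi_cont (d := d) α
  have hb0 : 0 < b := by linarith
  have hb' : 0 < b - α / 2 := by linarith
  have hG := Real.Gamma_pos_of_pos hb0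
  have hF : Integrable (Function.uncurry fun (s : ℝ) (ξ : Ed d) =>
      Real.cos ⟪x, ξ⟫ * Real.exp (-s * psi α ξ) *
    (Real.exp (-ε * (1 + ‖ξ‖ ^ 2)) * ((1 / (1 + ‖ξ‖ ^ 2)) ^ (b - α / 2) * Real.Gamma (b - α / 2))))
      ((volume.restrict (Ioo 0 t)).prod volume) := by
    have h1 := (integrable_const (μ := volume.restrict (Ioo 0 t)) (1 : ℝ)).mul_prod
      (JJ_integrable (d := d) h0 le_rfl hb' hε x).norm
    refine h1.mono' (Measurable.aestronglyMeasurable (by unfold Function.uncurry; fun_prop)) ?_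
    have : ∀ᵐ q : ℝ × Ed d ∂((volume.restrict (Ioo 0 t)).prod volume), 0 < q.1 := by
      have h3 : ((volume : Measure ℝ).restrict (Ioo 0 t)).prod (volume : Measure (Ed d))
        = (volume.prod volume).restrict (Ioo 0 t ×ˢ univ) := by
        rw [← Measure.prod_restrict, Measure.restrict_univ]
      rw [h3]
      refine (ae_restrict_iff' (measurableSet_Ioo.prod MeasurableSet.univ)).2
        (Eventually.of_forall fun q hq => hq.1.1)
    filter_upwards [this] with q hq
    simp only [Function.uncurry, neg_zero, zero_mul, Real.exp_zero, mul_one, one_mul]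
    have e1 : Real.exp (-q.1 * psi α q.2) ≤ 1 := by
      rw [Real.exp_le_one_iff]; nlinarith [psi_ge_one h0 q.2]
    generalize Real.exp (-ε * (1 + ‖q.2‖ ^ 2)) * ((1 / (1 + ‖q.2‖ ^ 2)) ^ (b - α / 2) *
      Real.Gamma (b - α / 2)) = A
    rw [Real.norm_eq_abs, Real.norm_eq_abs, abs_mul, abs_mul, abs_mul, abs_of_pos (Real.exp_pos _)]
    calc _ ≤ |Real.cos ⟪x, q.2⟫| * 1 * |A| := by gcongr
      _ = _ := by ring
  refine ⟨hF.integral_prod_left, ?_⟩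
  unfold JJ
  rw [integral_integral_swap hF, ← integral_sub (JJ_integrable h0 le_rfl hb0 hε x)
    (JJ_integrable h0 ht.le hb0 hε x), ← integral_const_mul]
  refine integral_congr_ae (Eventually.of_forall fun ξ => ?_)
  simp only
  have hp : 0 < psi α ξ := lt_of_lt_of_le one_pos (psi_ge_one h0 ξ)
  have e1 : ∫ s in Ioo 0 t, Real.exp (-s * psi α ξ) = (1 - Real.exp (-t * psi α ξ)) / psi α ξ := by
    rw [← integral_Ioc_eq_integral_Ioo, ← intervalIntegral.integral_of_le ht.le]
    have hd : ∀ s ∈ uIcc 0 t,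
          HasDerivAt (fun s : ℝ => -Real.exp (-s * psi α ξ) / psi α ξ) (Real.exp (-s * psi α ξ)) s := by
      intro s _
      have h2 := (((((hasDerivAt_id s).neg).mul_const (psi α ξ)).exp).neg).div_const (psi α ξ)
      refine h2.congr_deriv ?_
      simp only [id, Pi.neg_apply]; field_simp
    rw [intervalIntegral.integral_eq_sub_of_hasDerivAt hd
        (Continuous.intervalIntegrable (by fun_prop) _ _)]
    simp only [neg_zero, zero_mul, Real.exp_zero]; ring
  have e2 : (1 / (1 + ‖ξ‖ ^ 2)) ^ (b - α / 2) = (1 / (1 + ‖ξ‖ ^ 2)) ^ b * psi α ξ := by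
    unfold psi
    rw [Real.rpow_sub (by positivity), one_div, Real.inv_rpow (by positivity) (α / 2), div_inv_eq_mul,
      add_comm (‖ξ‖ ^ 2) 1]
  have e3 : ∀ s, Real.cos ⟪x, ξ⟫ * Real.exp (-s * psi α ξ) *
    (Real.exp (-ε * (1 + ‖ξ‖ ^ 2)) * ((1 / (1 + ‖ξ‖ ^ 2)) ^ (b - α / 2) * Real.Gamma (b - α / 2)))
    = (Real.cos ⟪x, ξ⟫ * (Real.exp (-ε * (1 + ‖ξ‖ ^ 2)) * ((1 / (1 + ‖ξ‖ ^ 2)) ^ (b - α / 2) *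
      Real.Gamma (b - α / 2)))) * Real.exp (-s * psi α ξ) := fun s => by ring
  simp_rw [e3]
  rw [integral_const_mul, e1, e2]
  simp only [neg_zero, zero_mul, Real.exp_zero]
  field_simp

lemma super_eps {d : ℕ} {α t b ε : ℝ} (h0 : 0 < α) (h2 : α < 2) (ht : 0 < t) (hb : α / 2 < b)
    (hε : 0 < ε) (x : Ed d) :
    (∫⁻ y, ENNReal.ofReal (relKernel d α 1 t x y) * Hf d b ε y) +
      ∫⁻ s in Ioo 0 t, ∫⁻ y, ENNReal.ofReal (relKernel d α 1 s x y) *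
        (ENNReal.ofReal (Real.Gamma b / Real.Gamma (b - α / 2)) * Hf d (b - α / 2) ε y)
      = Hf d b ε x := by
  have hpi := Real.pi_pos
  have hb0 : 0 < b := by linarith
  have hb' : 0 < b - α / 2 := by linarith
  have hG := Real.Gamma_pos_of_pos hb0
  have hG' := Real.Gamma_pos_of_pos hb'
  obtain ⟨hi, hv⟩ := JJ_time (d := d) h0 ht hb hε x
  have e1 : ∀ s ∈ Ioo 0 t, ∫⁻ y, ENNReal.ofReal (relKernel d α 1 s x y) *
        (ENNReal.ofReal (Real.Gamma b / Real.Gamma (b - α / 2)) * Hf d (b - α / 2) ε y)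
        = ENNReal.ofReal (Real.Gamma b / Real.Gamma (b - α / 2) * π ^ (-((d : ℝ) / 2))) *
          ENNReal.ofReal (JJ α s (b - α / 2) ε x) := by
    intro s hs
    simp_rw [mul_left_comm _ (ENNReal.ofReal (Real.Gamma b / Real.Gamma (b - α / 2)))]
    rw [lintegral_const_mul' _ _ ENNReal.ofReal_ne_top, kernel_Hf h0 h2 hs.1 hb' hε,
      ← ENNReal.ofReal_mul (by positivity), ← ENNReal.ofReal_mul (by positivity), mul_assoc]
  rw [setLIntegral_congr_fun measurableSet_Ioo e1, lintegral_const_mul' _ _ ENNReal.ofReal_ne_top,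
    ← ofReal_integral_eq_lintegral_ofReal hi ((ae_restrict_iff' measurableSet_Ioo).2
      (Eventually.of_forall fun s hs => (mixA h0 h2 hs.1.le hb' hε x).1)), hv,
      kernel_Hf h0 h2 ht hb0 hε, Hf_eq h0 h2 hb0 hε, ← ENNReal.ofReal_mul (by positivity),
      ← ENNReal.ofReal_add]
  · congr 1
    generalize Real.Gamma (b - α / 2) = g at *
    field_simp
    ring
  · exact mul_nonneg (by positivity) (mixA h0 h2 ht.le hb0 hε x).1
  · rw [← hv]
    refine mul_nonneg (by positivity) (setIntegral_nonneg measurableSet_Ioo fun s hs =>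
      (mixA h0 h2 hs.1.le hb' hε x).1)


/-! ### Part 5: limits, and properties of the potential -/

lemma rpow_exp_bound {p c : ℝ} (hp : 0 < p) (hc : 0 < c) :
    ∃ C : ℝ, 0 < C ∧ ∀ u : ℝ, 0 < u → u ^ (-p) * Real.exp (-(c / u)) ≤ C := by
  refine ⟨(p / c) ^ p, by positivity, fun u hu => ?_⟩
  have h1 : (c / (p * u)) ^ p ≤ Real.exp (c / u) := by
    have h2 : c / (p * u) ≤ Real.exp (c / (p * u)) := by
      linarith [Real.add_one_le_exp (c / (p * u))]
    calc (c / (p * u)) ^ p ≤ (Real.exp (c / (p * u))) ^ p :=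
          Real.rpow_le_rpow (by positivity) h2 hp.le
      _ = Real.exp (c / u) := by
          rw [← Real.exp_mul]; congr 1; field_simp
  have h3 : u ^ (-p) = (p / c) ^ p * (c / (p * u)) ^ p := by
    rw [← Real.mul_rpow (by positivity) (by positivity), Real.rpow_neg hu.le, ← Real.inv_rpow hu.le]
    congr 1; field_simp
  rw [h3, Real.exp_neg]
  have := Real.exp_pos (c / u)
  rw [mul_assoc]
  refine mul_le_of_le_one_right (by positivity) ?_
  rw [← div_eq_mul_inv, div_le_one this]; exact h1

lemma Hf_bound {d : ℕ} (hd : 0 < d) {y : Ed d} (hy : y ≠ 0) (b : ℝ) :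
    ∃ C : ℝ, 0 < C ∧ ∀ ε : ℝ, 0 ≤ ε → ∀ w : ℝ, 0 < w → w ^ (b - 1) *
    ((w + ε) ^ (-((d : ℝ) / 2)) * Real.exp (-(w + ε) - ‖y‖ ^ 2 / (4 * (w + ε))))
      ≤ C * (w ^ (b - 1) * Real.exp (-(1 * w))) := by
  have hy' : 0 < ‖y‖ := norm_pos_iff.2 hy
  have hd' : (0 : ℝ) < d := by exact_mod_cast hd
  obtain ⟨C, hC, h⟩ := rpow_exp_bound (p := (d : ℝ) / 2) (c := ‖y‖ ^ 2 / 4) (by positivity) (by positivity)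
  refine ⟨C, hC, fun ε hε w hw => ?_⟩
  have h1 := h (w + ε) (by linarith)
  have e1 : Real.exp (-(w + ε) - ‖y‖ ^ 2 / (4 * (w + ε))) = Real.exp (-(w + ε)) *
      Real.exp (-(‖y‖ ^ 2 / 4 / (w + ε))) := by
    rw [← Real.exp_add]; congr 1
    have : w + ε ≠ 0 := by linarith
    field_simp; ring
  have e3 : Real.exp (-(w + ε)) ≤ Real.exp (-(1 * w)) := by
    rw [Real.exp_le_exp]; linarith
  rw [e1]
  calc _ = w ^ (b - 1) * (((w + ε) ^ (-((d : ℝ) / 2)) * Real.exp (-(‖y‖ ^ 2 / 4 / (w + ε))))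
        * Real.exp (-(w + ε))) := by ring
    _ ≤ w ^ (b - 1) * (C * Real.exp (-(1 * w))) := by gcongr
    _ = _ := by ring

lemma Hf_tendsto {d : ℕ} (hd : 0 < d) {y : Ed d} (hy : y ≠ 0) {b : ℝ} (hb : 0 < b) :
    Tendsto (fun n : ℕ => Hf d b (1 / ((n : ℝ) + 1)) y) atTop (nhds (Hf d b 0 y)) := by
  obtain ⟨C, hC, h⟩ := Hf_bound hd hy b
  unfold Hf
  refine tendsto_lintegral_of_dominated_convergence
    (fun w => ENNReal.ofReal (C * (w ^ (b - 1) * Real.exp (-(1 * w))))) (fun n => by fun_prop)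
    (fun n => ?_) ?_ ?_
  · refine (ae_restrict_iff' measurableSet_Ioi).2 (Eventually.of_forall fun w hw => ?_)
    exact ENNReal.ofReal_le_ofReal (h _ (by positivity) w hw)
  · exact ((integrableOn_gam hb one_pos).const_mul C).lintegral_lt_top.ne
  · refine (ae_restrict_iff' measurableSet_Ioi).2 (Eventually.of_forall fun w hw => ?_)
    have hw' : 0 < w := hw
    refine (ENNReal.continuous_ofReal.tendsto _).comp ?_
    have hc : ContinuousAt (fun ε : ℝ => w ^ (b - 1) *
      ((w + ε) ^ (-((d : ℝ) / 2)) * Real.exp (-(w + ε) - ‖y‖ ^ 2 / (4 * (w + ε))))) 0 := by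
      have h1 : ContinuousAt (fun ε : ℝ => (w + ε) ^ (-((d : ℝ) / 2))) 0 :=
        ContinuousAt.rpow_const (by fun_prop) (Or.inl (by simpa using hw'.ne'))
      have h2 : ContinuousAt (fun ε : ℝ => ‖y‖ ^ 2 / (4 * (w + ε))) 0 :=
        ContinuousAt.div (by fun_prop) (by fun_prop) (by simpa using hw'.ne')
      have h3 : ContinuousAt (fun ε : ℝ => -(w + ε)) 0 := by fun_prop
      exact continuousAt_const.mul (h1.mul (Real.continuous_exp.continuousAt.comp (h3.sub h2)))
    exact hc.tendsto.comp tendsto_one_div_add_atTop_nhds_zero_nat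

lemma Hf_ne_top {d : ℕ} (hd : 0 < d) {y : Ed d} (hy : y ≠ 0) {b : ℝ} (hb : 0 < b) :
    Hf d b 0 y ≠ ⊤ := by
  obtain ⟨C, hC, h⟩ := Hf_bound hd hy b
  refine ne_top_of_le_ne_top
    ((integrableOn_gam hb one_pos).const_mul C).lintegral_lt_top.ne ?_
  exact setLIntegral_mono' measurableSet_Ioi fun w hw =>
    ENNReal.ofReal_le_ofReal (h 0 le_rfl w hw)

lemma ae_ne_zero {d : ℕ} (hd : 0 < d) : ∀ᵐ y : Ed d, y ≠ 0 := by
  have : Nonempty (Fin d) := ⟨⟨0, hd⟩⟩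
  have : Nontrivial (Ed d) := inferInstance
  exact Measure.ae_ne volume 0

lemma fatou_lim {Ω : Type*} [MeasurableSpace Ω] (μ : Measure Ω) (f : ℕ → Ω → ENNReal) (g : Ω → ENNReal)
    (hf : ∀ n, Measurable (f n)) (h : ∀ᵐ x ∂μ, Tendsto (fun n => f n x) atTop (nhds (g x))) :
    ∫⁻ x, g x ∂μ ≤ liminf (fun n => ∫⁻ x, f n x ∂μ) atTop := by
  calc ∫⁻ x, g x ∂μ = ∫⁻ x, liminf (fun n => f n x) atTop ∂μ :=
        lintegral_congr_ae (h.mono fun x hx => hx.liminf_eq.symm)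
    _ ≤ _ := lintegral_liminf_le hf

lemma fatou_le {Ω : Type*} [MeasurableSpace Ω] (μ : Measure Ω) (f : ℕ → Ω → ENNReal) (g : Ω → ENNReal)
    (hf : ∀ n, Measurable (f n)) (h : ∀ᵐ x ∂μ, g x ≤ liminf (fun n => f n x) atTop) :
    ∫⁻ x, g x ∂μ ≤ liminf (fun n => ∫⁻ x, f n x ∂μ) atTop :=
  (lintegral_mono_ae h).trans (lintegral_liminf_le hf)

/-- Superadditivity of the lower limit. -/
lemma liminf_add_ennreal {f g : ℕ → ENNReal} :
    liminf f atTop + liminf g atTop ≤ liminf (fun n => f n + g n) atTop := by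
  rw [liminf_eq_iSup_iInf_of_nat, liminf_eq_iSup_iInf_of_nat, liminf_eq_iSup_iInf_of_nat]
  rw [ENNReal.iSup_add_iSup_of_monotone]
  · refine iSup_mono fun n => le_iInf₂ fun i hi => add_le_add (iInf₂_le i hi) (iInf₂_le i hi)
  · exact fun n m h => le_iInf₂ fun i hi => iInf₂_le i (h.trans hi)
  · exact fun n m h => le_iInf₂ fun i hi => iInf₂_le i (h.trans hi)

lemma relKernel_meas_comp {Ω : Type*} [MeasurableSpace Ω] {d : ℕ} (α : ℝ) {f : Ω → ℝ} {g h : Ω → Ed d}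
    (hf : Measurable f) (hg : Measurable g) (hh : Measurable h) :
    Measurable fun ω => relKernel d α 1 (f ω) (g ω) (h ω) := by
  have h : (fun ω => relKernel d α 1 (f ω) (g ω) (h ω)) =
    (fun q : ℝ × Ed d × Ed d => relKernel d α 1 q.1 q.2.1 q.2.2) ∘ (fun ω => (f ω, g ω, h ω)) := by
    funext ω; rfl
  rw [h]
  exact (relKernel_meas d α).comp (hf.prodMk (hg.prodMk hh))

lemma superSol {d : ℕ} (hd : 0 < d) {α t b : ℝ} (h0 : 0 < α) (h2 : α < 2) (ht : 0 < t)
    (hb : α / 2 < b) {x : Ed d} (hx : x ≠ 0) :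
    (∫⁻ y, ENNReal.ofReal (relKernel d α 1 t x y) * Hf d b 0 y) +
      ∫⁻ s in Ioo 0 t, ∫⁻ y, ENNReal.ofReal (relKernel d α 1 s x y) *
        (ENNReal.ofReal (Real.Gamma b / Real.Gamma (b - α / 2)) * Hf d (b - α / 2) 0 y)
      ≤ Hf d b 0 x := by
  have hb0 : 0 < b := by linarith
  have hb' : 0 < b - α / 2 := by linarith
  have hm := relKernel_meas d α
  have hmH : ∀ b ε, Measurable (Hf d b ε) := fun b ε => Hf_meas d b ε
  have hlim : liminf (fun n : ℕ => Hf d b (1 / ((n : ℝ) + 1)) x) atTop = Hf d b 0 x :=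
    (Hf_tendsto hd hx hb0).liminf_eq
  have hms : Measurable fun q : ℝ × Ed d => relKernel d α 1 q.1 x q.2 :=
    relKernel_meas_comp α measurable_fst measurable_const measurable_snd
  have hA : (∫⁻ y, ENNReal.ofReal (relKernel d α 1 t x y) * Hf d b 0 y) ≤
      liminf (fun n : ℕ => ∫⁻ y, ENNReal.ofReal (relKernel d α 1 t x y) *
        Hf d b (1 / ((n : ℝ) + 1)) y) atTop := by
    refine fatou_lim volume (fun (n : ℕ) (y : Ed d) => ENNReal.ofReal (relKernel d α 1 t x y) *
        Hf d b (1 / ((n : ℝ) + 1)) y) _ (fun n => ?_) ?_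
    · exact ((relKernel_meas_right α t x).ennreal_ofReal).mul (hmH _ _)
    · filter_upwards [ae_ne_zero hd] with y hy
      exact ENNReal.Tendsto.const_mul (Hf_tendsto hd hy hb0) (Or.inr ENNReal.ofReal_ne_top)
  have hB : (∫⁻ s in Ioo 0 t, ∫⁻ y, ENNReal.ofReal (relKernel d α 1 s x y) *
        (ENNReal.ofReal (Real.Gamma b / Real.Gamma (b - α / 2)) * Hf d (b - α / 2) 0 y)) ≤
      liminf (fun n : ℕ => ∫⁻ s in Ioo 0 t, ∫⁻ y, ENNReal.ofReal (relKernel d α 1 s x y) *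
        (ENNReal.ofReal (Real.Gamma b / Real.Gamma (b - α / 2)) *
          Hf d (b - α / 2) (1 / ((n : ℝ) + 1)) y)) atTop := by
    refine fatou_le (volume.restrict (Ioo 0 t)) (fun (n : ℕ) (s : ℝ) => ∫⁻ y : Ed d,
        ENNReal.ofReal (relKernel d α 1 s x y) *
        (ENNReal.ofReal (Real.Gamma b / Real.Gamma (b - α / 2)) *
          Hf d (b - α / 2) (1 / ((n : ℝ) + 1)) y)) _ (fun n => ?_) (Eventually.of_forall fun s => ?_)
    · refine Measurable.lintegral_prod_right' (f := fun q : ℝ × Ed d =>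
        ENNReal.ofReal (relKernel d α 1 q.1 x q.2) *
        (ENNReal.ofReal (Real.Gamma b / Real.Gamma (b - α / 2)) *
          Hf d (b - α / 2) (1 / ((n : ℝ) + 1)) q.2)) ?_
      exact (hms.ennreal_ofReal).mul (measurable_const.mul ((hmH _ _).comp measurable_snd))
    · refine fatou_lim volume (fun (n : ℕ) (y : Ed d) => ENNReal.ofReal (relKernel d α 1 s x y) *
        (ENNReal.ofReal (Real.Gamma b / Real.Gamma (b - α / 2)) *
          Hf d (b - α / 2) (1 / ((n : ℝ) + 1)) y)) _ (fun n => ?_) ?_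
      · exact ((relKernel_meas_right α s x).ennreal_ofReal).mul (measurable_const.mul (hmH _ _))
      · filter_upwards [ae_ne_zero hd] with y hy
        exact ENNReal.Tendsto.const_mul (ENNReal.Tendsto.const_mul (Hf_tendsto hd hy hb')
          (Or.inr ENNReal.ofReal_ne_top)) (Or.inr ENNReal.ofReal_ne_top)
  refine (add_le_add hA hB).trans (liminf_add_ennreal.trans (le_of_eq ?_))
  rw [← hlim]
  refine liminf_congr (Eventually.of_forall fun n => ?_)
  exact super_eps h0 h2 ht hb (by positivity : 0 < 1 / ((n : ℝ) + 1)) x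

/-- The integral in the Bessel function. -/
def FK (a r : ℝ) : ℝ := ∫ u in Ioi (0 : ℝ), u ^ (-a - 1) * Real.exp (-u - r ^ 2 / (4 * u))

lemma FK_integrable (a : ℝ) (ha : 0 ≤ a) {r : ℝ} (hr : 0 < r) :
    IntegrableOn (fun u => u ^ (-a - 1) * Real.exp (-u - r ^ 2 / (4 * u))) (Ioi 0) := by
  obtain ⟨C, hC, h⟩ := rpow_exp_bound (p := a + 1) (c := r ^ 2 / 4) (by linarith) (by positivity)
  refine ((integrableOn_gam (c := 1) one_pos one_pos).const_mul C).mono'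
    (Measurable.aestronglyMeasurable (by fun_prop)) ?_
  refine (ae_restrict_iff' measurableSet_Ioi).2 (Eventually.of_forall fun u hu => ?_)
  have hu' : 0 < u := hu
  rw [Real.norm_eq_abs, abs_of_nonneg (by positivity)]
  have e1 : Real.exp (-u - r ^ 2 / (4 * u)) = Real.exp (-u) * Real.exp (-(r ^ 2 / 4 / u)) := by
    rw [← Real.exp_add]; congr 1; field_simp; ring
  rw [e1]
  have := h u hu'
  calc _ = (u ^ (-(a + 1)) * Real.exp (-(r ^ 2 / 4 / u))) * Real.exp (-u) := by
        rw [show -(a + 1) = -a - 1 by ring]; ring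
    _ ≤ C * Real.exp (-u) := by gcongr
    _ = _ := by simp

lemma FK_pos (a : ℝ) (ha : 0 ≤ a) {r : ℝ} (hr : 0 < r) : 0 < FK a r := by
  unfold FK
  refine (setIntegral_pos_iff_support_of_nonneg_ae ?_ (FK_integrable a ha hr)).2 ?_
  · refine (ae_restrict_iff' measurableSet_Ioi).2 (Eventually.of_forall fun u hu => ?_)
    have hu' : 0 < u := hu
    show 0 ≤ _; positivity
  · have : Function.support (fun u : ℝ => u ^ (-a - 1) * Real.exp (-u - r ^ 2 / (4 * u))) ∩ Ioi 0
      = Ioi 0 := by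
      refine inter_eq_right.2 fun u hu => ?_
      have hu' : 0 < u := hu
      simp only [Function.mem_support]; positivity
    rw [this]; simp

lemma FK_nonneg (a r : ℝ) : 0 ≤ FK a r := by
  refine setIntegral_nonneg measurableSet_Ioi fun u hu => ?_
  have hu' : 0 < u := hu
  positivity

lemma FK_meas (a : ℝ) : Measurable (FK a) := by
  unfold FK
  refine StronglyMeasurable.measurable ?_
  refine StronglyMeasurable.integral_prod_right' (f := fun q : ℝ × ℝ =>
    q.2 ^ (-a - 1) * Real.exp (-q.2 - q.1 ^ 2 / (4 * q.2))) ?_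
  refine Measurable.stronglyMeasurable ?_
  fun_prop

lemma FK_compare (a : ℝ) (ha : 0 ≤ a) {β : ℝ} (hβ : 0 < β) :
    ∃ C : ℝ, 0 < C ∧ ∀ r : ℝ, 1 ≤ r → FK (a + β) r ≤ C * FK a r := by
  obtain ⟨C, hC, h⟩ := rpow_exp_bound (p := β) (c := 1 / 8) hβ (by norm_num)
  set D := C * Real.exp 1 * 2 ^ (a + 1) with hD
  have hDp : 0 < D := by positivity
  refine ⟨1 + D * 2⁻¹, by positivity, fun r hr => ?_⟩
  have hr0 : 0 < r := by linarith
  set g : ℝ → ℝ := fun u => u ^ (-a - 1) * Real.exp (-u - r ^ 2 / (4 * u)) with hg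
  have hgi : IntegrableOn g (Ioi 0) := FK_integrable a ha hr0
  have hgi2 : IntegrableOn (fun u => g (2 * u)) (Ioi 0) := by
    rw [integrableOn_Ioi_comp_mul_left_iff g 0 two_pos]; simpa using hgi
  have hg2 : ∫ u in Ioi (0 : ℝ), g (2 * u) = 2⁻¹ * FK a r := by
    rw [integral_comp_mul_left_Ioi g 0 two_pos]; simp [FK, hg]
  have key : FK (a + β) r ≤ ∫ u in Ioi (0 : ℝ), (g u + D * g (2 * u)) := by
    unfold FK
    refine setIntegral_mono_on (FK_integrable _ (by linarith) hr0) (hgi.add (hgi2.const_mul D))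
      measurableSet_Ioi fun u hu => ?_
    have hu' : 0 < u := hu
    have n1 : 0 ≤ g u := by simp only [hg]; positivity
    have n2 : 0 ≤ g (2 * u) := by simp only [hg]; positivity
    have e1 : u ^ (-(a + β) - 1) = u ^ (-a - 1) * u ^ (-β) := by
      rw [← Real.rpow_add hu']; congr 1; ring
    rcases le_or_gt 1 u with hu1 | hu1
    · have : u ^ (-β) ≤ 1 := Real.rpow_le_one_of_one_le_of_nonpos hu1 (by linarith)
      calc _ = u ^ (-β) * g u := by rw [e1]; simp only [hg]; ring
        _ ≤ 1 * g u := by gcongr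
        _ ≤ _ := by nlinarith
    · have h1 := h u hu'
      have e2 : Real.exp (-u - r ^ 2 / (4 * u)) ≤ Real.exp (-(1 / 8 / u)) * Real.exp 1 *
          Real.exp (-(2 * u) - r ^ 2 / (4 * (2 * u))) := by
        rw [← Real.exp_add, ← Real.exp_add, Real.exp_le_exp]
        have : r ^ 2 / (4 * u) = r ^ 2 / (4 * (2 * u)) + r ^ 2 * (1 / 8 / u) := by field_simp; ring
        have h8 : 0 < 1 / 8 / u := by positivity
        nlinarith [mul_nonneg h8.le (by nlinarith : 0 ≤ r ^ 2 - 1)]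
      have e3 : g (2 * u) = 2 ^ (-a - 1) * u ^ (-a - 1) *
          Real.exp (-(2 * u) - r ^ 2 / (4 * (2 * u))) := by
        simp only [hg]; rw [Real.mul_rpow (by norm_num) hu'.le]
      have e4 : (2 : ℝ) ^ (a + 1) * 2 ^ (-a - 1) = 1 := by
        rw [← Real.rpow_add (by norm_num)]; simp
      calc _ ≤ u ^ (-a - 1) * u ^ (-β) * (Real.exp (-(1 / 8 / u)) * Real.exp 1 *
          Real.exp (-(2 * u) - r ^ 2 / (4 * (2 * u)))) := by rw [e1]; gcongr
        _ = (u ^ (-β) * Real.exp (-(1 / 8 / u))) * (u ^ (-a - 1) * Real.exp 1 *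
          Real.exp (-(2 * u) - r ^ 2 / (4 * (2 * u)))) := by ring
        _ ≤ C * (u ^ (-a - 1) * Real.exp 1 *
          Real.exp (-(2 * u) - r ^ 2 / (4 * (2 * u)))) := by gcongr
        _ = D * g (2 * u) := by
          rw [e3, hD]
          linear_combination (-(C * (u ^ (-a - 1) * Real.exp 1 *
          Real.exp (-(2 * u) - r ^ 2 / (4 * (2 * u)))))) * e4
        _ ≤ _ := by linarith
  refine key.trans (le_of_eq ?_)
  rw [integral_add hgi (hgi2.const_mul D), integral_const_mul, hg2]
  have : ∫ u in Ioi (0 : ℝ), g u = FK a r := rfl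
  rw [this]; ring

lemma besselK_eq (ν r : ℝ) : besselK ν r = (1 / 2) * (r / 2) ^ ν * FK ν r := rfl

lemma Vbeta_eq {d : ℕ} {α δ : ℝ} {y : Ed d} (hy : y ≠ 0) :
    Vbeta d α δ y = Real.Gamma (((d : ℝ) - δ) / 2) / Real.Gamma (((d : ℝ) - δ - α) / 2) *
      (FK ((δ + α) / 2) ‖y‖ / FK (δ / 2) ‖y‖) := by
  have hr : 0 < ‖y‖ := norm_pos_iff.2 hy
  unfold Vbeta VProf
  rw [besselK_eq, besselK_eq]
  have e1 : (‖y‖ / 2) ^ ((δ + α) / 2) = (‖y‖ / 2) ^ (δ / 2) * (‖y‖ / 2) ^ (α / 2) := by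
    rw [← Real.rpow_add (by positivity)]; congr 1; ring
  rw [e1, Real.div_rpow hr.le (by norm_num) (α / 2), Real.rpow_neg hr.le]
  have h1 : 0 < (‖y‖ / 2) ^ (δ / 2) := by positivity
  have h2 : 0 < ‖y‖ ^ (α / 2) := by positivity
  have h3 : (0 : ℝ) < 2 ^ (α / 2) := by positivity
  generalize (‖y‖ / 2) ^ (δ / 2) = A at *
  generalize ‖y‖ ^ (α / 2) = B at *
  generalize (2 : ℝ) ^ (α / 2) = C at *
  generalize Real.Gamma (((d : ℝ) - δ) / 2) = G1
  generalize Real.Gamma (((d : ℝ) - δ - α) / 2) = G2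
  have e : 1 / 2 * (A * (B / C)) * FK ((δ + α) / 2) ‖y‖ / (1 / 2 * A * FK (δ / 2) ‖y‖)
    = B / C * (FK ((δ + α) / 2) ‖y‖ / FK (δ / 2) ‖y‖) := by
    rw [show 1 / 2 * (A * (B / C)) * FK ((δ + α) / 2) ‖y‖ = (1 / 2 * A) * (B / C * FK ((δ + α) / 2) ‖y‖) by ring,
      mul_div_mul_left _ _ (by positivity), mul_div_assoc]
  rw [e]
  generalize FK ((δ + α) / 2) ‖y‖ / FK (δ / 2) ‖y‖ = q
  rw [div_eq_mul_inv, div_eq_mul_inv, div_eq_mul_inv]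
  have e5 : C * C⁻¹ = 1 := mul_inv_cancel₀ h3.ne'
  have e6 : B * B⁻¹ = 1 := mul_inv_cancel₀ h2.ne'
  calc _ = (C * C⁻¹) * (B * B⁻¹) * (G1 * G2⁻¹ * q) := by ring
    _ = _ := by rw [e5, e6]; ring

lemma Vbeta_meas (d : ℕ) (α δ : ℝ) : Measurable (Vbeta d α δ) := by
  have h : ∀ ν, Measurable (besselK ν) := by
    intro ν
    have := FK_meas ν
    have e : besselK ν = fun r => (1 / 2) * (r / 2) ^ ν * FK ν r := rfl
    rw [e]; fun_prop
  have h1 := h ((δ + α) / 2)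
  have h2 := h (δ / 2)
  unfold Vbeta VProf
  fun_prop

lemma Vbeta_nonneg {d : ℕ} {α δ : ℝ} (hα : 0 < α) (hδ : δ < d - α) (y : Ed d) :
    0 ≤ Vbeta d α δ y := by
  unfold Vbeta VProf
  rw [besselK_eq, besselK_eq]
  have := FK_nonneg ((δ + α) / 2) ‖y‖
  have := FK_nonneg (δ / 2) ‖y‖
  have := Real.Gamma_pos_of_pos (by linarith : 0 < ((d : ℝ) - δ) / 2)
  have := Real.Gamma_pos_of_pos (by linarith : 0 < ((d : ℝ) - δ - α) / 2)
  positivity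

lemma Vbeta_bounded {d : ℕ} {α δ : ℝ} (hα : 0 < α) (h0 : 0 < δ) (hδ : δ < d - α) :
    ∃ C : ℝ, 0 < C ∧ ∀ y : Ed d, 1 ≤ ‖y‖ → Vbeta d α δ y ≤ C := by
  obtain ⟨C, hC, h⟩ := FK_compare (δ / 2) (by linarith) (by linarith : 0 < α / 2)
  have g1 := Real.Gamma_pos_of_pos (by linarith : 0 < ((d : ℝ) - δ) / 2)
  have g2 := Real.Gamma_pos_of_pos (by linarith : 0 < ((d : ℝ) - δ - α) / 2)
  refine ⟨Real.Gamma (((d : ℝ) - δ) / 2) / Real.Gamma (((d : ℝ) - δ - α) / 2) * C, by positivity,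
    fun y hy => ?_⟩
  have hy0 : 0 < ‖y‖ := by linarith
  rw [Vbeta_eq (norm_pos_iff.1 hy0)]
  refine mul_le_mul_of_nonneg_left ?_ (by positivity)
  rw [div_le_iff₀ (FK_pos _ (by linarith) hy0), show (δ + α) / 2 = δ / 2 + α / 2 by ring]
  exact h _ hy

lemma Hf_zero_eq {d : ℕ} {b : ℝ} (hb : b ≤ d / 2) {y : Ed d} (hy : y ≠ 0) :
    Hf d b 0 y = ENNReal.ofReal (FK ((d : ℝ) / 2 - b) ‖y‖) := by
  have hy' : 0 < ‖y‖ := norm_pos_iff.2 hy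
  unfold FK
  rw [ofReal_integral_eq_lintegral_ofReal (FK_integrable _ (by linarith) hy')]
  · refine setLIntegral_congr_fun measurableSet_Ioi fun w hw => ?_
    have hw' : 0 < w := hw
    rw [add_zero, ← mul_assoc, ← Real.rpow_add hw']
    rw [show b - 1 + -((d : ℝ) / 2) = -((d : ℝ) / 2 - b) - 1 by ring]
  · refine (ae_restrict_iff' measurableSet_Ioi).2 (Eventually.of_forall fun u hu => ?_)
    have hu' : 0 < u := hu
    show 0 ≤ _; positivity

lemma V_mul_Hf {d : ℕ} {α δ : ℝ} (hα : 0 < α) (h0 : 0 < δ) (hδ : δ < d - α) {y : Ed d} (hy : y ≠ 0) :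
    ENNReal.ofReal (Vbeta d α δ y) * Hf d (((d : ℝ) - δ) / 2) 0 y =
      ENNReal.ofReal (Real.Gamma (((d : ℝ) - δ) / 2) / Real.Gamma (((d : ℝ) - δ) / 2 - α / 2)) *
        Hf d (((d : ℝ) - δ) / 2 - α / 2) 0 y := by
  have hy' : 0 < ‖y‖ := norm_pos_iff.2 hy
  have g1 := Real.Gamma_pos_of_pos (by linarith : 0 < ((d : ℝ) - δ) / 2)
  have g2 := Real.Gamma_pos_of_pos (by linarith : 0 < ((d : ℝ) - δ) / 2 - α / 2)
  rw [Hf_zero_eq (by linarith) hy, Hf_zero_eq (by linarith) hy, ← ENNReal.ofReal_mul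
    (Vbeta_nonneg hα hδ y), ← ENNReal.ofReal_mul (by positivity), Vbeta_eq hy,
    show (d : ℝ) / 2 - (d - δ) / 2 = δ / 2 by ring,
    show (d : ℝ) / 2 - ((d - δ) / 2 - α / 2) = (δ + α) / 2 by ring,
    show ((d : ℝ) - δ - α) / 2 = (d - δ) / 2 - α / 2 by ring]
  have := (FK_pos (δ / 2) (by linarith) hy').ne'
  congr 1
  rw [mul_assoc, div_mul_cancel₀ _ this]

lemma Hf_lower {d : ℕ} (b : ℝ) {v : ℝ} (hv : 0 < v) :
    ∃ c : ENNReal, c ≠ 0 ∧ ∀ y : Ed d,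
      c * ENNReal.ofReal (Real.exp (-(1 / (4 * v)) * ‖y‖ ^ 2)) ≤ Hf d b 0 y := by
  refine ⟨∫⁻ w in Ioo v (v + 1), ENNReal.ofReal (w ^ (b - 1) * ((w + 0) ^ (-((d : ℝ) / 2)) *
    Real.exp (-(w + 0)))), ?_, fun y => ?_⟩
  · rw [← pos_iff_ne_zero, setLIntegral_pos_iff (by fun_prop)]
    have : Function.support (fun w : ℝ => ENNReal.ofReal (w ^ (b - 1) * ((w + 0) ^ (-((d : ℝ) / 2)) *
      Real.exp (-(w + 0))))) ∩ Ioo v (v + 1) = Ioo v (v + 1) := by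
      refine inter_eq_right.2 fun u hu => ?_
      have hu' : 0 < u := hv.trans hu.1
      simp only [Function.mem_support, ne_eq, ENNReal.ofReal_eq_zero, not_le, add_zero]; positivity
    rw [this]; simp
  · rw [← lintegral_mul_const' _ _ ENNReal.ofReal_ne_top]
    unfold Hf
    refine le_trans (setLIntegral_mono' measurableSet_Ioo fun w hw => ?_)
      (lintegral_mono_set (fun w hw => hv.trans hw.1 : Ioo v (v + 1) ⊆ Ioi 0))
    have hw' : 0 < w := hv.trans hw.1
    rw [← ENNReal.ofReal_mul (by rw [add_zero]; positivity)]
    refine ENNReal.ofReal_le_ofReal ?_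
    simp only [add_zero]
    rw [mul_assoc, mul_assoc, ← Real.exp_add]
    gcongr
    have : ‖y‖ ^ 2 / (4 * w) ≤ 1 / (4 * v) * ‖y‖ ^ 2 := by
      rw [div_eq_mul_one_div, mul_comm]
      gcongr; exact hw.1.le
    linarith


/-! ### Part 6: abstract perturbation series in `ENNReal` -/

section abstractPert

variable {E : Type*} [MeasurableSpace E]

/-- The perturbation series with values in `ENNReal`, started at `x`. -/
def RR (μ : Measure E) (k : ℝ → E → E → ENNReal) (V : E → ENNReal) (x : E) : ℕ → ℝ → E → ENNReal
  | 0 => fun t y => k t x y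
  | n + 1 => fun t y => ∫⁻ s in Ioo 0 t, ∫⁻ z, RR μ k V x n s z * V z * k (t - s) z y ∂μ

lemma lintegral_ind {f : ℝ → ENNReal} (S : Set ℝ) (hS : MeasurableSet S) :
    ∫⁻ s in S, f s = ∫⁻ s, S.indicator f s := (lintegral_indicator hS f).symm

lemma measSet_and {Ω : Type*} [MeasurableSpace Ω] {f g : Ω → ℝ} (hf : Measurable f)
    (hg : Measurable g) : MeasurableSet {q : Ω | 0 < f q ∧ f q < g q} := by
  have : {q : Ω | 0 < f q ∧ f q < g q} = {q | 0 < f q} ∩ {q | f q < g q} := by ext; simp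
  rw [this]
  exact (measurableSet_lt measurable_const hf).inter (measurableSet_lt hf hg)

variable {μ : Measure E} [SFinite μ] {k : ℝ → E → E → ENNReal} {V : E → ENNReal} {x : E}

lemma k_comp (hk : Measurable fun q : ℝ × E × E => k q.1 q.2.1 q.2.2) {Ω : Type*} [MeasurableSpace Ω]
    {f : Ω → ℝ} {g h : Ω → E} (hf : Measurable f) (hg : Measurable g) (hh : Measurable h) :
    Measurable fun ω => k (f ω) (g ω) (h ω) :=
  Measurable.comp (g := fun q : ℝ × E × E => k q.1 q.2.1 q.2.2) hk (hf.prodMk (hg.prodMk hh))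

lemma RR_meas (hk : Measurable fun q : ℝ × E × E => k q.1 q.2.1 q.2.2) (hV : Measurable V) (n : ℕ) :
    Measurable fun q : ℝ × E => RR μ k V x n q.1 q.2 := by
  induction n with
  | zero => exact k_comp hk measurable_fst measurable_const measurable_snd
  | succ n ih =>
    simp only [RR]
    simp_rw [lintegral_ind _ measurableSet_Ioo]
    refine Measurable.lintegral_prod_right' (f := fun q : (ℝ × E) × ℝ =>
      (Ioo 0 q.1.1).indicator
        (fun s => ∫⁻ z, RR μ k V x n s z * V z * k (q.1.1 - s) z q.1.2 ∂μ) q.2) ?_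
    have e : (fun q : (ℝ × E) × ℝ => (Ioo 0 q.1.1).indicator
        (fun s => ∫⁻ z, RR μ k V x n s z * V z * k (q.1.1 - s) z q.1.2 ∂μ) q.2)
        = {q : (ℝ × E) × ℝ | 0 < q.2 ∧ q.2 < q.1.1}.indicator (fun q =>
          ∫⁻ z, RR μ k V x n q.2 z * V z * k (q.1.1 - q.2) z q.1.2 ∂μ) := by
      funext q; simp only [indicator, mem_Ioo, mem_ofPred_eq]
    rw [e]
    refine Measurable.indicator ?_ ?_
    · refine Measurable.lintegral_prod_right' (f := fun q : ((ℝ × E) × ℝ) × E =>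
        RR μ k V x n q.1.2 q.2 * V q.2 * k (q.1.1.1 - q.1.2) q.2 q.1.1.2) ?_
      refine Measurable.mul (Measurable.mul ?_ (hV.comp measurable_snd)) ?_
      · exact ih.comp (f := fun q : ((ℝ × E) × ℝ) × E => (q.1.2, q.2)) (by fun_prop)
      · exact k_comp hk (by fun_prop) (by fun_prop) (by fun_prop)
    · exact measSet_and (by fun_prop) (by fun_prop)

lemma RR_comp (hk : Measurable fun q : ℝ × E × E => k q.1 q.2.1 q.2.2) (hV : Measurable V) (n : ℕ)
    {Ω : Type*} [MeasurableSpace Ω] {f : Ω → ℝ} {g : Ω → E} (hf : Measurable f) (hg : Measurable g) :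
    Measurable fun ω => RR μ k V x n (f ω) (g ω) :=
  Measurable.comp (g := fun q : ℝ × E => RR μ k V x n q.1 q.2) (RR_meas hk hV n) (hf.prodMk hg)

lemma RR_T2 (hk : Measurable fun q : ℝ × E × E => k q.1 q.2.1 q.2.2) (hV : Measurable V) (n : ℕ)
    {g : E → ENNReal} (hg : Measurable g) (t : ℝ) :
    ∫⁻ y, RR μ k V x (n + 1) t y * g y ∂μ =
      ∫⁻ s in Ioo 0 t, ∫⁻ z, RR μ k V x n s z * V z * ∫⁻ y, k (t - s) z y * g y ∂μ ∂μ := by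
  have m1 : ∀ y, Measurable fun q : ℝ × E => RR μ k V x n q.1 q.2 * V q.2 * k (t - q.1) q.2 y :=
    fun y => ((RR_meas hk hV n).mul (hV.comp measurable_snd)).mul
      (k_comp hk (by fun_prop) (by fun_prop) (by fun_prop))
  have m2 : Measurable fun q : (E × ℝ) × E =>
      RR μ k V x n q.1.2 q.2 * V q.2 * k (t - q.1.2) q.2 q.1.1 * g q.1.1 :=
    (((RR_comp hk hV n (by fun_prop) (by fun_prop)).mul (hV.comp measurable_snd)).mul
      (k_comp hk (by fun_prop) (by fun_prop) (by fun_prop))).mul (hg.comp (by fun_prop))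
  have e1 : ∀ y, RR μ k V x (n + 1) t y * g y = ∫⁻ s in Ioo 0 t, ∫⁻ z,
      RR μ k V x n s z * V z * k (t - s) z y * g y ∂μ := by
    intro y
    simp only [RR]
    rw [← lintegral_mul_const _ (m1 y).lintegral_prod_right']
    refine lintegral_congr fun s => ?_
    rw [← lintegral_mul_const]
    exact (m1 y).comp (f := fun z : E => (s, z)) (by fun_prop)
  simp_rw [e1]
  rw [lintegral_lintegral_swap]
  · refine lintegral_congr fun s => ?_
    rw [lintegral_lintegral_swap]
    · refine lintegral_congr fun z => ?_
      rw [← lintegral_const_mul]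
      · simp_rw [mul_assoc]
      · exact (k_comp hk (by fun_prop) (by fun_prop) (by fun_prop)).mul hg
    · exact (m2.comp (f := fun q : E × E => ((q.1, s), q.2)) (by fun_prop)).aemeasurable
  · exact m2.lintegral_prod_right'.aemeasurable

lemma lintegral_Ioi_shift (f : ℝ → ENNReal) (s : ℝ) :
    ∫⁻ t in Ioi s, f t = ∫⁻ τ in Ioi 0, f (s + τ) := by
  rw [lintegral_ind _ measurableSet_Ioi, lintegral_ind _ measurableSet_Ioi,
    ← lintegral_add_left_eq_self _ s]
  refine lintegral_congr fun τ => ?_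
  simp [indicator]

lemma RR_T1 (hk : Measurable fun q : ℝ × E × E => k q.1 q.2.1 q.2.2) (hV : Measurable V) (n : ℕ)
    {g : ℝ → E → ENNReal} (hg : Measurable fun q : ℝ × E => g q.1 q.2) :
    ∫⁻ t in Ioi 0, ∫⁻ y, RR μ k V x (n + 1) t y * g t y ∂μ =
      ∫⁻ s in Ioi 0, ∫⁻ z, RR μ k V x n s z * V z *
        (∫⁻ τ in Ioi (0 : ℝ), ∫⁻ y, k τ z y * g (s + τ) y ∂μ) ∂μ := by
  have hgt : ∀ t, Measurable (g t) := fun t =>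
    hg.comp (f := fun y : E => (t, y)) (by fun_prop)
  have mP : Measurable fun q : (ℝ × ℝ) × E => ∫⁻ y, k (q.1.2 - q.1.1) q.2 y * g q.1.2 y ∂μ :=
    Measurable.lintegral_prod_right' (f := fun q : ((ℝ × ℝ) × E) × E =>
      k (q.1.1.2 - q.1.1.1) q.1.2 q.2 * g q.1.1.2 q.2)
      ((k_comp hk (by fun_prop) (by fun_prop) (by fun_prop)).mul
        (Measurable.comp (g := fun q : ℝ × E => g q.1 q.2) hg
          (f := fun q : ((ℝ × ℝ) × E) × E => (q.1.1.2, q.2)) (by fun_prop)))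
  have mF : Measurable fun q : (ℝ × ℝ) × E => RR μ k V x n q.1.1 q.2 * V q.2 *
      ∫⁻ y, k (q.1.2 - q.1.1) q.2 y * g q.1.2 y ∂μ :=
    ((RR_comp hk hV n (by fun_prop) (by fun_prop)).mul (hV.comp measurable_snd)).mul mP
  have mΦ : Measurable fun q : ℝ × ℝ => ∫⁻ z, RR μ k V x n q.1 z * V z *
      ∫⁻ y, k (q.2 - q.1) z y * g q.2 y ∂μ ∂μ := mF.lintegral_prod_right'
  simp_rw [fun t => RR_T2 (μ := μ) (x := x) hk hV n (hgt t) t]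
  have e1 : ∀ t : ℝ, ∫⁻ s in Ioo 0 t, ∫⁻ z, RR μ k V x n s z * V z *
      ∫⁻ y, k (t - s) z y * g t y ∂μ ∂μ = ∫⁻ s, {q : ℝ × ℝ | 0 < q.1 ∧ q.1 < q.2}.indicator
        (fun q => ∫⁻ z, RR μ k V x n q.1 z * V z *
      ∫⁻ y, k (q.2 - q.1) z y * g q.2 y ∂μ ∂μ) (s, t) := by
    intro t
    rw [lintegral_ind _ measurableSet_Ioo]
    rfl
  have e2 : ∀ s : ℝ, ∫⁻ t in Ioi 0, {q : ℝ × ℝ | 0 < q.1 ∧ q.1 < q.2}.indicator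
        (fun q => ∫⁻ z, RR μ k V x n q.1 z * V z *
      ∫⁻ y, k (q.2 - q.1) z y * g q.2 y ∂μ ∂μ) (s, t) =
      (Ioi 0).indicator (fun s => ∫⁻ t in Ioi s, ∫⁻ z, RR μ k V x n s z * V z *
      ∫⁻ y, k (t - s) z y * g t y ∂μ ∂μ) s := by
    intro s
    by_cases hs : 0 < s
    · rw [indicator_of_mem (show s ∈ Ioi 0 from hs), lintegral_ind _ measurableSet_Ioi,
        lintegral_ind _ measurableSet_Ioi]
      refine lintegral_congr fun t => ?_
      simp only [indicator, mem_Ioi, mem_ofPred_eq]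
      by_cases h : s < t
      · simp [h, hs, hs.trans h]
      · simp [h]
    · rw [indicator_of_notMem (by simpa using hs)]
      simp [indicator, hs]
  simp_rw [e1]
  rw [lintegral_lintegral_swap]
  · simp_rw [e2]
    rw [← lintegral_ind _ measurableSet_Ioi]
    refine lintegral_congr fun s => ?_
    rw [lintegral_Ioi_shift, lintegral_lintegral_swap]
    · refine lintegral_congr fun z => ?_
      simp_rw [add_sub_cancel_left]
      rw [← lintegral_const_mul]
      refine Measurable.lintegral_prod_right' (f := fun q : ℝ × E => k q.1 z q.2 * g (s + q.1) q.2) ?_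
      exact (k_comp hk (by fun_prop) (by fun_prop) (by fun_prop)).mul
        (Measurable.comp (g := fun q : ℝ × E => g q.1 q.2) hg
          (f := fun q : ℝ × E => (s + q.1, q.2)) (by fun_prop))
    · exact (mF.comp (f := fun q : ℝ × E => ((s, s + q.1), q.2)) (by fun_prop)).aemeasurable
  · refine Measurable.aemeasurable ?_
    have := mΦ.indicator (s := {q : ℝ × ℝ | 0 < q.1 ∧ q.1 < q.2})
      (measSet_and measurable_fst measurable_snd)
    exact this.comp (f := fun q : ℝ × ℝ => (q.2, q.1)) (by fun_prop)

lemma RR_T1_bdd (hk : Measurable fun q : ℝ × E × E => k q.1 q.2.1 q.2.2) (hV : Measurable V) (n : ℕ)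
    {g : E → ENNReal} (hg : Measurable g) (t : ℝ) :
    ∫⁻ s in Ioo 0 t, ∫⁻ y, RR μ k V x (n + 1) s y * g y ∂μ =
      ∫⁻ s in Ioo 0 t, ∫⁻ z, RR μ k V x n s z * V z *
        (∫⁻ τ in Ioo 0 (t - s), ∫⁻ y, k τ z y * g y ∂μ) ∂μ := by
  have h := RR_T1 (μ := μ) (x := x) hk hV n (g := fun s y => (Iio t).indicator (fun _ => g y) s) (by
    have e : (fun q : ℝ × E => (Iio t).indicator (fun _ => g q.2) q.1) =
      {q : ℝ × E | q.1 < t}.indicator (fun q => g q.2) := by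
      funext q; simp only [indicator, mem_Iio, mem_ofPred_eq]
    rw [e]
    exact (hg.comp measurable_snd).indicator (measurableSet_lt (by fun_prop) (by fun_prop)))
  have e1 : ∀ F : ℝ → ENNReal, ∫⁻ s in Ioo 0 t, F s = ∫⁻ s in Ioi 0, (Iio t).indicator F s := by
    intro F
    rw [lintegral_ind _ measurableSet_Ioo, lintegral_ind _ measurableSet_Ioi]
    refine lintegral_congr fun s => ?_
    simp only [indicator, mem_Ioo, mem_Ioi, mem_Iio]
    by_cases h1 : 0 < s <;> by_cases h2 : s < t <;> simp [h1, h2]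
  rw [e1, e1]
  refine Eq.trans (lintegral_congr fun s => ?_) (h.trans (lintegral_congr fun s => ?_))
  · by_cases hs : s < t <;> simp [indicator, hs]
  · by_cases hs : s < t
    · rw [indicator_of_mem (show s ∈ Iio t from hs)]
      refine lintegral_congr fun z => ?_
      congr 1
      rw [lintegral_ind _ measurableSet_Ioo, lintegral_ind _ measurableSet_Ioi]
      refine lintegral_congr fun τ => ?_
      simp only [indicator, mem_Ioo, mem_Ioi, mem_Iio]
      by_cases h1 : 0 < τ <;> by_cases h2 : s + τ < t
      · have : τ < t - s := by linarith
        simp [h1, h2, this]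
      · have : ¬ τ < t - s := by linarith
        simp [h1, h2, this]
      · simp [h1]
      · simp [h1]
    · rw [indicator_of_notMem (by simpa using hs)]
      symm
      have : ∀ z, ∫⁻ τ in Ioi (0 : ℝ), ∫⁻ y, k τ z y * (Iio t).indicator (fun _ => g y) (s + τ) ∂μ = 0 := by
        intro z
        rw [lintegral_ind _ measurableSet_Ioi, lintegral_eq_zero_of_ae_eq_zero]
        refine Eventually.of_forall fun τ => ?_
        simp only [indicator, mem_Ioi, mem_Iio]
        by_cases h1 : 0 < τ
        · have : ¬ s + τ < t := by linarith
          simp [this]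
        · simp [h1]
      simp [this]

lemma RR_F1 (hk : Measurable fun q : ℝ × E × E => k q.1 q.2.1 q.2.2) (hV : Measurable V)
    {h : E → ENNReal} (hh : Measurable h)
    (SI : ∀ᵐ z ∂μ, ∀ τ : ℝ, 0 < τ →
      (∫⁻ y, k τ z y * h y ∂μ) + (∫⁻ s in Ioo 0 τ, ∫⁻ y, k s z y * (V y * h y) ∂μ) ≤ h z)
    {t : ℝ} (SIx : (∫⁻ y, k t x y * h y ∂μ) +
      (∫⁻ s in Ioo 0 t, ∫⁻ y, k s x y * (V y * h y) ∂μ) ≤ h x) :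
    ∑' n, ∫⁻ y, RR μ k V x n t y * h y ∂μ ≤ h x := by
  have step : ∀ n, (∫⁻ y, RR μ k V x (n + 1) t y * h y ∂μ) +
      (∫⁻ s in Ioo 0 t, ∫⁻ y, RR μ k V x (n + 1) s y * (V y * h y) ∂μ) ≤
      ∫⁻ s in Ioo 0 t, ∫⁻ y, RR μ k V x n s y * (V y * h y) ∂μ := by
    intro n
    have mm : Measurable fun q : ℝ × E => RR μ k V x n q.1 q.2 * V q.2 *
        ∫⁻ y, k (t - q.1) q.2 y * h y ∂μ :=
      ((RR_meas hk hV n).mul (hV.comp measurable_snd)).mul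
        (Measurable.lintegral_prod_right' (f := fun q : (ℝ × E) × E => k (t - q.1.1) q.1.2 q.2 * h q.2)
          ((k_comp hk (by fun_prop) (by fun_prop) (by fun_prop)).mul (hh.comp measurable_snd)))
    rw [RR_T2 hk hV n hh, RR_T1_bdd hk hV n (g := fun y => V y * h y) (hV.mul hh), ← lintegral_add_left mm.lintegral_prod_right']
    refine setLIntegral_mono' measurableSet_Ioo fun s hs => ?_
    have ms : Measurable fun z => RR μ k V x n s z * V z * ∫⁻ y, k (t - s) z y * h y ∂μ :=
      mm.comp measurable_prodMk_left
    show (∫⁻ z, RR μ k V x n s z * V z * ∫⁻ y, k (t - s) z y * h y ∂μ ∂μ) + _ ≤ _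
    rw [← lintegral_add_left ms]
    refine lintegral_mono_ae ?_
    filter_upwards [SI] with z hz
    have := hz (t - s) (by linarith [hs.2])
    rw [← mul_add, ← mul_assoc]
    gcongr
  have tot : ∀ N, (∑ n ∈ Finset.range (N + 1), ∫⁻ y, RR μ k V x n t y * h y ∂μ) +
      (∫⁻ s in Ioo 0 t, ∫⁻ y, RR μ k V x N s y * (V y * h y) ∂μ) ≤ h x := by
    intro N
    induction N with
    | zero => simpa [RR] using SIx
    | succ N ih =>
      rw [Finset.sum_range_succ, add_assoc]
      exact le_trans (by gcongr; exact step N) ih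
  refine ENNReal.tsum_le_of_sum_range_le fun N => ?_
  refine le_trans ?_ ((le_self_add).trans (tot N))
  exact Finset.sum_le_sum_of_subset (Finset.range_mono (Nat.le_succ N))

lemma RR_F2 (hk : Measurable fun q : ℝ × E × E => k q.1 q.2.1 q.2.2) (hV : Measurable V)
    {h : E → ENNReal} (hh : Measurable h) {t : ℝ} {c : ENNReal} (g : E → ENNReal)
    (hc : ∀ τ ∈ Ioo 0 t, ∀ z, c * g z ≤ ∫⁻ y, k τ z y * h y ∂μ) (hg : Measurable g)
    (F1 : ∑' n, ∫⁻ y, RR μ k V x n t y * h y ∂μ ≤ h x) :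
    c * ∑' n, ∫⁻ s in Ioo 0 t, ∫⁻ z, RR μ k V x n s z * V z * g z ∂μ ≤ h x := by
  refine le_trans ?_ F1
  rw [← ENNReal.tsum_mul_left]
  rw [tsum_eq_zero_add' (f := fun n => ∫⁻ y, RR μ k V x n t y * h y ∂μ) ENNReal.summable]
  refine le_trans (ENNReal.tsum_le_tsum fun n => ?_) le_add_self
  rw [RR_T2 hk hV n hh]
  have mm : Measurable fun q : ℝ × E => RR μ k V x n q.1 q.2 * V q.2 * g q.2 :=
      ((RR_meas hk hV n).mul (hV.comp measurable_snd)).mul (hg.comp measurable_snd)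
  rw [← lintegral_const_mul _ mm.lintegral_prod_right']
  refine setLIntegral_mono' measurableSet_Ioo fun s hs => ?_
  have ms : Measurable fun z => RR μ k V x n s z * V z * g z := mm.comp measurable_prodMk_left
  show c * (∫⁻ z, RR μ k V x n s z * V z * g z ∂μ) ≤ _
  rw [← lintegral_const_mul _ ms]
  refine lintegral_mono fun z => ?_
  have := hc (t - s) ⟨by linarith [hs.2], by linarith [hs.1]⟩ z
  calc _ = RR μ k V x n s z * V z * (c * g z) := by ring
    _ ≤ _ := by gcongr

lemma exp_lint {C : ℝ} (hC : 0 < C) {a t : ℝ} (ha : 0 ≤ a) (ht : 0 < t) :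
    ENNReal.ofReal C * ∫⁻ s in Ioo 0 t, ENNReal.ofReal (a * Real.exp (C * s)) =
      ENNReal.ofReal (a * (Real.exp (C * t) - 1)) := by
  rw [← ofReal_integral_eq_lintegral_ofReal, ← ENNReal.ofReal_mul hC.le]
  · congr 1
    rw [← integral_Ioc_eq_integral_Ioo, ← intervalIntegral.integral_of_le ht.le]
    have hd : ∀ s ∈ uIcc 0 t,
          HasDerivAt (fun s : ℝ => a * Real.exp (C * s) / C) (a * Real.exp (C * s)) s := by
      intro s _
      have h2 := (((((hasDerivAt_id s)).const_mul C).exp).const_mul a).div_const C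
      refine h2.congr_deriv ?_
      simp only [id]; field_simp
    rw [intervalIntegral.integral_eq_sub_of_hasDerivAt hd
        (Continuous.intervalIntegrable (by fun_prop) _ _)]
    simp only [mul_zero, Real.exp_zero]; field_simp
  · have : Continuous fun s : ℝ => a * Real.exp (C * s) := by fun_prop
    exact this.integrableOn_Icc.mono_set Ioo_subset_Icc_self
  · exact Eventually.of_forall fun s => by show 0 ≤ _; positivity

lemma RR_F3 (hk : Measurable fun q : ℝ × E × E => k q.1 q.2.1 q.2.2) (hV : Measurable V)
    (hm : ∀ t : ℝ, 0 < t → ∀ z, ∫⁻ y, k t z y ∂μ ≤ 1) {T : ℝ} {C A : ℝ} (hC : 0 < C) (hA0 : 0 ≤ A)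
    (g : E → ENNReal) (hg : Measurable g) (hVg : ∀ z, V z ≤ V z * g z + ENNReal.ofReal C)
    (hA : ∑' n, ∫⁻ s in Ioo 0 T, ∫⁻ z, RR μ k V x n s z * V z * g z ∂μ ≤ ENNReal.ofReal A)
    {t : ℝ} (ht : t ∈ Ioo 0 T) :
    ∑' n, ∫⁻ y, RR μ k V x n t y ∂μ ≤ ENNReal.ofReal ((1 + A) * Real.exp (C * t)) := by
  have mR : ∀ n, Measurable fun s => ∫⁻ y, RR μ k V x n s y ∂μ := fun n =>
    (RR_meas hk hV n).lintegral_prod_right'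
  have step : ∀ n, ∀ t ∈ Ioo 0 T, ∫⁻ y, RR μ k V x (n + 1) t y ∂μ ≤
      (∫⁻ s in Ioo 0 T, ∫⁻ z, RR μ k V x n s z * V z * g z ∂μ) +
      ENNReal.ofReal C * ∫⁻ s in Ioo 0 t, ∫⁻ y, RR μ k V x n s y ∂μ := by
    intro n t ht
    have mm : Measurable fun q : ℝ × E => RR μ k V x n q.1 q.2 * V q.2 * g q.2 :=
      ((RR_meas hk hV n).mul (hV.comp measurable_snd)).mul (hg.comp measurable_snd)
    have h1 := RR_T2 (μ := μ) (x := x) hk hV n (g := fun _ => 1) measurable_const t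
    simp only [mul_one] at h1
    rw [h1, ← lintegral_const_mul _ (mR n)]
    calc _ ≤ ∫⁻ s in Ioo 0 t, ((∫⁻ z, RR μ k V x n s z * V z * g z ∂μ) +
            ENNReal.ofReal C * ∫⁻ y, RR μ k V x n s y ∂μ) := by
          refine setLIntegral_mono' measurableSet_Ioo fun s hs => ?_
          have ms : Measurable fun z => RR μ k V x n s z * V z * g z :=
            mm.comp measurable_prodMk_left
          have ms2 : Measurable fun z => RR μ k V x n s z :=
            (RR_meas hk hV n).comp measurable_prodMk_left
          rw [← lintegral_const_mul _ ms2, ← lintegral_add_left ms]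
          refine lintegral_mono fun z => ?_
          calc _ ≤ RR μ k V x n s z * V z * 1 := by
                gcongr; exact hm _ (by linarith [hs.2]) z
            _ ≤ RR μ k V x n s z * (V z * g z + ENNReal.ofReal C) := by
                rw [mul_one]; gcongr; exact hVg z
            _ = _ := by ring
      _ = (∫⁻ s in Ioo 0 t, ∫⁻ z, RR μ k V x n s z * V z * g z ∂μ) +
            ∫⁻ s in Ioo 0 t, ENNReal.ofReal C * ∫⁻ y, RR μ k V x n s y ∂μ :=
          lintegral_add_left mm.lintegral_prod_right' _
      _ ≤ _ := by
          gcongr; exact ht.2.le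
  have hN : ∀ N, ∀ t ∈ Ioo 0 T, ∑ n ∈ Finset.range N, ∫⁻ y, RR μ k V x n t y ∂μ ≤
      ENNReal.ofReal ((1 + A) * Real.exp (C * t)) := by
    intro N
    induction N with
    | zero => intro t ht; simp
    | succ N ih =>
      intro t ht
      rw [Finset.sum_range_succ']
      calc _ ≤ (∑ n ∈ Finset.range N, ((∫⁻ s in Ioo 0 T, ∫⁻ z, RR μ k V x n s z * V z * g z ∂μ) +
            ENNReal.ofReal C * ∫⁻ s in Ioo 0 t, ∫⁻ y, RR μ k V x n s y ∂μ)) + 1 := by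
            gcongr with n hn
            · exact step n t ht
            · exact hm t ht.1 x
        _ = (∑ n ∈ Finset.range N, ∫⁻ s in Ioo 0 T, ∫⁻ z, RR μ k V x n s z * V z * g z ∂μ) +
            ENNReal.ofReal C * (∫⁻ s in Ioo 0 t, ∑ n ∈ Finset.range N, ∫⁻ y, RR μ k V x n s y ∂μ) + 1 := by
            rw [Finset.sum_add_distrib, ← Finset.mul_sum, lintegral_finsetSum _ (fun n _ => mR n)]
        _ ≤ ENNReal.ofReal A + ENNReal.ofReal ((1 + A) * (Real.exp (C * t) - 1)) + 1 := by
            rw [← exp_lint hC (by linarith) ht.1]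
            gcongr ?_ + _ * ?_ + _
            · exact (ENNReal.sum_le_tsum _).trans hA
            · exact setLIntegral_mono' measurableSet_Ioo fun s hs => ih s ⟨hs.1, hs.2.trans ht.2⟩
        _ = _ := by
            have : 0 ≤ Real.exp (C * t) - 1 := by
              have := Real.one_le_exp (by nlinarith [ht.1] : 0 ≤ C * t); linarith
            rw [← ENNReal.ofReal_one, ← ENNReal.ofReal_add hA0 (by positivity),
              ← ENNReal.ofReal_add (by positivity) zero_le_one]
            congr 1; ring
  exact ENNReal.tsum_le_of_sum_range_le fun N => hN N t ht

end abstractPert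


/-! ### Part 7: application to the relativistic kernel -/

/-- The kernel with values in `ENNReal`. -/
def kE (d : ℕ) (α t : ℝ) (x y : Ed d) : ENNReal := ENNReal.ofReal (relKernel d α 1 t x y)

/-- The potential with values in `ENNReal`. -/
def VE (d : ℕ) (α δ : ℝ) (y : Ed d) : ENNReal := ENNReal.ofReal (Vbeta d α δ y)

/-- The perturbation series with values in `ENNReal`. -/
def RL (d : ℕ) (α δ : ℝ) (x : Ed d) : ℕ → ℝ → Ed d → ENNReal :=
  RR volume (kE d α) (VE d α δ) x

lemma kE_meas (d : ℕ) (α : ℝ) : Measurable fun q : ℝ × Ed d × Ed d => kE d α q.1 q.2.1 q.2.2 :=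
  (relKernel_meas d α).ennreal_ofReal

lemma VE_meas (d : ℕ) (α δ : ℝ) : Measurable (VE d α δ) := (Vbeta_meas d α δ).ennreal_ofReal

lemma RL_meas (d : ℕ) (α δ : ℝ) (x : Ed d) (n : ℕ) :
    Measurable fun q : ℝ × Ed d => RL d α δ x n q.1 q.2 :=
  RR_meas (kE_meas d α) (VE_meas d α δ) n

lemma pertN_eq {d : ℕ} {α δ : ℝ} (h0 : 0 < α) (h2 : α < 2) (hδ : δ < d - α) (x : Ed d) (n : ℕ) :
    ∀ t : ℝ, 0 < t → ∀ y : Ed d, RL d α δ x n t y ≠ ⊤ →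
      pertN d (relKernel d α 1) (Vbeta d α δ) n t x y = (RL d α δ x n t y).toReal := by
  induction n with
  | zero =>
    intro t ht y _
    simp only [pertN, RL, RR, kE]
    rw [ENNReal.toReal_ofReal (relKernel_nonneg h0 h2 ht x y)]
  | succ n ih =>
    intro t ht y hfin
    have hR := RL_meas d α δ x n
    have hF : Measurable fun q : ℝ × Ed d => RL d α δ x n q.1 q.2 * VE d α δ q.2 * kE d α (t - q.1) q.2 y :=
      (hR.mul ((VE_meas d α δ).comp measurable_snd)).mul
        (k_comp (kE_meas d α) (by fun_prop) (by fun_prop) (by fun_prop))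
    have e : RL d α δ x (n + 1) t y = ∫⁻ s in Ioo 0 t, ∫⁻ z, RL d α δ x n s z * VE d α δ z *
        kE d α (t - s) z y := rfl
    rw [e] at hfin ⊢
    have hmI : Measurable fun s => ∫⁻ z, RL d α δ x n s z * VE d α δ z * kE d α (t - s) z y :=
      hF.lintegral_prod_right'
    have hae := ae_lt_top hmI hfin
    rw [← integral_toReal hmI.aemeasurable hae]
    simp only [pertN]
    refine integral_congr_ae ?_
    filter_upwards [hae, ae_restrict_mem measurableSet_Ioo] with s hs hst
    have ms : Measurable fun z => RL d α δ x n s z * VE d α δ z * kE d α (t - s) z y :=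
      hF.comp measurable_prodMk_left
    have hae2 := ae_lt_top ms hs.ne
    rw [← integral_toReal ms.aemeasurable hae2]
    refine integral_congr_ae ?_
    filter_upwards [hae2] with z hz
    have hV := Vbeta_nonneg (d := d) h0 hδ z
    have hk := relKernel_nonneg h0 h2 (by linarith [hst.2] : 0 < t - s) z y
    rw [ENNReal.toReal_mul, ENNReal.toReal_mul]
    simp only [VE, kE]
    rw [ENNReal.toReal_ofReal hV, ENNReal.toReal_ofReal hk]
    by_cases hR' : RL d α δ x n s z = ⊤
    · have h4 : Vbeta d α δ z * relKernel d α 1 (t - s) z y = 0 := by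
        by_contra hne
        have hpos : 0 < Vbeta d α δ z * relKernel d α 1 (t - s) z y :=
          lt_of_le_of_ne (mul_nonneg hV hk) (Ne.symm hne)
        rw [mul_assoc, VE, kE, ← ENNReal.ofReal_mul hV, hR',
          ENNReal.top_mul (ENNReal.ofReal_pos.2 hpos).ne'] at hz
        exact lt_irrefl _ hz
      rw [mul_assoc, mul_assoc, h4, mul_zero, mul_zero]
    · rw [ih s hst.1 z hR']

section fixedParams

variable {d : ℕ} {α δ : ℝ}

lemma SI_all (hd : 0 < d) (h0 : 0 < α) (h2 : α < 2) (hδ0 : 0 < δ) (hδ : δ < d - α) {z : Ed d}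
    (hz : z ≠ 0) {τ : ℝ} (hτ : 0 < τ) :
    (∫⁻ y, kE d α τ z y * Hf d (((d : ℝ) - δ) / 2) 0 y) + (∫⁻ s in Ioo 0 τ, ∫⁻ y, kE d α s z y *
      (VE d α δ y * Hf d (((d : ℝ) - δ) / 2) 0 y)) ≤ Hf d (((d : ℝ) - δ) / 2) 0 z := by
  refine le_trans (le_of_eq ?_) (superSol hd h0 h2 hτ (by linarith : α / 2 < ((d : ℝ) - δ) / 2) hz)
  congr 1
  refine lintegral_congr fun s => lintegral_congr_ae ?_
  filter_upwards [ae_ne_zero hd] with y hy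
  simp only [VE, kE]
  rw [V_mul_Hf h0 hδ0 hδ hy]

lemma RL_F1 (hd : 0 < d) (h0 : 0 < α) (h2 : α < 2) (hδ0 : 0 < δ) (hδ : δ < d - α) {x : Ed d}
    (hx : x ≠ 0) {t : ℝ} (ht : 0 < t) :
    ∑' n, ∫⁻ y, RL d α δ x n t y * Hf d (((d : ℝ) - δ) / 2) 0 y ≤ Hf d (((d : ℝ) - δ) / 2) 0 x := by
  refine RR_F1 (kE_meas d α) (VE_meas d α δ) (Hf_meas _ _ _) ?_ (SI_all hd h0 h2 hδ0 hδ hx ht)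
  filter_upwards [ae_ne_zero hd] with z hz τ hτ
  exact SI_all hd h0 h2 hδ0 hδ hz hτ

lemma RL_finite (hd : 0 < d) (h0 : 0 < α) (h2 : α < 2) (hδ0 : 0 < δ) (hδ : δ < d - α) {x : Ed d}
    (hx : x ≠ 0) {t : ℝ} (ht : 0 < t) : ∀ᵐ y, ∑' n, RL d α δ x n t y ≠ ⊤ := by
  have h1 := RL_F1 hd h0 h2 hδ0 hδ hx ht
  have hms : ∀ n, Measurable fun y => RL d α δ x n t y := fun n =>
    (RL_meas d α δ x n).comp measurable_prodMk_left
  have hms2 : ∀ n, Measurable fun y => RL d α δ x n t y * Hf d (((d : ℝ) - δ) / 2) 0 y := fun n =>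
    (hms n).mul (Hf_meas _ _ _)
  rw [← lintegral_tsum (fun n => (hms2 n).aemeasurable)] at h1
  have h3 := ae_lt_top (Measurable.tsum hms2)
    (ne_top_of_le_ne_top (Hf_ne_top hd hx (by linarith)) h1)
  filter_upwards [h3] with y hy
  obtain ⟨c, hc, hl⟩ := Hf_lower (d := d) (((d : ℝ) - δ) / 2) one_pos
  have hp : Hf d (((d : ℝ) - δ) / 2) 0 y ≠ 0 := by
    have := hl y
    intro h4
    rw [h4, nonpos_iff_eq_zero, mul_eq_zero] at this
    rcases this with h | h
    · exact hc h
    · rw [ENNReal.ofReal_eq_zero] at h; exact absurd (Real.exp_pos _) (not_lt.2 h)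
  rw [ENNReal.tsum_mul_right] at hy
  intro h5
  rw [h5, ENNReal.top_mul hp] at hy
  exact lt_irrefl _ hy

lemma pert_ae (hd : 0 < d) (h0 : 0 < α) (h2 : α < 2) (hδ0 : 0 < δ) (hδ : δ < d - α) {x : Ed d}
    (hx : x ≠ 0) {t : ℝ} (ht : 0 < t) : ∀ᵐ y, (∑' n, RL d α δ x n t y ≠ ⊤) ∧
      pert d (relKernel d α 1) (Vbeta d α δ) t x y = (∑' n, RL d α δ x n t y).toReal := by
  filter_upwards [RL_finite hd h0 h2 hδ0 hδ hx ht] with y hy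
  have hf := ENNReal.ne_top_of_tsum_ne_top hy
  refine ⟨hy, ?_⟩
  rw [ENNReal.tsum_toReal_eq hf]
  unfold pert
  exact tsum_congr fun n => pertN_eq h0 h2 hδ x n t ht y (hf n)

lemma RL_F2 (hd : 0 < d) (h0 : 0 < α) (h2 : α < 2) (hδ0 : 0 < δ) (hδ : δ < d - α) {x : Ed d}
    (hx : x ≠ 0) {T : ℝ} (hT : 0 < T) (ρ : ℝ) :
    ∑' n, ∫⁻ s in Ioo 0 T, ∫⁻ z, RL d α δ x n s z * VE d α δ z *
      (Metric.closedBall (0 : Ed d) ρ).indicator (fun _ => 1) z ≠ ⊤ := by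
  set v : ℝ := 4 * (T + ρ ^ 2 / 2) * 2 ^ ((d : ℝ) / 2) * Real.exp T with hv
  have hq : (0 : ℝ) < 2 ^ ((d : ℝ) / 2) := by positivity
  have hv0 : 0 < v := by positivity
  obtain ⟨c, hc, hl⟩ := Hf_lower (d := d) (((d : ℝ) - δ) / 2) hv0
  set c' := c * ENNReal.ofReal (Real.exp (-T) / 2) with hc'
  have hc0 : c' ≠ 0 := by
    refine mul_ne_zero hc ?_
    rw [ne_eq, ENNReal.ofReal_eq_zero, not_le]; positivity
  have key := RR_F2 (kE_meas d α) (VE_meas d α δ) (Hf_meas d (((d : ℝ) - δ) / 2) 0) (μ := volume)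
    (x := x) (t := T)
    (c := c') ((Metric.closedBall (0 : Ed d) ρ).indicator (fun _ => 1)) ?_
    (measurable_const.indicator Metric.isClosed_closedBall.measurableSet)
    (RL_F1 hd h0 h2 hδ0 hδ hx hT)
  · intro htop
    have h5 : ∑' n, ∫⁻ s in Ioo 0 T, ∫⁻ z, RR volume (kE d α) (VE d α δ) x n s z * VE d α δ z *
      (Metric.closedBall (0 : Ed d) ρ).indicator (fun _ => 1) z = ⊤ := htop
    rw [h5, ENNReal.mul_top hc0, top_le_iff] at key
    exact Hf_ne_top hd hx (by linarith) key
  · intro τ hτ z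
    by_cases hz : z ∈ Metric.closedBall (0 : Ed d) ρ
    · rw [indicator_of_mem hz, mul_one]
      have hzn : ‖z‖ ≤ ρ := by simpa using hz
      obtain ⟨ki, -⟩ := kernel_gauss h0 hτ.1 hv0 z 0
      have kge := kernel_gauss_ge h0 h2 hτ.1 hv0 z 0
      have knn : ∀ y : Ed d, 0 ≤ relKernel d α 1 τ z y * Real.exp (-(1 / (4 * v)) * ‖y - 0‖ ^ 2) :=
        fun y => mul_nonneg (relKernel_nonneg h0 h2 hτ.1 z y) (Real.exp_pos _).le
      have hlow : Real.exp (-T) / 2 ≤ ∫ y : Ed d, relKernel d α 1 τ z y *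
          Real.exp (-(1 / (4 * v)) * ‖y - 0‖ ^ 2) := by
        refine le_trans ?_ kge
        have e1 : Real.exp (-T) ≤ Real.exp (-τ) := by rw [Real.exp_le_exp]; linarith [hτ.2]
        have e2 : (T + ρ ^ 2 / 2) * (2 / v) * 2 ^ ((d : ℝ) / 2) = Real.exp (-T) / 2 := by
          rw [hv, Real.exp_neg]
          have : 0 < T + ρ ^ 2 / 2 := by positivity
          have := Real.exp_pos T
          field_simp; ring
        have e3 : (τ + ‖0 - z‖ ^ 2 / 2) * (2 / v) * 2 ^ ((d : ℝ) / 2) ≤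
            (T + ρ ^ 2 / 2) * (2 / v) * 2 ^ ((d : ℝ) / 2) := by
          rw [zero_sub, norm_neg]
          gcongr
          exact hτ.2.le
        linarith
      calc c' ≤ c * ENNReal.ofReal (∫ y : Ed d, relKernel d α 1 τ z y *
          Real.exp (-(1 / (4 * v)) * ‖y - 0‖ ^ 2)) := by
            rw [hc']; gcongr
        _ = ∫⁻ y : Ed d, c * ENNReal.ofReal (relKernel d α 1 τ z y *
          Real.exp (-(1 / (4 * v)) * ‖y - 0‖ ^ 2)) := by
            rw [ofReal_integral_eq_lintegral_ofReal ki (Eventually.of_forall knn),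
              lintegral_const_mul]
            have := relKernel_meas_right α τ z
            fun_prop
        _ ≤ _ := by
            refine lintegral_mono fun y => ?_
            have := hl y
            rw [ENNReal.ofReal_mul (relKernel_nonneg h0 h2 hτ.1 z y), sub_zero, mul_left_comm]
            simp only [kE]
            gcongr
    · rw [indicator_of_notMem hz, mul_zero]; exact zero_le

lemma RL_F3 (hd : 0 < d) (h0 : 0 < α) (h2 : α < 2) (hδ0 : 0 < δ) (hδ : δ < d - α) {x : Ed d}
    (hx : x ≠ 0) {T : ℝ} (hT : 0 < T) :
    ∃ M : ℝ, 0 ≤ M ∧ ∀ t ∈ Ioo 0 T, ∑' n, ∫⁻ y, RL d α δ x n t y ≤ ENNReal.ofReal M := by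
  obtain ⟨C, hC, hVC⟩ := Vbeta_bounded (d := d) h0 hδ0 hδ
  have hA := RL_F2 hd h0 h2 hδ0 hδ hx hT 1
  set A := (∑' n, ∫⁻ s in Ioo 0 T, ∫⁻ z, RL d α δ x n s z * VE d α δ z *
      (Metric.closedBall (0 : Ed d) 1).indicator (fun _ => 1) z).toReal with hAdef
  have hA0 : 0 ≤ A := ENNReal.toReal_nonneg
  refine ⟨(1 + A) * Real.exp (C * T), by positivity, fun t ht => ?_⟩
  refine (RR_F3 (kE_meas d α) (VE_meas d α δ) (fun t ht z => kernel_mass h0 h2 ht z) hC hA0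
    ((Metric.closedBall (0 : Ed d) 1).indicator (fun _ => 1))
    (measurable_const.indicator Metric.isClosed_closedBall.measurableSet) ?_ ?_ ht).trans ?_
  · intro z
    by_cases hz : z ∈ Metric.closedBall (0 : Ed d) 1
    · rw [indicator_of_mem hz, mul_one]; exact le_self_add
    · rw [indicator_of_notMem hz, mul_zero, zero_add]
      refine ENNReal.ofReal_le_ofReal (hVC z ?_)
      have : ¬ ‖z‖ ≤ 1 := by simpa using hz
      linarith
  · rw [hAdef, ENNReal.ofReal_toReal hA]; exact le_rfl
  · refine ENNReal.ofReal_le_ofReal ?_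
    gcongr; exact ht.2.le

end fixedParams


/-! ### Part 8: the Levy measure -/

/-- Gaussian density. -/
def gker {d : ℕ} (u : ℝ) (w : Ed d) : ℝ :=
  (4 * π * u) ^ (-((d : ℝ) / 2)) * Real.exp (-(1 / (4 * u)) * ‖w‖ ^ 2)

lemma gker_nonneg {d : ℕ} {u : ℝ} (hu : 0 < u) (w : Ed d) : 0 ≤ gker u w := by
  unfold gker; positivity

lemma gker_meas (d : ℕ) : Measurable fun q : ℝ × Ed d => gker q.1 q.2 := by
  unfold gker; fun_prop

lemma gker_cos {d : ℕ} {u : ℝ} (hu : 0 < u) (ξ : Ed d) :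
    Integrable (fun w : Ed d => (1 - Real.cos ⟪ξ, w⟫) * gker u w) ∧
    ∫ w : Ed d, (1 - Real.cos ⟪ξ, w⟫) * gker u w = 1 - Real.exp (-(u * ‖ξ‖ ^ 2)) := by
  have hpi := Real.pi_pos
  have hb : 0 < 1 / (4 * u) := by positivity
  have i1 := integrable_gauss (d := d) hb
  have i2 : Integrable fun w : Ed d => Real.cos ⟪ξ, w⟫ * Real.exp (-(1 / (4 * u)) * ‖w‖ ^ 2) := by
    refine i1.mono' (Measurable.aestronglyMeasurable (by fun_prop)) (Eventually.of_forall fun w => ?_)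
    rw [Real.norm_eq_abs, abs_mul, abs_of_pos (Real.exp_pos _)]
    exact mul_le_of_le_one_left (Real.exp_pos _).le (Real.abs_cos_le_one _)
  have e : (fun w : Ed d => (1 - Real.cos ⟪ξ, w⟫) * gker u w) = fun w =>
      (4 * π * u) ^ (-((d : ℝ) / 2)) * (Real.exp (-(1 / (4 * u)) * ‖w‖ ^ 2) -
        Real.cos ⟪ξ, w⟫ * Real.exp (-(1 / (4 * u)) * ‖w‖ ^ 2)) := by
    funext w; unfold gker; ring
  rw [e]
  refine ⟨(i1.sub i2).const_mul _, ?_⟩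
  rw [integral_const_mul, integral_sub i1 i2, integral_gauss hb, gauss_cos0 hb]
  have e2 : π / (1 / (4 * u)) = 4 * π * u := by field_simp
  have e3 : -‖ξ‖ ^ 2 / (4 * (1 / (4 * u))) = -(u * ‖ξ‖ ^ 2) := by field_simp
  rw [e2, e3, Real.rpow_neg (by positivity)]
  have : 0 < (4 * π * u) ^ ((d : ℝ) / 2) := by positivity
  field_simp

lemma levyNu_eq {d : ℕ} {α : ℝ} {w : Ed d} (hw : w ≠ 0) :
    levyNu d α w = 2 ^ (-(d : ℝ)) * π ^ (-((d : ℝ) / 2)) * |Real.Gamma (-(α / 2))|⁻¹ *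
      FK (((d : ℝ) + α) / 2) ‖w‖ := by
  have hr : 0 < ‖w‖ := norm_pos_iff.2 hw
  unfold levyNu
  rw [besselK_eq, Real.div_rpow hr.le (by norm_num), neg_div, neg_div]
  have h1 : 0 < ‖w‖ ^ (((d : ℝ) + α) / 2) := by positivity
  have e1 : (2 : ℝ) ^ ((α - (d : ℝ)) / 2 + 1) = 2 ^ (-(d : ℝ)) * 2 ^ (((d : ℝ) + α) / 2) * 2 := by
    rw [← Real.rpow_add (by norm_num), Real.rpow_add (by norm_num), Real.rpow_one]
    congr 2; ring
  rw [e1]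
  have h2 : (0 : ℝ) < 2 ^ (((d : ℝ) + α) / 2) := by positivity
  generalize (2 : ℝ) ^ (((d : ℝ) + α) / 2) = A at *
  generalize ‖w‖ ^ (((d : ℝ) + α) / 2) = B at *
  generalize |Real.Gamma (-(α / 2))|⁻¹ = G
  generalize FK (((d : ℝ) + α) / 2) ‖w‖ = F
  field_simp

lemma levyNu_meas (d : ℕ) (α : ℝ) : Measurable (levyNu d α) := by
  have h : Measurable (besselK (((d : ℝ) + α) / 2)) := by
    have := FK_meas (((d : ℝ) + α) / 2)
    have e : besselK (((d : ℝ) + α) / 2) = fun r => (1 / 2) * (r / 2) ^ (((d : ℝ) + α) / 2) *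
      FK (((d : ℝ) + α) / 2) r := rfl
    rw [e]; fun_prop
  unfold levyNu
  fun_prop

lemma levyNu_nonneg (d : ℕ) (α : ℝ) (w : Ed d) : 0 ≤ levyNu d α w := by
  unfold levyNu
  rw [besselK_eq]
  have := FK_nonneg (((d : ℝ) + α) / 2) ‖w‖
  have := Real.pi_pos
  positivity

lemma levyNu_neg (d : ℕ) (α : ℝ) (w : Ed d) : levyNu d α (-w) = levyNu d α w := by
  unfold levyNu; rw [norm_neg]

lemma levyNu_lint {d : ℕ} {α : ℝ} (h0 : 0 < α) {w : Ed d} (hw : w ≠ 0) :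
    ENNReal.ofReal (levyNu d α w) =
      ∫⁻ u in Ioi (0 : ℝ), ENNReal.ofReal (kap (α / 2) u) * ENNReal.ofReal (gker u w) := by
  have hr : 0 < ‖w‖ := norm_pos_iff.2 hw
  have hpi := Real.pi_pos
  have hi := FK_integrable (((d : ℝ) + α) / 2) (by positivity) hr
  rw [levyNu_eq hw]
  unfold FK
  rw [ENNReal.ofReal_mul (by positivity), ofReal_integral_eq_lintegral_ofReal hi,
    ← lintegral_const_mul' _ _ ENNReal.ofReal_ne_top]
  · refine setLIntegral_congr_fun measurableSet_Ioi fun u hu => ?_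
    have hu' : 0 < u := hu
    show ENNReal.ofReal _ * ENNReal.ofReal _ = ENNReal.ofReal _ * ENNReal.ofReal _
    rw [← ENNReal.ofReal_mul (by positivity), ← ENNReal.ofReal_mul (kap_nonneg _ hu')]
    congr 1
    unfold kap gker
    have e1 : (4 * π * u) ^ (-((d : ℝ) / 2)) = 2 ^ (-(d : ℝ)) * π ^ (-((d : ℝ) / 2)) *
        u ^ (-((d : ℝ) / 2)) := by
      rw [Real.mul_rpow (by positivity) hu'.le, Real.mul_rpow (by norm_num) hpi.le]
      congr 2
      rw [show (4 : ℝ) = 2 ^ (2 : ℝ) by norm_num, ← Real.rpow_mul (by norm_num)]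
      congr 1; ring
    have e2 : u ^ (-(((d : ℝ) + α) / 2) - 1) = u ^ (-(α / 2) - 1) * u ^ (-((d : ℝ) / 2)) := by
      rw [← Real.rpow_add hu']; congr 1; ring
    have e3 : Real.exp (-u - ‖w‖ ^ 2 / (4 * u)) = Real.exp (-u) *
        Real.exp (-(1 / (4 * u)) * ‖w‖ ^ 2) := by
      rw [← Real.exp_add]; congr 1; ring
    rw [e1, e2, e3]; ring
  · refine (ae_restrict_iff' measurableSet_Ioi).2 (Eventually.of_forall fun u hu => ?_)
    have hu' : 0 < u := hu
    show 0 ≤ _; positivity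

lemma levy_swap {d : ℕ} (hd : 0 < d) {α : ℝ} (h0 : 0 < α) {f : Ed d → ENNReal} (hf : Measurable f) :
    ∫⁻ w, f w * ENNReal.ofReal (levyNu d α w) =
      ∫⁻ u in Ioi (0 : ℝ), ENNReal.ofReal (kap (α / 2) u) *
        ∫⁻ w : Ed d, f w * ENNReal.ofReal (gker u w) := by
  have hk := kap_meas (α / 2)
  have mg : ∀ u : ℝ, Measurable fun w : Ed d => ENNReal.ofReal (gker u w) := fun u =>
    ((gker_meas d).comp (measurable_prodMk_left (x := u))).ennreal_ofReal
  have mg' : ∀ w : Ed d, Measurable fun u : ℝ => ENNReal.ofReal (gker u w) := fun w =>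
    ((gker_meas d).comp (measurable_prodMk_right (y := w))).ennreal_ofReal
  calc _ = ∫⁻ w : Ed d, ∫⁻ u in Ioi (0 : ℝ), f w * (ENNReal.ofReal (kap (α / 2) u) *
        ENNReal.ofReal (gker u w)) := by
        refine lintegral_congr_ae ?_
        filter_upwards [ae_ne_zero hd] with w hw
        have m3 : Measurable fun u : ℝ => ENNReal.ofReal (kap (α / 2) u) *
          ENNReal.ofReal (gker u w) := (hk.ennreal_ofReal).mul (mg' w)
        rw [levyNu_lint h0 hw, lintegral_const_mul _ m3]
    _ = _ := by
        rw [lintegral_lintegral_swap]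
        · refine lintegral_congr fun u => ?_
          have m4 : Measurable fun w : Ed d => f w * ENNReal.ofReal (gker u w) := hf.mul (mg u)
          rw [← lintegral_const_mul _ m4]
          refine lintegral_congr fun w => ?_
          ring
        · refine Measurable.aemeasurable ?_
          refine (hf.comp measurable_fst).mul (((hk.comp measurable_snd).ennreal_ofReal).mul ?_)
          exact ((gker_meas d).comp measurable_swap).ennreal_ofReal

lemma levy_sq {d : ℕ} (hd : 0 < d) {α : ℝ} (h0 : 0 < α) (h2 : α < 2) :
    Integrable fun w : Ed d => ‖w‖ ^ 2 * levyNu d α w := by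
  have hpi := Real.pi_pos
  refine ⟨((measurable_norm.pow_const 2).mul (levyNu_meas d α)).aestronglyMeasurable, ?_⟩
  rw [hasFiniteIntegral_iff_ofReal (Eventually.of_forall fun w =>
    mul_nonneg (by positivity) (levyNu_nonneg d α w))]
  have e : ∀ w : Ed d, ENNReal.ofReal (‖w‖ ^ 2 * levyNu d α w) = ENNReal.ofReal (‖w‖ ^ 2) *
    ENNReal.ofReal (levyNu d α w) := fun w => ENNReal.ofReal_mul (by positivity)
  simp_rw [e]
  rw [levy_swap hd h0 (by fun_prop)]
  have hb : ∀ u : ℝ, 0 < u → ∫⁻ w : Ed d, ENNReal.ofReal (‖w‖ ^ 2) * ENNReal.ofReal (gker u w) ≤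
      ENNReal.ofReal (8 * u * 2 ^ ((d : ℝ) / 2)) := by
    intro u hu
    have hb' : 0 < 1 / (8 * u) := by positivity
    have i1 := (integrable_gauss (d := d) hb').const_mul (8 * u * (4 * π * u) ^ (-((d : ℝ) / 2)))
    calc _ ≤ ∫⁻ w : Ed d, ENNReal.ofReal (8 * u * (4 * π * u) ^ (-((d : ℝ) / 2)) *
          Real.exp (-(1 / (8 * u)) * ‖w‖ ^ 2)) := by
          refine lintegral_mono fun w => ?_
          rw [← ENNReal.ofReal_mul (by positivity)]
          refine ENNReal.ofReal_le_ofReal ?_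
          unfold gker
          have e1 : ‖w‖ ^ 2 ≤ 8 * u * Real.exp (1 / (8 * u) * ‖w‖ ^ 2) := by
            have := Real.add_one_le_exp (1 / (8 * u) * ‖w‖ ^ 2)
            calc ‖w‖ ^ 2 = 8 * u * (1 / (8 * u) * ‖w‖ ^ 2) := by field_simp
              _ ≤ _ := by gcongr; linarith
          have e2 : Real.exp (1 / (8 * u) * ‖w‖ ^ 2) * Real.exp (-(1 / (4 * u)) * ‖w‖ ^ 2) =
              Real.exp (-(1 / (8 * u)) * ‖w‖ ^ 2) := by
            rw [← Real.exp_add]; congr 1; field_simp; ring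
          calc _ ≤ 8 * u * Real.exp (1 / (8 * u) * ‖w‖ ^ 2) * ((4 * π * u) ^ (-((d : ℝ) / 2)) *
                Real.exp (-(1 / (4 * u)) * ‖w‖ ^ 2)) := by gcongr
            _ = _ := by rw [← e2]; ring
      _ = _ := by
          rw [← ofReal_integral_eq_lintegral_ofReal i1 (Eventually.of_forall fun w => by
            show 0 ≤ _; positivity), integral_const_mul, integral_gauss hb']
          congr 1
          have e2 : π / (1 / (8 * u)) = 2 * (4 * π * u) := by field_simp; ring
          have hq : 0 < 4 * π * u := by positivity
          rw [e2]
          generalize 4 * π * u = q at hq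
          rw [Real.mul_rpow (by norm_num) hq.le, Real.rpow_neg hq.le]
          have : 0 < q ^ ((d : ℝ) / 2) := by positivity
          field_simp
  refine lt_of_le_of_lt (setLIntegral_mono' measurableSet_Ioi fun u hu =>
    mul_le_mul_right (hb u hu) _) ?_
  have hintg : IntegrableOn (fun u : ℝ => (|Real.Gamma (-(α / 2))|⁻¹ * (8 * 2 ^ ((d : ℝ) / 2))) *
      (u ^ ((1 - α / 2) - 1) * Real.exp (-(1 * u)))) (Ioi 0) :=
    (integrableOn_gam (by linarith : 0 < 1 - α / 2) one_pos).const_mul _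
  refine lt_of_le_of_lt (le_of_eq ?_) hintg.lintegral_lt_top
  refine setLIntegral_congr_fun measurableSet_Ioi fun u hu => ?_
  have hu' : 0 < u := hu
  show ENNReal.ofReal _ * ENNReal.ofReal _ = ENNReal.ofReal _
  rw [← ENNReal.ofReal_mul (kap_nonneg _ hu')]
  congr 1
  unfold kap
  have e2 : u ^ ((1 - α / 2) - 1) = u ^ (-(α / 2) - 1) * u := by
    rw [← Real.rpow_add_one hu'.ne']; congr 1; ring
  rw [e2, one_mul]; ring

lemma levy_cos {d : ℕ} (hd : 0 < d) {α : ℝ} (h0 : 0 < α) (h2 : α < 2) (ξ : Ed d) :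
    ∫ w : Ed d, (1 - Real.cos ⟪ξ, w⟫) * levyNu d α w = psi α ξ - 1 := by
  have hc : ∀ w : Ed d, 0 ≤ 1 - Real.cos ⟪ξ, w⟫ := fun w => by linarith [Real.cos_le_one ⟪ξ, w⟫]
  have hmc : Measurable fun w : Ed d => 1 - Real.cos ⟪ξ, w⟫ := by fun_prop
  rw [integral_eq_lintegral_of_nonneg_ae (Eventually.of_forall fun w =>
    mul_nonneg (hc w) (levyNu_nonneg d α w)) (hmc.mul (levyNu_meas d α)).aestronglyMeasurable]
  have e : ∀ w : Ed d, ENNReal.ofReal ((1 - Real.cos ⟪ξ, w⟫) * levyNu d α w) =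
    ENNReal.ofReal (1 - Real.cos ⟪ξ, w⟫) * ENNReal.ofReal (levyNu d α w) :=
    fun w => ENNReal.ofReal_mul (hc w)
  simp_rw [e]
  rw [levy_swap hd h0 hmc.ennreal_ofReal]
  obtain ⟨b1, b2⟩ := bern (by linarith : 0 < α / 2) (by linarith : α / 2 < 1) (sq_nonneg ‖ξ‖)
  have e2 : ∀ u ∈ Ioi (0 : ℝ), ENNReal.ofReal (kap (α / 2) u) * ∫⁻ w : Ed d,
      ENNReal.ofReal (1 - Real.cos ⟪ξ, w⟫) * ENNReal.ofReal (gker u w) =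
      ENNReal.ofReal (kap (α / 2) u * (1 - Real.exp (-(u * ‖ξ‖ ^ 2)))) := by
    intro u hu
    have hu' : 0 < u := hu
    obtain ⟨g1, g2⟩ := gker_cos hu' ξ
    rw [ENNReal.ofReal_mul (kap_nonneg _ hu'), ← g2, ofReal_integral_eq_lintegral_ofReal g1
      (Eventually.of_forall fun w => mul_nonneg (hc w) (gker_nonneg hu' w))]
    congr 1
    exact lintegral_congr fun w => (ENNReal.ofReal_mul (hc w)).symm
  rw [setLIntegral_congr_fun measurableSet_Ioi e2, ← ofReal_integral_eq_lintegral_ofReal b1, b2]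
  · rw [ENNReal.toReal_ofReal]
    · unfold psi; rw [add_comm]
    · have := psi_ge_one h0 ξ
      unfold psi at this; rw [add_comm] at this; linarith
  · refine (ae_restrict_iff' measurableSet_Ioi).2 (Eventually.of_forall fun u hu => ?_)
    have hu' : 0 < u := hu
    refine mul_nonneg (kap_nonneg _ hu') ?_
    have : Real.exp (-(u * ‖ξ‖ ^ 2)) ≤ 1 := by
      rw [Real.exp_le_one_iff]
      have : 0 ≤ u * ‖ξ‖ ^ 2 := by positivity
      linarith
    linarith


def Sd {d : ℕ} (φ : ℝ × Ed d → ℝ) (u : ℝ) (z w : Ed d) : ℝ :=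
  (1 / 2) * (φ (u, z + w) + φ (u, z - w) - 2 * φ (u, z))

def Lop (d : ℕ) (α : ℝ) (φ : ℝ × Ed d → ℝ) (u : ℝ) (z : Ed d) : ℝ :=
  φ (u, z) - ∫ w : Ed d, Sd φ u z w * levyNu d α w

lemma phi_supp {d : ℕ} {φ : ℝ × Ed d → ℝ} (hφc : HasCompactSupport φ) :
    ∃ R : ℝ, 0 < R ∧ ∀ u z, φ (u, z) ≠ 0 → |u| ≤ R ∧ ‖z‖ ≤ R := by
  obtain ⟨R, hR⟩ := hφc.isCompact.isBounded.subset_closedBall (0 : ℝ × Ed d)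
  refine ⟨max R 1, by positivity, fun u z h => ?_⟩
  have h1 := hR (subset_tsupport _ h)
  rw [mem_closedBall_zero_iff, Prod.norm_def] at h1
  have h2 := h1.trans (le_max_left R 1)
  exact ⟨(le_max_left _ _).trans h2, (le_max_right _ _).trans h2⟩

lemma Sd_bound {d : ℕ} {φ : ℝ × Ed d → ℝ} (hφ : ContDiff ℝ (⊤ : ℕ∞) φ)
    (hφc : HasCompactSupport φ) : ∃ C : ℝ, 0 ≤ C ∧ ∀ u z w, |Sd φ u z w| ≤ C * ‖w‖ ^ 2 := by
  have hfd : ContDiff ℝ 1 (fderiv ℝ φ) := hφ.fderiv_right (m := 1) (by norm_cast)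
  obtain ⟨C, hC⟩ := ContDiff.lipschitzWith_of_hasCompactSupport (hφc.fderiv ℝ) hfd (by simp)
  have hdiff : Differentiable ℝ φ := hφ.differentiable (by simp)
  have key : ∀ p q : ℝ × Ed d, |φ (p + q) - φ p - fderiv ℝ φ p q| ≤ C * ‖q‖ ^ 2 := by
    intro p q
    have := Convex.norm_image_sub_le_of_norm_hasFDerivWithin_le' (f := φ) (f' := fderiv ℝ φ)
      (φ := fderiv ℝ φ p) (C := C * ‖q‖) (s := Metric.closedBall p ‖q‖) (x := p) (y := p + q)
      (fun y _ => (hdiff y).hasFDerivAt.hasFDerivWithinAt)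
      (fun y hy => by
        have h1 := hC.dist_le_mul y p
        rw [dist_eq_norm] at h1
        refine h1.trans ?_
        have : dist y p ≤ ‖q‖ := hy
        gcongr)
      (convex_closedBall _ _) (Metric.mem_closedBall_self (norm_nonneg _)) (by simp)
    rw [add_sub_cancel_left] at this
    calc _ ≤ _ := this
      _ = _ := by ring
  refine ⟨C, C.2, fun u z w => ?_⟩
  have h1 := key (u, z) (0, w)
  have h2 := key (u, z) (0, -w)
  have e1 : ((u, z) : ℝ × Ed d) + (0, w) = (u, z + w) := by simp
  have e2 : ((u, z) : ℝ × Ed d) + (0, -w) = (u, z - w) := by simp [sub_eq_add_neg]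
  have e3 : ((0 : ℝ), -w) = -((0 : ℝ), w) := by simp
  have n1 : ‖((0 : ℝ), w)‖ = ‖w‖ := by simp [Prod.norm_def]
  have n2 : ‖((0 : ℝ), -w)‖ = ‖w‖ := by simp [Prod.norm_def]
  rw [e1, n1] at h1
  rw [e2, n2, e3, map_neg] at h2
  unfold Sd
  rw [abs_le] at *
  constructor <;> linarith [h1.1, h1.2, h2.1, h2.2]

lemma Sd_zero {d : ℕ} {φ : ℝ × Ed d → ℝ} {R : ℝ}
    (hR : ∀ u z, φ (u, z) ≠ 0 → |u| ≤ R ∧ ‖z‖ ≤ R) {u : ℝ} (hu : R < |u|) (z w : Ed d) :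
    Sd φ u z w = 0 := by
  have h : ∀ y, φ (u, y) = 0 := fun y => by
    by_contra h; exact absurd (hR u y h).1 (not_le.2 hu)
  simp [Sd, h]

lemma Sd_meas {d : ℕ} {φ : ℝ × Ed d → ℝ} (hφ : Continuous φ) :
    Measurable fun q : (ℝ × Ed d) × Ed d => Sd φ q.1.1 q.1.2 q.2 := by
  have : Continuous fun q : (ℝ × Ed d) × Ed d => Sd φ q.1.1 q.1.2 q.2 := by
    unfold Sd; fun_prop
  exact this.measurable

lemma Sd_L1 {d : ℕ} {φ : ℝ × Ed d → ℝ} (hφ : ContDiff ℝ (⊤ : ℕ∞) φ)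
    (hφc : HasCompactSupport φ) :
    ∃ K : ℝ, 0 ≤ K ∧ ∀ u w, ∫⁻ z : Ed d, ENNReal.ofReal |Sd φ u z w| ≤
      ENNReal.ofReal (K * ‖w‖ ^ 2) := by
  obtain ⟨C, hC0, hC⟩ := Sd_bound hφ hφc
  obtain ⟨R, hR0, hR⟩ := phi_supp hφc
  let B : Ed d → ENNReal := (Metric.closedBall (0 : Ed d) R).indicator (fun _ => 1)
  have hBm : Measurable B := measurable_const.indicator Metric.isClosed_closedBall.measurableSet
  have hB1 : ∀ z, ‖z‖ ≤ R → B z = 1 := fun z hz => by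
    simp only [B]; rw [indicator_of_mem]; simpa using hz
  have hBv : ∫⁻ z, B z = volume (Metric.closedBall (0 : Ed d) R) := by
    simp only [B]
    rw [lintegral_indicator Metric.isClosed_closedBall.measurableSet]; simp
  have hfin : volume (Metric.closedBall (0 : Ed d) R) ≠ ⊤ := measure_closedBall_lt_top.ne
  set v := (volume (Metric.closedBall (0 : Ed d) R)).toReal with hv
  have hv0 : 0 ≤ v := ENNReal.toReal_nonneg
  refine ⟨C * (3 * v), by positivity, fun u w => ?_⟩
  have pt : ∀ z, ENNReal.ofReal |Sd φ u z w| ≤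
      ENNReal.ofReal (C * ‖w‖ ^ 2) * (B z + B (z + w) + B (z - w)) := by
    intro z
    by_cases h : ‖z‖ ≤ R ∨ ‖z + w‖ ≤ R ∨ ‖z - w‖ ≤ R
    · have h1 : 1 ≤ B z + B (z + w) + B (z - w) := by
        rcases h with h | h | h
        · rw [hB1 _ h, add_assoc]; exact le_self_add
        · rw [hB1 _ h, add_comm (B z), add_assoc]; exact le_self_add
        · rw [hB1 _ h]; exact le_add_self
      calc _ ≤ ENNReal.ofReal (C * ‖w‖ ^ 2) * 1 := by
            rw [mul_one]; exact ENNReal.ofReal_le_ofReal (hC u z w)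
        _ ≤ _ := mul_le_mul_right h1 _
    · push Not at h
      have h0 : ∀ y : Ed d, R < ‖y‖ → φ (u, y) = 0 := fun y hy => by
        by_contra h; exact absurd (hR u y h).2 (not_le.2 hy)
      simp [Sd, h0 _ h.1, h0 _ h.2.1, h0 _ h.2.2]
  have m1 : Measurable fun z : Ed d => B (z + w) := hBm.comp (measurable_add_const w)
  have m2 : Measurable fun z : Ed d => B (z - w) := hBm.comp (measurable_sub_const w)
  have m12 : Measurable fun z : Ed d => B z + B (z + w) := hBm.add m1
  have m3 : Measurable fun z : Ed d => B z + B (z + w) + B (z - w) := m12.add m2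
  refine (lintegral_mono pt).trans ?_
  rw [lintegral_const_mul _ m3, lintegral_add_left m12, lintegral_add_left hBm,
    lintegral_add_right_eq_self B w, lintegral_sub_right_eq_self B w, hBv,
    ← ENNReal.ofReal_toReal hfin, ← hv, ← ENNReal.ofReal_add hv0 hv0,
    ← ENNReal.ofReal_add (by positivity) hv0, ← ENNReal.ofReal_mul (by positivity)]
  refine ENNReal.ofReal_le_ofReal (le_of_eq (by ring))

lemma Sd_nu_integrable {d : ℕ} (hd : 0 < d) {α : ℝ} (h0 : 0 < α) (h2 : α < 2)
    {φ : ℝ × Ed d → ℝ} (hφ : ContDiff ℝ (⊤ : ℕ∞) φ)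
    (hφc : HasCompactSupport φ) (u : ℝ) (z : Ed d) :
    Integrable fun w => Sd φ u z w * levyNu d α w := by
  obtain ⟨C, hC0, hC⟩ := Sd_bound hφ hφc
  have ms : Measurable fun w => Sd φ u z w :=
    (Sd_meas hφ.continuous).comp (measurable_prodMk_left (x := (u, z)))
  refine ((levy_sq hd h0 h2).const_mul C).mono' (ms.mul (levyNu_meas d α)).aestronglyMeasurable
    (Eventually.of_forall fun w => ?_)
  rw [Real.norm_eq_abs, abs_mul, abs_of_nonneg (levyNu_nonneg d α w), ← mul_assoc]
  exact mul_le_mul_of_nonneg_right (hC u z w) (levyNu_nonneg d α w)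

lemma relFracOp_eq {d : ℕ} (hd : 0 < d) {α : ℝ} (h0 : 0 < α) (h2 : α < 2)
    {φ : ℝ × Ed d → ℝ} (hφ : ContDiff ℝ (⊤ : ℕ∞) φ)
    (hφc : HasCompactSupport φ) (u : ℝ) (z : Ed d) :
    relFracOp d α φ u z = Lop d α φ u z := by
  unfold relFracOp Lop
  congr 1
  have hintg := Sd_nu_integrable hd h0 h2 hφ hφc u z
  have hms : ∀ ε : ℝ, MeasurableSet {w : Ed d | ε < ‖w‖} := fun ε =>
    measurableSet_lt measurable_const measurable_norm
  obtain ⟨M, hM⟩ := hφc.exists_bound_of_continuous hφ.continuous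
  have hcont := hφ.continuous
  have mA : ∀ y : Ed d → Ed d, Continuous y → Measurable fun w : Ed d => φ (u, y w) - φ (u, z) :=
    fun y hy => by
      have : Continuous fun w : Ed d => φ (u, y w) - φ (u, z) := by fun_prop
      exact this.measurable
  have hi : ∀ ε : ℝ, 0 < ε → ∀ y : Ed d → Ed d, Continuous y →
      IntegrableOn (fun w : Ed d => (φ (u, y w) - φ (u, z)) * levyNu d α w) {w | ε < ‖w‖} := by
    intro ε hε y hy
    refine (((levy_sq hd h0 h2).const_mul (2 * M / ε ^ 2)).integrableOn).mono'
      ((mA y hy).mul (levyNu_meas d α)).aestronglyMeasurable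
      ((ae_restrict_iff' (hms ε)).2 (Eventually.of_forall fun w hw => ?_))
    have hw' : ε < ‖w‖ := hw
    have a1 := hM (u, y w)
    have a2 := hM (u, z)
    have hM0 : 0 ≤ M := (norm_nonneg _).trans a2
    rw [Real.norm_eq_abs, abs_mul, abs_of_nonneg (levyNu_nonneg d α w), ← mul_assoc]
    refine mul_le_mul_of_nonneg_right ?_ (levyNu_nonneg d α w)
    have b1 : |φ (u, y w) - φ (u, z)| ≤ 2 * M := by
      rw [Real.norm_eq_abs] at a1 a2
      rw [abs_le] at *
      constructor <;> linarith [a1.1, a1.2, a2.1, a2.2]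
    refine b1.trans ?_
    have : 1 ≤ ‖w‖ ^ 2 / ε ^ 2 := by
      rw [one_le_div (by positivity)]; gcongr
    calc 2 * M = 2 * M * 1 := by ring
      _ ≤ 2 * M * (‖w‖ ^ 2 / ε ^ 2) := by gcongr
      _ = _ := by ring
  have heq : ∀ ε : ℝ, 0 < ε → ∫ w in {w : Ed d | ε < ‖w‖}, (φ (u, z + w) - φ (u, z)) * levyNu d α w
      = ∫ w, {w : Ed d | ε < ‖w‖}.indicator (fun w => Sd φ u z w * levyNu d α w) w := by
    intro ε hε
    rw [integral_indicator (hms ε)]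
    have i1 := hi ε hε (fun w => z + w) (by fun_prop)
    have i2 := hi ε hε (fun w => z - w) (by fun_prop)
    have s1 : ∫ w in {w : Ed d | ε < ‖w‖}, (φ (u, z + w) - φ (u, z)) * levyNu d α w =
        ∫ w in {w : Ed d | ε < ‖w‖}, (φ (u, z - w) - φ (u, z)) * levyNu d α w := by
      rw [← integral_indicator (hms ε), ← integral_indicator (hms ε),
        ← integral_neg_eq_self]
      refine integral_congr_ae (Eventually.of_forall fun w => ?_)
      simp only [indicator, mem_ofPred_eq, norm_neg, levyNu_neg, sub_eq_add_neg]
    have s2 : ∫ w in {w : Ed d | ε < ‖w‖}, Sd φ u z w * levyNu d α w =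
        ∫ w in {w : Ed d | ε < ‖w‖}, ((1 / 2) * ((φ (u, z + w) - φ (u, z)) * levyNu d α w) +
          (1 / 2) * ((φ (u, z - w) - φ (u, z)) * levyNu d α w)) := by
      refine integral_congr_ae (Eventually.of_forall fun w => ?_)
      simp only [Sd]; ring
    rw [s2, integral_add (i1.const_mul _) (i2.const_mul _), integral_const_mul, integral_const_mul,
      ← s1]
    ring
  refine Tendsto.limUnder_eq ?_
  have hlim : Tendsto (fun ε : ℝ => ∫ w, {w : Ed d | ε < ‖w‖}.indicator
      (fun w => Sd φ u z w * levyNu d α w) w) (nhdsWithin 0 (Ioi 0))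
      (nhds (∫ w, Sd φ u z w * levyNu d α w)) := by
    refine tendsto_integral_filter_of_dominated_convergence
      (fun w => ‖Sd φ u z w * levyNu d α w‖) ?_ ?_ hintg.norm ?_
    · exact Eventually.of_forall fun ε => (hintg.indicator (hms ε)).aestronglyMeasurable
    · exact Eventually.of_forall fun ε => Eventually.of_forall fun w => norm_indicator_le_norm_self _ _
    · filter_upwards [ae_ne_zero hd] with w hw
      refine tendsto_const_nhds.congr' ?_
      have : ∀ᶠ ε : ℝ in nhdsWithin 0 (Ioi 0), ε < ‖w‖ :=
        mem_nhdsWithin_of_mem_nhds (Iio_mem_nhds (norm_pos_iff.2 hw))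
      filter_upwards [this] with ε hε
      rw [indicator_of_mem]
      exact hε
  refine hlim.congr' ?_
  filter_upwards [self_mem_nhdsWithin] with ε hε
  exact (heq ε hε).symm


lemma Lop_meas {d : ℕ} (α : ℝ) {φ : ℝ × Ed d → ℝ} (hφ : Continuous φ) :
    Measurable fun q : ℝ × Ed d => Lop d α φ q.1 q.2 := by
  have h1 : Measurable fun q : (ℝ × Ed d) × Ed d => Sd φ q.1.1 q.1.2 q.2 * levyNu d α q.2 :=
    (Sd_meas hφ).mul ((levyNu_meas d α).comp measurable_snd)
  have h2 : Measurable fun q : ℝ × Ed d => ∫ w : Ed d, Sd φ q.1 q.2 w * levyNu d α w :=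
    (StronglyMeasurable.integral_prod_right' (ν := (volume : Measure (Ed d)))
      h1.stronglyMeasurable).measurable
  exact hφ.measurable.sub h2

lemma Lop_zero {d : ℕ} (α : ℝ) {φ : ℝ × Ed d → ℝ} {R : ℝ}
    (hR : ∀ u z, φ (u, z) ≠ 0 → |u| ≤ R ∧ ‖z‖ ≤ R) {u : ℝ} (hu : R < |u|) (z : Ed d) :
    Lop d α φ u z = 0 := by
  have h : φ (u, z) = 0 := by
    by_contra h; exact absurd (hR u z h).1 (not_le.2 hu)
  simp [Lop, h, Sd_zero hR hu]

lemma Lop_bdd {d : ℕ} (hd : 0 < d) {α : ℝ} (h0 : 0 < α) (h2 : α < 2)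
    {φ : ℝ × Ed d → ℝ} (hφ : ContDiff ℝ (⊤ : ℕ∞) φ)
    (hφc : HasCompactSupport φ) : ∃ C : ℝ, 0 ≤ C ∧ ∀ u z, |Lop d α φ u z| ≤ C := by
  obtain ⟨C, hC0, hC⟩ := Sd_bound hφ hφc
  obtain ⟨M, hM⟩ := hφc.exists_bound_of_continuous hφ.continuous
  have hM0 : 0 ≤ M := (norm_nonneg _).trans (hM (0, 0))
  have hI0 : 0 ≤ ∫ w : Ed d, C * (‖w‖ ^ 2 * levyNu d α w) :=
    integral_nonneg fun w => mul_nonneg hC0 (mul_nonneg (by positivity) (levyNu_nonneg d α w))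
  refine ⟨M + ∫ w : Ed d, C * (‖w‖ ^ 2 * levyNu d α w), by positivity, fun u z => ?_⟩
  unfold Lop
  refine (abs_sub _ _).trans (add_le_add (hM (u, z)) ?_)
  rw [← Real.norm_eq_abs]
  refine norm_integral_le_of_norm_le ((levy_sq hd h0 h2).const_mul C)
    (Eventually.of_forall fun w => ?_)
  rw [Real.norm_eq_abs, abs_mul, abs_of_nonneg (levyNu_nonneg d α w), ← mul_assoc]
  exact mul_le_mul_of_nonneg_right (hC u z w) (levyNu_nonneg d α w)

lemma Sd_nu_prod {d : ℕ} (hd : 0 < d) {α : ℝ} (h0 : 0 < α) (h2 : α < 2)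
    {φ : ℝ × Ed d → ℝ} (hφ : ContDiff ℝ (⊤ : ℕ∞) φ)
    (hφc : HasCompactSupport φ) : ∃ K : ℝ, 0 ≤ K ∧ ∀ u : ℝ,
    ∫⁻ z : Ed d, ∫⁻ w : Ed d, ENNReal.ofReal |Sd φ u z w * levyNu d α w| ≤ ENNReal.ofReal K := by
  obtain ⟨K, hK0, hK⟩ := Sd_L1 hφ hφc
  refine ⟨∫ w : Ed d, K * (‖w‖ ^ 2 * levyNu d α w), integral_nonneg fun w => mul_nonneg hK0
    (mul_nonneg (by positivity) (levyNu_nonneg d α w)), fun u => ?_⟩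
  have ms : Measurable fun q : Ed d × Ed d => Sd φ u q.1 q.2 := by
    have : Continuous fun q : Ed d × Ed d => Sd φ u q.1 q.2 := by
      have := hφ.continuous
      unfold Sd; fun_prop
    exact this.measurable
  rw [lintegral_lintegral_swap (Measurable.aemeasurable
    ((measurable_norm.comp (ms.mul ((levyNu_meas d α).comp measurable_snd))).ennreal_ofReal)),
    ofReal_integral_eq_lintegral_ofReal ((levy_sq hd h0 h2).const_mul K)
    (Eventually.of_forall fun w => mul_nonneg hK0
    (mul_nonneg (by positivity) (levyNu_nonneg d α w)))]
  refine lintegral_mono fun w => ?_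
  have e : ∀ z, ENNReal.ofReal |Sd φ u z w * levyNu d α w| =
      ENNReal.ofReal |Sd φ u z w| * ENNReal.ofReal (levyNu d α w) := fun z => by
    rw [abs_mul, abs_of_nonneg (levyNu_nonneg d α w), ENNReal.ofReal_mul (abs_nonneg _)]
  have mz : Measurable fun z => ENNReal.ofReal |Sd φ u z w| :=
    (measurable_norm.comp (ms.comp (measurable_prodMk_right (y := w)))).ennreal_ofReal
  simp_rw [e]
  rw [lintegral_mul_const _ mz, ← mul_assoc, ENNReal.ofReal_mul (by positivity)]
  exact mul_le_mul_left (hK u w) _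

lemma phi_sec_integrable {d : ℕ} {φ : ℝ × Ed d → ℝ} (hφ : Continuous φ)
    (hφc : HasCompactSupport φ) (u : ℝ) : Integrable fun z : Ed d => φ (u, z) := by
  have hc : Continuous fun z : Ed d => φ (u, z) := by fun_prop
  refine hc.integrable_of_hasCompactSupport ?_
  obtain ⟨R, hR0, hR⟩ := phi_supp hφc
  refine HasCompactSupport.intro (isCompact_closedBall (0 : Ed d) R) fun z hz => ?_
  by_contra h
  exact hz (by simpa using (hR u z h).2)

lemma Sd_nu_int_prod {d : ℕ} (hd : 0 < d) {α : ℝ} (h0 : 0 < α) (h2 : α < 2)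
    {φ : ℝ × Ed d → ℝ} (hφ : ContDiff ℝ (⊤ : ℕ∞) φ)
    (hφc : HasCompactSupport φ) (u : ℝ) :
    Integrable (fun q : Ed d × Ed d => Sd φ u q.1 q.2 * levyNu d α q.2)
      ((volume : Measure (Ed d)).prod volume) := by
  obtain ⟨K, hK0, hK⟩ := Sd_nu_prod hd h0 h2 hφ hφc
  have ms : Measurable fun q : Ed d × Ed d => Sd φ u q.1 q.2 := by
    have : Continuous fun q : Ed d × Ed d => Sd φ u q.1 q.2 := by
      have := hφ.continuous
      unfold Sd; fun_prop
    exact this.measurable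
  have mm : Measurable fun q : Ed d × Ed d => Sd φ u q.1 q.2 * levyNu d α q.2 :=
    ms.mul ((levyNu_meas d α).comp measurable_snd)
  refine ⟨mm.aestronglyMeasurable, ?_⟩
  rw [hasFiniteIntegral_iff_norm, lintegral_prod]
  · exact (hK u).trans_lt ENNReal.ofReal_lt_top
  · exact mm.norm.ennreal_ofReal.aemeasurable

lemma Lop_L1 {d : ℕ} (hd : 0 < d) {α : ℝ} (h0 : 0 < α) (h2 : α < 2)
    {φ : ℝ × Ed d → ℝ} (hφ : ContDiff ℝ (⊤ : ℕ∞) φ)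
    (hφc : HasCompactSupport φ) : Integrable (fun q : ℝ × Ed d => Lop d α φ q.1 q.2) := by
  obtain ⟨K, hK0, hK⟩ := Sd_nu_prod hd h0 h2 hφ hφc
  obtain ⟨R, hR0, hR⟩ := phi_supp hφc
  have hm := Lop_meas α hφ.continuous
  have h1 : Integrable φ := hφ.continuous.integrable_of_hasCompactSupport hφc
  have m2 : Measurable fun q : ℝ × Ed d => ∫ w : Ed d, Sd φ q.1 q.2 w * levyNu d α w := by
    have := hφ.continuous.measurable.sub hm
    simpa [Lop, Pi.sub_def] using this
  suffices h : Integrable (fun q : ℝ × Ed d => ∫ w : Ed d, Sd φ q.1 q.2 w * levyNu d α w) from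
    h1.sub h
  refine ⟨m2.aestronglyMeasurable, ?_⟩
  rw [hasFiniteIntegral_iff_norm, Measure.volume_eq_prod,
    lintegral_prod _ m2.norm.ennreal_ofReal.aemeasurable]
  calc _ ≤ ∫⁻ u : ℝ, (Icc (-R) R).indicator (fun _ => ENNReal.ofReal K) u := by
        refine lintegral_mono fun u => ?_
        by_cases hu : |u| ≤ R
        · rw [indicator_of_mem (show u ∈ Icc (-R) R from abs_le.1 hu)]
          refine le_trans (lintegral_mono fun z => ?_) (hK u)
          have := enorm_integral_le_lintegral_enorm (μ := volume)
            (fun w : Ed d => Sd φ u z w * levyNu d α w)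
          simpa only [← ofReal_norm_eq_enorm, Real.norm_eq_abs] using this
        · have := Sd_zero hR (not_le.1 hu)
          simp [this]
    _ < ⊤ := by
        rw [lintegral_indicator measurableSet_Icc]
        simp only [lintegral_const, Measure.restrict_apply_univ]
        exact ENNReal.mul_lt_top ENNReal.ofReal_lt_top measure_Icc_lt_top

lemma Sd_fourier {d : ℕ} {φ : ℝ × Ed d → ℝ} (hφ : Continuous φ)
    (hφc : HasCompactSupport φ) (u : ℝ) (x ξ w : Ed d) :
    ∫ z : Ed d, Sd φ u z w * Real.cos ⟪z - x, ξ⟫ =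
      (Real.cos ⟪ξ, w⟫ - 1) * ∫ z : Ed d, φ (u, z) * Real.cos ⟪z - x, ξ⟫ := by
  have hi := phi_sec_integrable hφ hφc u
  have hb : ∀ (f g : Ed d → ℝ), Integrable f → Continuous g →
      Integrable fun z => f z * Real.cos (g z) := by
    intro f g hf hg
    refine hf.mul_bdd (c := 1) (by fun_prop : Continuous fun z => Real.cos (g z)).aestronglyMeasurable
      (Eventually.of_forall fun z => Real.abs_cos_le_one _)
  have i1 : Integrable fun z : Ed d => φ (u, z + w) * Real.cos ⟪z - x, ξ⟫ :=
    hb _ _ (hi.comp_add_right w) (by fun_prop)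
  have i2 : Integrable fun z : Ed d => φ (u, z - w) * Real.cos ⟪z - x, ξ⟫ :=
    hb _ _ (hi.comp_sub_right w) (by fun_prop)
  have i3 : Integrable fun z : Ed d => φ (u, z) * Real.cos ⟪z - x, ξ⟫ :=
    hb _ _ hi (by fun_prop)
  have j1 : Integrable fun z : Ed d => φ (u, z) * Real.cos ⟪z - w - x, ξ⟫ :=
    hb _ _ hi (by fun_prop)
  have j2 : Integrable fun z : Ed d => φ (u, z) * Real.cos ⟪z + w - x, ξ⟫ :=
    hb _ _ hi (by fun_prop)
  have e1 : ∫ z : Ed d, φ (u, z + w) * Real.cos ⟪z - x, ξ⟫ =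
      ∫ z : Ed d, φ (u, z) * Real.cos ⟪z - w - x, ξ⟫ := by
    rw [← integral_add_right_eq_self (fun z : Ed d => φ (u, z) * Real.cos ⟪z - w - x, ξ⟫) w]
    simp
  have e2 : ∫ z : Ed d, φ (u, z - w) * Real.cos ⟪z - x, ξ⟫ =
      ∫ z : Ed d, φ (u, z) * Real.cos ⟪z + w - x, ξ⟫ := by
    rw [← integral_sub_right_eq_self (fun z : Ed d => φ (u, z) * Real.cos ⟪z + w - x, ξ⟫) w]
    simp
  have e0 : ∀ z : Ed d, Sd φ u z w * Real.cos ⟪z - x, ξ⟫ =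
      (1 / 2) * (φ (u, z + w) * Real.cos ⟪z - x, ξ⟫) +
      (1 / 2) * (φ (u, z - w) * Real.cos ⟪z - x, ξ⟫) - φ (u, z) * Real.cos ⟪z - x, ξ⟫ :=
    fun z => by unfold Sd; ring
  simp_rw [e0]
  have i12 : Integrable fun z : Ed d => (1 / 2) * (φ (u, z + w) * Real.cos ⟪z - x, ξ⟫) +
      (1 / 2) * (φ (u, z - w) * Real.cos ⟪z - x, ξ⟫) := (i1.const_mul _).add (i2.const_mul _)
  rw [integral_sub i12 i3, integral_add (i1.const_mul _) (i2.const_mul _), integral_const_mul,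
    integral_const_mul, e1, e2, ← mul_add, ← integral_add j1 j2]
  have e3 : ∀ z : Ed d, φ (u, z) * Real.cos ⟪z - w - x, ξ⟫ + φ (u, z) * Real.cos ⟪z + w - x, ξ⟫ =
      (2 * Real.cos ⟪ξ, w⟫) * (φ (u, z) * Real.cos ⟪z - x, ξ⟫) := by
    intro z
    have a1 : ⟪z - w - x, ξ⟫ = ⟪z - x, ξ⟫ - ⟪ξ, w⟫ := by
      rw [real_inner_comm w ξ, ← inner_sub_left]; congr 1; abel
    have a2 : ⟪z + w - x, ξ⟫ = ⟪z - x, ξ⟫ + ⟪ξ, w⟫ := by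
      rw [real_inner_comm w ξ, ← inner_add_left]; congr 1; abel
    rw [a1, a2, Real.cos_sub, Real.cos_add]; ring
  simp_rw [e3]
  rw [integral_const_mul]; ring

lemma Lop_fourier {d : ℕ} (hd : 0 < d) {α : ℝ} (h0 : 0 < α) (h2 : α < 2)
    {φ : ℝ × Ed d → ℝ} (hφ : ContDiff ℝ (⊤ : ℕ∞) φ)
    (hφc : HasCompactSupport φ) (u : ℝ) (x ξ : Ed d) :
    ∫ z : Ed d, Lop d α φ u z * Real.cos ⟪z - x, ξ⟫ =
      psi α ξ * ∫ z : Ed d, φ (u, z) * Real.cos ⟪z - x, ξ⟫ := by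
  have hi := phi_sec_integrable hφ.continuous hφc u
  have hp := Sd_nu_int_prod hd h0 h2 hφ hφc u
  have hcc : Continuous fun z : Ed d => Real.cos ⟪z - x, ξ⟫ := by fun_prop
  have i1 : Integrable fun z : Ed d => φ (u, z) * Real.cos ⟪z - x, ξ⟫ :=
    hi.mul_bdd (c := 1) hcc.aestronglyMeasurable
      (Eventually.of_forall fun z => Real.abs_cos_le_one _)
  have i2 : Integrable fun z : Ed d => (∫ w : Ed d, Sd φ u z w * levyNu d α w) *
      Real.cos ⟪z - x, ξ⟫ :=
    hp.integral_prod_left.mul_bdd (c := 1) hcc.aestronglyMeasurable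
      (Eventually.of_forall fun z => Real.abs_cos_le_one _)
  have e0 : ∀ z, Lop d α φ u z * Real.cos ⟪z - x, ξ⟫ = φ (u, z) * Real.cos ⟪z - x, ξ⟫ -
      (∫ w : Ed d, Sd φ u z w * levyNu d α w) * Real.cos ⟪z - x, ξ⟫ := fun z => by
    unfold Lop; ring
  simp_rw [e0]
  rw [integral_sub i1 i2]
  have e1 : ∫ z : Ed d, (∫ w : Ed d, Sd φ u z w * levyNu d α w) * Real.cos ⟪z - x, ξ⟫ =
      ∫ z : Ed d, ∫ w : Ed d, Sd φ u z w * levyNu d α w * Real.cos ⟪z - x, ξ⟫ := by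
    simp_rw [← integral_mul_const]
  have hp2 : Integrable (Function.uncurry fun z w : Ed d =>
      Sd φ u z w * levyNu d α w * Real.cos ⟪z - x, ξ⟫)
      ((volume : Measure (Ed d)).prod volume) :=
    hp.mul_bdd (c := 1) (hcc.comp continuous_fst).aestronglyMeasurable
      (Eventually.of_forall fun z => Real.abs_cos_le_one _)
  rw [e1, integral_integral_swap hp2]
  have e2 : ∀ w : Ed d, ∫ z : Ed d, Sd φ u z w * levyNu d α w * Real.cos ⟪z - x, ξ⟫ =
      -(∫ z : Ed d, φ (u, z) * Real.cos ⟪z - x, ξ⟫) * ((1 - Real.cos ⟪ξ, w⟫) * levyNu d α w) := by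
    intro w
    have : ∀ z, Sd φ u z w * levyNu d α w * Real.cos ⟪z - x, ξ⟫ =
      levyNu d α w * (Sd φ u z w * Real.cos ⟪z - x, ξ⟫) := fun z => by ring
    simp_rw [this]
    rw [integral_const_mul, Sd_fourier hφ.continuous hφc]; ring
  simp_rw [e2]
  rw [integral_const_mul, levy_cos hd h0 h2]
  ring


def dphi {d : ℕ} (φ : ℝ × Ed d → ℝ) (q : ℝ × Ed d) : ℝ := deriv (fun u : ℝ => φ (u, q.2)) q.1

lemma dphi_hasDerivAt {d : ℕ} {φ : ℝ × Ed d → ℝ} (hφ : ContDiff ℝ (⊤ : ℕ∞) φ) (u : ℝ) (z : Ed d) :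
    HasDerivAt (fun u : ℝ => φ (u, z)) (fderiv ℝ φ (u, z) (1, 0)) u := by
  have h1 : HasFDerivAt φ (fderiv ℝ φ (u, z)) (u, z) :=
    ((hφ.differentiable (by simp)) (u, z)).hasFDerivAt
  have h2 : HasDerivAt (fun u : ℝ => ((u, z) : ℝ × Ed d)) (1, 0) u :=
    (hasDerivAt_id u).prodMk (hasDerivAt_const u z)
  exact h1.comp_hasDerivAt u h2

lemma dphi_eq {d : ℕ} {φ : ℝ × Ed d → ℝ} (hφ : ContDiff ℝ (⊤ : ℕ∞) φ) :
    dphi φ = fun q => fderiv ℝ φ q (1, 0) := by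
  funext q
  exact (dphi_hasDerivAt hφ q.1 q.2).deriv

lemma dphi_cont {d : ℕ} {φ : ℝ × Ed d → ℝ} (hφ : ContDiff ℝ (⊤ : ℕ∞) φ) : Continuous (dphi φ) := by
  rw [dphi_eq hφ]
  exact (hφ.continuous_fderiv (by simp)).clm_apply continuous_const

lemma dphi_supp {d : ℕ} {φ : ℝ × Ed d → ℝ} (hφ : ContDiff ℝ (⊤ : ℕ∞) φ)
    (hφc : HasCompactSupport φ) : HasCompactSupport (dphi φ) := by
  rw [dphi_eq hφ]
  exact hφc.fderiv_apply ℝ (1, 0)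

lemma shift_int {d : ℕ} {F : ℝ × Ed d → ℝ} (hF : Integrable F) (s ε : ℝ) :
    Integrable (fun q : ℝ × Ed d => F (s + q.1, q.2))
      ((volume.restrict (Ioi ε)).prod (volume : Measure (Ed d))) := by
  rw [Measure.volume_eq_prod] at hF
  have h1 : Integrable (fun q : ℝ × Ed d => F (((s, 0) : ℝ × Ed d) + q))
    ((volume : Measure ℝ).prod (volume : Measure (Ed d))) := hF.comp_add_left _
  have h2 : (fun q : ℝ × Ed d => F (((s, 0) : ℝ × Ed d) + q)) = fun q => F (s + q.1, q.2) := by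
    funext q; congr 1; ext <;> simp
  rw [h2] at h1
  have h3 : (volume.restrict (Ioi ε)).prod (volume : Measure (Ed d)) =
    ((volume : Measure ℝ).prod (volume : Measure (Ed d))).restrict (Ioi ε ×ˢ univ) := by
    rw [← Measure.prod_restrict, Measure.restrict_univ]
  rw [h3]
  exact h1.restrict

lemma free_xi {d : ℕ} (hd : 0 < d) {α : ℝ} (h0 : 0 < α) (h2 : α < 2)
    {φ : ℝ × Ed d → ℝ} (hφ : ContDiff ℝ (⊤ : ℕ∞) φ)
    (hφc : HasCompactSupport φ) (s : ℝ) (x ξ : Ed d) {ε : ℝ} (hε : 0 < ε) :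
    ∫ q : ℝ × Ed d, (dphi φ (s + q.1, q.2) - Lop d α φ (s + q.1) q.2) *
        (Real.cos ⟪q.2 - x, ξ⟫ * Real.exp (-q.1 * psi α ξ))
      ∂((volume.restrict (Ioi ε)).prod (volume : Measure (Ed d))) =
    -(Real.exp (-ε * psi α ξ) * ∫ z : Ed d, φ (s + ε, z) * Real.cos ⟪z - x, ξ⟫) := by
  have hψ : 1 ≤ psi α ξ := psi_ge_one h0 ξ
  set ψ := psi α ξ with hψdef
  set ρ := ((volume.restrict (Ioi ε)).prod (volume : Measure (Ed d))) with hρ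
  have i1 : Integrable (fun q : ℝ × Ed d => dphi φ (s + q.1, q.2)) ρ := shift_int
    ((dphi_cont hφ).integrable_of_hasCompactSupport (dphi_supp hφ hφc)) s ε
  have i2 : Integrable (fun q : ℝ × Ed d => Lop d α φ (s + q.1) q.2) ρ :=
    shift_int (F := fun q => Lop d α φ q.1 q.2) (Lop_L1 hd h0 h2 hφ hφc) s ε
  have i3 : Integrable (fun q : ℝ × Ed d => φ (s + q.1, q.2)) ρ :=
    shift_int (hφ.continuous.integrable_of_hasCompactSupport hφc) s ε
  have hae : ∀ᵐ q ∂ρ, ε < q.1 := by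
    have : ∀ᵐ t ∂(volume.restrict (Ioi ε)), ε < t := ae_restrict_mem measurableSet_Ioi
    exact (Measure.quasiMeasurePreserving_fst (μ := volume.restrict (Ioi ε))
      (ν := (volume : Measure (Ed d)))).ae this
  have hb : ∀ F : ℝ × Ed d → ℝ, Integrable F ρ → Integrable (fun q => F q *
      (Real.cos ⟪q.2 - x, ξ⟫ * Real.exp (-q.1 * ψ))) ρ := by
    intro F hF
    refine hF.mul_bdd (c := 1) ?_ ?_
    · exact (by fun_prop : Continuous fun q : ℝ × Ed d =>
        Real.cos ⟪q.2 - x, ξ⟫ * Real.exp (-q.1 * ψ)).aestronglyMeasurable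
    · filter_upwards [hae] with q hq
      have hq' : 0 < q.1 := hε.trans hq
      have e1 : Real.exp (-q.1 * ψ) ≤ 1 := by
        rw [Real.exp_le_one_iff]; nlinarith
      rw [Real.norm_eq_abs, abs_mul, abs_of_pos (Real.exp_pos _)]
      calc _ ≤ 1 * 1 := mul_le_mul (Real.abs_cos_le_one _) e1 (Real.exp_pos _).le zero_le_one
        _ = 1 := one_mul 1
  have eL : ∫ q, Lop d α φ (s + q.1) q.2 * (Real.cos ⟪q.2 - x, ξ⟫ * Real.exp (-q.1 * ψ)) ∂ρ =
      ∫ q, (ψ * φ (s + q.1, q.2)) * (Real.cos ⟪q.2 - x, ξ⟫ * Real.exp (-q.1 * ψ)) ∂ρ := by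
    rw [hρ, integral_prod _ (hb _ i2), integral_prod _ (hb _ (i3.const_mul ψ))]
    refine integral_congr_ae (Eventually.of_forall fun t => ?_)
    have a1 : ∀ z : Ed d, Lop d α φ (s + t) z * (Real.cos ⟪z - x, ξ⟫ * Real.exp (-t * ψ)) =
      (Lop d α φ (s + t) z * Real.cos ⟪z - x, ξ⟫) * Real.exp (-t * ψ) := fun z => by ring
    have a2 : ∀ z : Ed d, ψ * φ (s + t, z) * (Real.cos ⟪z - x, ξ⟫ * Real.exp (-t * ψ)) =
      (φ (s + t, z) * Real.cos ⟪z - x, ξ⟫) * (ψ * Real.exp (-t * ψ)) := fun z => by ring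
    simp only [a1, a2]
    rw [integral_mul_const, integral_mul_const, Lop_fourier hd h0 h2 hφ hφc, ← hψdef]
    ring
  have e0 : ∀ q : ℝ × Ed d, (dphi φ (s + q.1, q.2) - Lop d α φ (s + q.1) q.2) *
        (Real.cos ⟪q.2 - x, ξ⟫ * Real.exp (-q.1 * ψ)) =
        dphi φ (s + q.1, q.2) * (Real.cos ⟪q.2 - x, ξ⟫ * Real.exp (-q.1 * ψ)) -
        Lop d α φ (s + q.1) q.2 * (Real.cos ⟪q.2 - x, ξ⟫ * Real.exp (-q.1 * ψ)) :=
    fun q => by ring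
  simp_rw [e0]
  have i4 : Integrable (fun q : ℝ × Ed d =>
      dphi φ (s + q.1, q.2) * (Real.cos ⟪q.2 - x, ξ⟫ * Real.exp (-q.1 * ψ)) -
      ψ * φ (s + q.1, q.2) * (Real.cos ⟪q.2 - x, ξ⟫ * Real.exp (-q.1 * ψ))) ρ :=
    (hb _ i1).sub (hb _ (i3.const_mul ψ))
  rw [integral_sub (hb _ i1) (hb _ i2), eL, ← integral_sub (hb _ i1) (hb _ (i3.const_mul ψ)),
    hρ, integral_prod_symm _ i4]
  have e3 : ∀ z : Ed d, ∫ t in Ioi ε, (dphi φ (s + t, z) * (Real.cos ⟪z - x, ξ⟫ *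
      Real.exp (-t * ψ)) - ψ * φ (s + t, z) * (Real.cos ⟪z - x, ξ⟫ * Real.exp (-t * ψ))) =
      -(Real.exp (-ε * ψ)) * (φ (s + ε, z) * Real.cos ⟪z - x, ξ⟫) := by
    intro z
    let f : ℝ → ℝ := fun t => Real.exp (-t * ψ) * φ (s + t, z)
    have hf : ContDiff ℝ 1 f := by
      have h1 : ContDiff ℝ 1 φ := hφ.of_le (by norm_cast)
      have h2 : ContDiff ℝ 1 fun t : ℝ => ((s + t, z) : ℝ × Ed d) := by fun_prop
      have h3 : ContDiff ℝ 1 fun t : ℝ => Real.exp (-t * ψ) := by fun_prop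
      exact h3.mul (h1.comp h2)
    obtain ⟨R, hR0, hR⟩ := phi_supp hφc
    have hfc : HasCompactSupport f := by
      refine HasCompactSupport.intro (isCompact_closedBall (-s) R) fun t ht => ?_
      have : φ (s + t, z) = 0 := by
        by_contra h
        refine ht ?_
        have := (hR _ _ h).1
        rw [Metric.mem_closedBall, Real.dist_eq]
        convert this using 2; ring
      simp [f, this]
    have hder : ∀ t, deriv f t = Real.exp (-t * ψ) * dphi φ (s + t, z) -
        ψ * Real.exp (-t * ψ) * φ (s + t, z) := by
      intro t
      have h1 : HasDerivAt (fun u : ℝ => φ (u, z)) (dphi φ (s + t, z)) (s + t) := by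
        rw [dphi_eq hφ]; exact dphi_hasDerivAt hφ (s + t) z
      have h2 : HasDerivAt (fun t : ℝ => φ (s + t, z)) (dphi φ (s + t, z)) t :=
        h1.comp_const_add s t
      have h3 : HasDerivAt (fun t : ℝ => Real.exp (-t * ψ)) (Real.exp (-t * ψ) * (-1 * ψ)) t :=
        (((hasDerivAt_id t).neg).mul_const ψ).exp
      have h4 := (h3.mul h2).deriv
      have h5 : deriv f t = _ := h4
      rw [h5]; ring
    have h6 := hfc.integral_Ioi_deriv_eq hf ε
    have e4 : ∀ t, dphi φ (s + t, z) * (Real.cos ⟪z - x, ξ⟫ *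
      Real.exp (-t * ψ)) - ψ * φ (s + t, z) * (Real.cos ⟪z - x, ξ⟫ * Real.exp (-t * ψ)) =
      Real.cos ⟪z - x, ξ⟫ * deriv f t := fun t => by rw [hder]; ring
    simp_rw [e4]
    rw [integral_const_mul, h6]
    simp only [f]; ring
  simp only [e3]
  rw [integral_const_mul]; ring

lemma free_eps {d : ℕ} (hd : 0 < d) {α : ℝ} (h0 : 0 < α) (h2 : α < 2)
    {φ : ℝ × Ed d → ℝ} (hφ : ContDiff ℝ (⊤ : ℕ∞) φ)
    (hφc : HasCompactSupport φ) (s : ℝ) (x : Ed d) {ε : ℝ} (hε : 0 < ε) :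
    ∫ q : ℝ × Ed d, relKernel d α 1 q.1 x q.2 *
        (dphi φ (s + q.1, q.2) - Lop d α φ (s + q.1) q.2)
      ∂((volume.restrict (Ioi ε)).prod (volume : Measure (Ed d))) =
    -∫ z : Ed d, relKernel d α 1 ε x z * φ (s + ε, z) := by
  set ρ := ((volume.restrict (Ioi ε)).prod (volume : Measure (Ed d))) with hρ
  have i1 : Integrable (fun q : ℝ × Ed d => dphi φ (s + q.1, q.2)) ρ := shift_int
    ((dphi_cont hφ).integrable_of_hasCompactSupport (dphi_supp hφ hφc)) s ε
  have i2 : Integrable (fun q : ℝ × Ed d => Lop d α φ (s + q.1) q.2) ρ :=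
    shift_int (F := fun q => Lop d α φ q.1 q.2) (Lop_L1 hd h0 h2 hφ hφc) s ε
  have i12 : Integrable (fun q : ℝ × Ed d => dphi φ (s + q.1, q.2) - Lop d α φ (s + q.1) q.2) ρ :=
    i1.sub i2
  have hae : ∀ᵐ q ∂ρ, ε < q.1 := by
    have : ∀ᵐ t ∂(volume.restrict (Ioi ε)), ε < t := ae_restrict_mem measurableSet_Ioi
    exact (Measure.quasiMeasurePreserving_fst (μ := volume.restrict (Ioi ε))
      (ν := (volume : Measure (Ed d)))).ae this
  have hψc := psi_cont (d := d) α
  have hE := integrable_exp_psi (d := d) h0 hε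
  have c1 : Continuous fun q : (ℝ × Ed d) × Ed d =>
      Real.cos ⟪q.1.2 - x, q.2⟫ * Real.exp (-q.1.1 * psi α q.2) := by fun_prop
  have J1 : Integrable (Function.uncurry fun (q : ℝ × Ed d) (ξ : Ed d) =>
      (dphi φ (s + q.1, q.2) - Lop d α φ (s + q.1) q.2) *
        (Real.cos ⟪q.2 - x, ξ⟫ * Real.exp (-q.1 * psi α ξ))) (ρ.prod (volume : Measure (Ed d))) := by
    refine (i12.norm.mul_prod hE).mono ?_ ?_
    · exact i12.aestronglyMeasurable.comp_fst.mul c1.aestronglyMeasurable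
    · have hae2 : ∀ᵐ q ∂(ρ.prod (volume : Measure (Ed d))), ε < q.1.1 :=
        (Measure.quasiMeasurePreserving_fst (μ := ρ) (ν := (volume : Measure (Ed d)))).ae hae
      filter_upwards [hae2] with q hq
      have hψ := psi_ge_one h0 q.2
      simp only [Function.uncurry, norm_mul, norm_norm]
      refine mul_le_mul_of_nonneg_left ?_ (norm_nonneg _)
      have e1 : ‖Real.exp (-q.1.1 * psi α q.2)‖ ≤ ‖Real.exp (-ε * psi α q.2)‖ := by
        rw [Real.norm_eq_abs, Real.norm_eq_abs, abs_of_pos (Real.exp_pos _),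
          abs_of_pos (Real.exp_pos _), Real.exp_le_exp]
        nlinarith
      calc _ ≤ 1 * ‖Real.exp (-ε * psi α q.2)‖ :=
            mul_le_mul (Real.abs_cos_le_one _) e1 (norm_nonneg _) zero_le_one
        _ = _ := one_mul _
  have iφ := phi_sec_integrable hφ.continuous hφc (s + ε)
  have J2 : Integrable (Function.uncurry fun (z : Ed d) (ξ : Ed d) =>
      φ (s + ε, z) * (Real.cos ⟪z - x, ξ⟫ * Real.exp (-ε * psi α ξ)))
      ((volume : Measure (Ed d)).prod (volume : Measure (Ed d))) := by
    have c2 : Continuous fun q : Ed d × Ed d =>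
      Real.cos ⟪q.1 - x, q.2⟫ * Real.exp (-ε * psi α q.2) := by fun_prop
    refine (iφ.norm.mul_prod hE).mono ?_ ?_
    · exact iφ.aestronglyMeasurable.comp_fst.mul c2.aestronglyMeasurable
    · refine Eventually.of_forall fun q => ?_
      simp only [Function.uncurry, norm_mul, norm_norm]
      refine mul_le_mul_of_nonneg_left ?_ (norm_nonneg _)
      calc _ ≤ 1 * ‖Real.exp (-ε * psi α q.2)‖ :=
            mul_le_mul_of_nonneg_right (Real.abs_cos_le_one _) (norm_nonneg _)
        _ = _ := one_mul _
  have e1 : ∀ q : ℝ × Ed d, relKernel d α 1 q.1 x q.2 *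
        (dphi φ (s + q.1, q.2) - Lop d α φ (s + q.1) q.2) = (2 * π) ^ (-(d : ℝ)) *
      ∫ ξ : Ed d, (dphi φ (s + q.1, q.2) - Lop d α φ (s + q.1) q.2) *
        (Real.cos ⟪q.2 - x, ξ⟫ * Real.exp (-q.1 * psi α ξ)) := by
    intro q
    rw [relKernel_eq, integral_const_mul]; ring
  have e2 : ∀ z : Ed d, relKernel d α 1 ε x z * φ (s + ε, z) = (2 * π) ^ (-(d : ℝ)) *
      ∫ ξ : Ed d, φ (s + ε, z) * (Real.cos ⟪z - x, ξ⟫ * Real.exp (-ε * psi α ξ)) := by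
    intro z
    rw [relKernel_eq, integral_const_mul]; ring
  simp_rw [e1, e2]
  rw [integral_const_mul, integral_const_mul, integral_integral_swap J1, integral_integral_swap J2]
  have e3 : ∀ ξ : Ed d, ∫ z : Ed d, φ (s + ε, z) * (Real.cos ⟪z - x, ξ⟫ * Real.exp (-ε * psi α ξ))
      = Real.exp (-ε * psi α ξ) * ∫ z : Ed d, φ (s + ε, z) * Real.cos ⟪z - x, ξ⟫ := by
    intro ξ
    rw [← integral_const_mul]
    refine integral_congr_ae (Eventually.of_forall fun z => ?_)
    simp only; ring
  simp_rw [e3, hρ, free_xi hd h0 h2 hφ hφc s x _ hε]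
  rw [integral_neg]; ring


lemma approx_id {d : ℕ} {α : ℝ} (h0 : 0 < α) (h2 : α < 2)
    {φ : ℝ × Ed d → ℝ} (hφ : ContDiff ℝ (⊤ : ℕ∞) φ)
    (hφc : HasCompactSupport φ) (s : ℝ) (x : Ed d) :
    Tendsto (fun ε : ℝ => ∫ z : Ed d, relKernel d α 1 ε x z * φ (s + ε, z))
      (nhdsWithin 0 (Ioi 0)) (nhds (φ (s, x))) := by
  obtain ⟨L0, hL0⟩ := ContDiff.lipschitzWith_of_hasCompactSupport hφc hφ (by simp)
  obtain ⟨M, hM⟩ := hφc.exists_bound_of_continuous hφ.continuous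
  have hM0 : 0 ≤ M := (norm_nonneg _).trans (hM (0, 0))
  set L : ℝ := L0 + 1 with hL
  have hLpos : 0 < L := by positivity
  have hLip : ∀ p q : ℝ × Ed d, |φ p - φ q| ≤ L * ‖p - q‖ := fun p q => by
    have := hL0.dist_le_mul p q
    rw [Real.dist_eq, dist_eq_norm] at this
    refine this.trans ?_
    gcongr; linarith
  set c : ℝ := 8 * 2 ^ ((d : ℝ) / 2) with hc
  -- Gaussian defect
  have hG : ∀ t : ℝ, 0 < t → Integrable (fun y : Ed d => relKernel d α 1 t x y *
      Real.exp (-‖y - x‖ ^ 2)) ∧ Real.exp (-t) - c * t ≤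
      ∫ y : Ed d, relKernel d α 1 t x y * Real.exp (-‖y - x‖ ^ 2) := by
    intro t ht
    have a1 := (kernel_gauss (d := d) h0 ht (by norm_num : (0 : ℝ) < 1 / 4) x x).1
    have a2 := kernel_gauss_ge (d := d) h0 h2 ht (by norm_num : (0 : ℝ) < 1 / 4) x x
    have e : ∀ y : Ed d, -(1 / (4 * (1 / 4 : ℝ))) * ‖y - x‖ ^ 2 = -‖y - x‖ ^ 2 := fun y => by ring
    simp only [e] at a1 a2
    refine ⟨a1, le_trans (le_of_eq ?_) a2⟩
    simp [hc]; ring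
  rw [Metric.tendsto_nhds]
  intro η hη
  obtain ⟨C, hC0, hC⟩ : ∃ C : ℝ, 0 ≤ C ∧ ∀ z : Ed d, |φ (s, z) - φ (s, x)| ≤
      η / 2 + C * (1 - Real.exp (-‖z - x‖ ^ 2)) := by
    set κ := 1 - Real.exp (-(η / (2 * L)) ^ 2) with hκ
    have hκ0 : 0 < κ := by
      have : Real.exp (-(η / (2 * L)) ^ 2) < 1 := by
        rw [Real.exp_lt_one_iff]
        have : 0 < (η / (2 * L)) ^ 2 := by positivity
        linarith
      linarith
    refine ⟨2 * M / κ, by positivity, fun z => ?_⟩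
    have hn : ‖((s, z) : ℝ × Ed d) - (s, x)‖ = ‖z - x‖ := by simp [Prod.norm_def]
    have h1 := hLip (s, z) (s, x)
    rw [hn] at h1
    have hexp : Real.exp (-‖z - x‖ ^ 2) ≤ 1 := by
      rw [Real.exp_le_one_iff]; have := sq_nonneg ‖z - x‖; linarith
    by_cases hz : ‖z - x‖ ≤ η / (2 * L)
    · have : L * ‖z - x‖ ≤ η / 2 := by
        calc _ ≤ L * (η / (2 * L)) := by gcongr
          _ = _ := by field_simp
      have h3 : 0 ≤ 2 * M / κ * (1 - Real.exp (-‖z - x‖ ^ 2)) :=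
        mul_nonneg (by positivity) (by linarith)
      linarith
    · have hz' := not_le.1 hz
      have a1 := hM (s, z)
      have a2 := hM (s, x)
      have b1 : |φ (s, z) - φ (s, x)| ≤ 2 * M := by
        rw [Real.norm_eq_abs] at a1 a2
        rw [abs_le] at *
        constructor <;> linarith [a1.1, a1.2, a2.1, a2.2]
      have b2 : κ ≤ 1 - Real.exp (-‖z - x‖ ^ 2) := by
        rw [hκ]
        have : Real.exp (-‖z - x‖ ^ 2) ≤ Real.exp (-(η / (2 * L)) ^ 2) := by
          rw [Real.exp_le_exp]
          have : (η / (2 * L)) ^ 2 ≤ ‖z - x‖ ^ 2 := by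
            have : 0 ≤ η / (2 * L) := by positivity
            gcongr
          linarith
        linarith
      have b3 : 2 * M ≤ 2 * M / κ * (1 - Real.exp (-‖z - x‖ ^ 2)) := by
        calc 2 * M = 2 * M / κ * κ := by field_simp
          _ ≤ _ := by gcongr
      linarith
  have hlim : Tendsto (fun ε : ℝ => L * ε + (C + M) * (1 - (Real.exp (-ε) - c * ε)))
      (nhdsWithin 0 (Ioi 0)) (nhds 0) := by
    have hc : Continuous fun ε : ℝ => L * ε + (C + M) * (1 - (Real.exp (-ε) - c * ε)) := by fun_prop
    have := (hc.tendsto 0).mono_left (nhdsWithin_le_nhds (s := Ioi (0 : ℝ)))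
    simpa using this
  have hev := hlim.eventually (gt_mem_nhds (half_pos hη))
  filter_upwards [hev, self_mem_nhdsWithin] with ε hε hε0
  have hε0' : 0 < ε := hε0
  obtain ⟨g1, g2⟩ := hG ε hε0'
  have ki := kernel_integrable (d := d) h0 h2 hε0' x
  have kl := kernel_integral_le (d := d) h0 h2 hε0' x
  have kn := fun z => relKernel_nonneg (d := d) h0 h2 hε0' x z
  have hcont := hφ.continuous
  have iφ : Integrable fun z : Ed d => relKernel d α 1 ε x z * φ (s + ε, z) :=
    ki.mul_bdd (c := M) (by fun_prop : Continuous fun z : Ed d => φ (s + ε, z)).aestronglyMeasurable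
      (Eventually.of_forall fun z => hM _)
  have g3 : ∫ y : Ed d, relKernel d α 1 ε x y * Real.exp (-‖y - x‖ ^ 2) ≤
      ∫ y : Ed d, relKernel d α 1 ε x y := by
    refine integral_mono g1 ki fun y => ?_
    have : Real.exp (-‖y - x‖ ^ 2) ≤ 1 := by
      rw [Real.exp_le_one_iff]; have := sq_nonneg ‖y - x‖; linarith
    exact mul_le_of_le_one_right (kn y) this
  set m := ∫ y : Ed d, relKernel d α 1 ε x y with hm
  set g := ∫ y : Ed d, relKernel d α 1 ε x y * Real.exp (-‖y - x‖ ^ 2) with hg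
  have d1 : |(∫ z : Ed d, relKernel d α 1 ε x z * φ (s + ε, z)) - m * φ (s, x)| ≤
      (L * ε + η / 2 + C) * m - C * g := by
    rw [hm, hg, ← integral_mul_const, ← integral_sub iφ (ki.mul_const _), ← Real.norm_eq_abs,
      ← integral_const_mul, ← integral_const_mul, ← integral_sub (ki.const_mul _) (g1.const_mul _)]
    refine norm_integral_le_of_norm_le ((ki.const_mul _).sub (g1.const_mul _))
      (Eventually.of_forall fun z => ?_)
    have q1 := hLip (s + ε, z) (s, z)
    have hn : ‖((s + ε, z) : ℝ × Ed d) - (s, z)‖ = ε := by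
      simp [Prod.norm_def, abs_of_pos hε0', hε0'.le]
    rw [hn] at q1
    have q2 := hC z
    have q3 : |φ (s + ε, z) - φ (s, x)| ≤
        L * ε + (η / 2 + C * (1 - Real.exp (-‖z - x‖ ^ 2))) :=
      (abs_sub_le _ (φ (s, z)) _).trans (add_le_add q1 q2)
    rw [← mul_sub, Real.norm_eq_abs, abs_mul, abs_of_nonneg (kn z)]
    calc _ ≤ relKernel d α 1 ε x z * (L * ε + (η / 2 + C * (1 - Real.exp (-‖z - x‖ ^ 2)))) :=
          mul_le_mul_of_nonneg_left q3 (kn z)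
      _ = _ := by ring
  have d2 : |m * φ (s, x) - φ (s, x)| ≤ M * (1 - m) := by
    have : m * φ (s, x) - φ (s, x) = -((1 - m) * φ (s, x)) := by ring
    rw [this, abs_neg, abs_mul, abs_of_nonneg (by linarith), mul_comm]
    exact mul_le_mul_of_nonneg_right (hM _) (by linarith)
  rw [Real.dist_eq]
  have d3 := (abs_sub_le (∫ z : Ed d, relKernel d α 1 ε x z * φ (s + ε, z)) (m * φ (s, x))
    (φ (s, x))).trans (add_le_add d1 d2)
  refine d3.trans_lt ?_
  have e1 : (L * ε + η / 2 + C) * m ≤ (L * ε + η / 2 + C) * 1 := by gcongr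
  have e2 : C * (Real.exp (-ε) - c * ε) ≤ C * g := by gcongr
  have e3 : M * (1 - m) ≤ M * (1 - (Real.exp (-ε) - c * ε)) := by gcongr; linarith
  nlinarith

def Dop (d : ℕ) (α : ℝ) (φ : ℝ × Ed d → ℝ) (q : ℝ × Ed d) : ℝ :=
  dphi φ q - Lop d α φ q.1 q.2

lemma Dop_meas {d : ℕ} (α : ℝ) {φ : ℝ × Ed d → ℝ} (hφ : ContDiff ℝ (⊤ : ℕ∞) φ) :
    Measurable (Dop d α φ) := by
  exact (dphi_cont hφ).measurable.sub (Lop_meas α hφ.continuous)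

lemma Dop_bdd {d : ℕ} (hd : 0 < d) {α : ℝ} (h0 : 0 < α) (h2 : α < 2)
    {φ : ℝ × Ed d → ℝ} (hφ : ContDiff ℝ (⊤ : ℕ∞) φ) (hφc : HasCompactSupport φ) :
    ∃ C R : ℝ, 0 ≤ C ∧ 0 < R ∧ (∀ q, |Dop d α φ q| ≤ C) ∧ (∀ q, R < |q.1| → Dop d α φ q = 0) ∧
      (∀ q, R < |q.1| → φ q = 0) ∧ (∀ q, R < ‖q.2‖ → φ q = 0) ∧ (∀ q, |φ q| ≤ C) := by
  obtain ⟨C1, hC1, hC1'⟩ := Lop_bdd hd h0 h2 hφ hφc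
  obtain ⟨C2, hC2⟩ := (dphi_supp hφ hφc).exists_bound_of_continuous (dphi_cont hφ)
  obtain ⟨C3, hC3⟩ := hφc.exists_bound_of_continuous hφ.continuous
  obtain ⟨R1, hR1, hR1'⟩ := phi_supp hφc
  obtain ⟨R2, hR2, hR2'⟩ := phi_supp (dphi_supp hφ hφc)
  have hC20 : 0 ≤ C2 := (norm_nonneg _).trans (hC2 (0, 0))
  have hC30 : 0 ≤ C3 := (norm_nonneg _).trans (hC3 (0, 0))
  refine ⟨C1 + C2 + C3, R1 + R2, by positivity, by positivity, fun q => ?_, fun q hq => ?_,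
    fun q hq => ?_, fun q hq => ?_, fun q => ?_⟩
  · unfold Dop
    have a1 := hC2 q
    have a2 := hC1' q.1 q.2
    rw [Real.norm_eq_abs] at a1
    have := abs_sub (dphi φ q) (Lop d α φ q.1 q.2)
    linarith
  · unfold Dop
    rw [Lop_zero α hR1' (by linarith)]
    have : dphi φ q = 0 := by
      by_contra h; have := (hR2' q.1 q.2 h).1; linarith
    rw [this, sub_zero]
  · by_contra h; have := (hR1' q.1 q.2 h).1; linarith
  · by_contra h; have := (hR1' q.1 q.2 h).2; linarith
  · have := hC3 q
    rw [Real.norm_eq_abs] at this; linarith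

lemma free_weak {d : ℕ} (hd : 0 < d) {α : ℝ} (h0 : 0 < α) (h2 : α < 2)
    {φ : ℝ × Ed d → ℝ} (hφ : ContDiff ℝ (⊤ : ℕ∞) φ)
    (hφc : HasCompactSupport φ) (s : ℝ) (x : Ed d) :
    Integrable (fun q : ℝ × Ed d => relKernel d α 1 q.1 x q.2 * Dop d α φ (s + q.1, q.2))
      ((volume.restrict (Ioi 0)).prod (volume : Measure (Ed d))) ∧
    ∫ q : ℝ × Ed d, relKernel d α 1 q.1 x q.2 * Dop d α φ (s + q.1, q.2)
      ∂((volume.restrict (Ioi 0)).prod (volume : Measure (Ed d))) = -φ (s, x) := by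
  obtain ⟨C, R, hC0, hR0, hC, hR, -, -⟩ := Dop_bdd hd h0 h2 hφ hφc
  have mk : Measurable fun q : ℝ × Ed d => relKernel d α 1 q.1 x q.2 :=
    relKernel_meas_comp α measurable_fst measurable_const measurable_snd
  have msh : Measurable fun q : ℝ × Ed d => ((s + q.1, q.2) : ℝ × Ed d) := by fun_prop
  have mD : Measurable fun q : ℝ × Ed d => Dop d α φ (s + q.1, q.2) := (Dop_meas α hφ).comp msh
  have mm : Measurable fun q : ℝ × Ed d => relKernel d α 1 q.1 x q.2 * Dop d α φ (s + q.1, q.2) :=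
    mk.mul mD
  have hintg : Integrable (fun q : ℝ × Ed d => relKernel d α 1 q.1 x q.2 * Dop d α φ (s + q.1, q.2))
      ((volume.restrict (Ioi 0)).prod (volume : Measure (Ed d))) := by
    refine ⟨mm.aestronglyMeasurable, ?_⟩
    rw [hasFiniteIntegral_iff_norm, lintegral_prod _ mm.norm.ennreal_ofReal.aemeasurable]
    calc _ ≤ ∫⁻ t in Ioi (0 : ℝ), (Icc (-s - R) (-s + R)).indicator (fun _ => ENNReal.ofReal C) t := by
          refine setLIntegral_mono' measurableSet_Ioi fun t ht => ?_
          by_cases htR : |s + t| ≤ R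
          · have ht2 : t ∈ Icc (-s - R) (-s + R) := by
              rw [abs_le] at htR; constructor <;> linarith [htR.1, htR.2]
            rw [indicator_of_mem ht2]
            calc _ ≤ ∫⁻ z : Ed d, ENNReal.ofReal C * ENNReal.ofReal (relKernel d α 1 t x z) := by
                  refine lintegral_mono fun z => ?_
                  have kn := relKernel_nonneg h0 h2 ht x z
                  simp only [norm_mul, Real.norm_eq_abs, abs_of_nonneg kn]
                  rw [← ENNReal.ofReal_mul hC0, mul_comm]
                  exact ENNReal.ofReal_le_ofReal (mul_le_mul_of_nonneg_right (hC _) kn)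
              _ ≤ ENNReal.ofReal C * 1 := by
                  rw [lintegral_const_mul _ (relKernel_meas_right α t x).ennreal_ofReal]
                  exact mul_le_mul_right (kernel_mass h0 h2 ht x) _
              _ = _ := mul_one _
          · have : ∀ z : Ed d, Dop d α φ (s + t, z) = 0 := fun z => hR _ (not_le.1 htR)
            simp [this]
      _ ≤ ∫⁻ t, (Icc (-s - R) (-s + R)).indicator (fun _ => ENNReal.ofReal C) t :=
          lintegral_mono' Measure.restrict_le_self le_rfl
      _ < ⊤ := by
          rw [lintegral_indicator measurableSet_Icc]
          simp only [lintegral_const, Measure.restrict_apply_univ]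
          exact ENNReal.mul_lt_top ENNReal.ofReal_lt_top measure_Icc_lt_top
  refine ⟨hintg, ?_⟩
  set ρ := ((volume.restrict (Ioi (0 : ℝ))).prod (volume : Measure (Ed d))) with hρ
  have hms : ∀ ε : ℝ, MeasurableSet (Ioi ε ×ˢ (univ : Set (Ed d))) := fun ε =>
    measurableSet_Ioi.prod MeasurableSet.univ
  have hae : ∀ᵐ q ∂ρ, 0 < q.1 := by
    have : ∀ᵐ t ∂(volume.restrict (Ioi (0 : ℝ))), 0 < t := ae_restrict_mem measurableSet_Ioi
    exact (Measure.quasiMeasurePreserving_fst (μ := volume.restrict (Ioi (0 : ℝ)))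
      (ν := (volume : Measure (Ed d)))).ae this
  have hlim : Tendsto (fun ε : ℝ => ∫ q, (Ioi ε ×ˢ (univ : Set (Ed d))).indicator
      (fun q : ℝ × Ed d => relKernel d α 1 q.1 x q.2 * Dop d α φ (s + q.1, q.2)) q ∂ρ)
      (nhdsWithin 0 (Ioi 0))
      (nhds (∫ q : ℝ × Ed d, relKernel d α 1 q.1 x q.2 * Dop d α φ (s + q.1, q.2) ∂ρ)) := by
    refine tendsto_integral_filter_of_dominated_convergence
      (fun q => ‖relKernel d α 1 q.1 x q.2 * Dop d α φ (s + q.1, q.2)‖) ?_ ?_ hintg.norm ?_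
    · exact Eventually.of_forall fun ε => (hintg.indicator (hms ε)).aestronglyMeasurable
    · exact Eventually.of_forall fun ε => Eventually.of_forall fun w => norm_indicator_le_norm_self _ _
    · filter_upwards [hae] with q hq
      refine tendsto_const_nhds.congr' ?_
      have : ∀ᶠ ε : ℝ in nhdsWithin 0 (Ioi 0), ε < q.1 :=
        mem_nhdsWithin_of_mem_nhds (Iio_mem_nhds hq)
      filter_upwards [this] with ε hε
      rw [indicator_of_mem]
      exact ⟨hε, mem_univ _⟩
  refine tendsto_nhds_unique hlim ?_
  refine (approx_id h0 h2 hφ hφc s x).neg.congr' ?_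
  filter_upwards [self_mem_nhdsWithin] with ε hε
  have hε' : 0 < ε := hε
  rw [← free_eps hd h0 h2 hφ hφc s x hε', integral_indicator (hms ε)]
  have hr : ρ.restrict (Ioi ε ×ˢ univ) =
      (volume.restrict (Ioi ε)).prod (volume : Measure (Ed d)) := by
    conv_lhs => rw [hρ, ← Measure.prod_restrict, Measure.restrict_univ]
    rw [Measure.restrict_restrict measurableSet_Ioi, inter_eq_left.2 (Ioi_subset_Ioi hε'.le)]
  rw [hr]
  rfl


section Assembly

variable {d : ℕ} {α δ : ℝ}

/-- The reference measure on `(0,∞) × ℝ^d`. -/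
def rhoM (d : ℕ) : Measure (ℝ × Ed d) :=
  (volume.restrict (Ioi (0 : ℝ))).prod (volume : Measure (Ed d))

/-- The full perturbation series. -/
def SL (d : ℕ) (α δ : ℝ) (x : Ed d) (q : ℝ × Ed d) : ENNReal := ∑' n, RL d α δ x n q.1 q.2

lemma SL_meas (d : ℕ) (α δ : ℝ) (x : Ed d) : Measurable (SL d α δ x) :=
  Measurable.tsum fun n => RL_meas d α δ x n

lemma rhoM_pos (d : ℕ) : ∀ᵐ q ∂(rhoM d), 0 < q.1 := by
  have : ∀ᵐ t ∂(volume.restrict (Ioi (0 : ℝ))), 0 < t := ae_restrict_mem measurableSet_Ioi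
  exact (Measure.quasiMeasurePreserving_fst (μ := volume.restrict (Ioi (0 : ℝ)))
    (ν := (volume : Measure (Ed d)))).ae this

lemma lint_rho {f : ℝ × Ed d → ENNReal} (hf : Measurable f) :
    ∫⁻ q, f q ∂(rhoM d) = ∫⁻ t in Ioi (0 : ℝ), ∫⁻ z : Ed d, f (t, z) :=
  lintegral_prod _ hf.aemeasurable

lemma pert_ae_prod (hd : 0 < d) (h0 : 0 < α) (h2 : α < 2) (hδ0 : 0 < δ) (hδ : δ < d - α) {x : Ed d}
    (hx : x ≠ 0) : ∀ᵐ q ∂(rhoM d), SL d α δ x q ≠ ⊤ ∧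
      pert d (relKernel d α 1) (Vbeta d α δ) q.1 x q.2 = (SL d α δ x q).toReal := by
  have hs : MeasurableSet {q | SL d α δ x q ≠ ⊤} :=
    (SL_meas d α δ x) (measurableSet_singleton ⊤).compl
  have h1 : ∀ᵐ q ∂(rhoM d), q ∈ {q | SL d α δ x q ≠ ⊤} := by
    refine (Measure.ae_prod_mem_iff_ae_ae_mem hs).2 ?_
    filter_upwards [ae_restrict_mem measurableSet_Ioi] with t ht
    exact RL_finite hd h0 h2 hδ0 hδ hx ht
  filter_upwards [h1, rhoM_pos d] with q hq hq0
  refine ⟨hq, ?_⟩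
  have hq' : ∑' n, RL d α δ x n q.1 q.2 ≠ ⊤ := hq
  have hf := ENNReal.ne_top_of_tsum_ne_top hq'
  unfold SL
  rw [ENNReal.tsum_toReal_eq hf]
  unfold pert
  exact tsum_congr fun n => pertN_eq h0 h2 hδ x n q.1 hq0 q.2 (hf n)

/-- balance identity for the free kernel, written with positive and negative parts -/
lemma free_balance (hd : 0 < d) (h0 : 0 < α) (h2 : α < 2)
    {φ : ℝ × Ed d → ℝ} (hφ : ContDiff ℝ (⊤ : ℕ∞) φ) (hφc : HasCompactSupport φ)
    (s : ℝ) (x : Ed d) :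
    (∫⁻ τ in Ioi (0 : ℝ), ∫⁻ y : Ed d, kE d α τ x y * ENNReal.ofReal (Dop d α φ (s + τ, y))) +
      ENNReal.ofReal (φ (s, x)) =
    (∫⁻ τ in Ioi (0 : ℝ), ∫⁻ y : Ed d, kE d α τ x y * ENNReal.ofReal (-Dop d α φ (s + τ, y))) +
      ENNReal.ofReal (-φ (s, x)) := by
  obtain ⟨hi, he⟩ := free_weak hd h0 h2 hφ hφc s x
  have mk : Measurable fun q : ℝ × Ed d => kE d α q.1 x q.2 :=
    (relKernel_meas_comp α measurable_fst measurable_const measurable_snd).ennreal_ofReal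
  have msh : Measurable fun q : ℝ × Ed d => ((s + q.1, q.2) : ℝ × Ed d) := by fun_prop
  have mD : Measurable fun q : ℝ × Ed d => Dop d α φ (s + q.1, q.2) := (Dop_meas α hφ).comp msh
  have e1 : ∫⁻ q, ENNReal.ofReal (relKernel d α 1 q.1 x q.2 * Dop d α φ (s + q.1, q.2)) ∂(rhoM d) =
      ∫⁻ τ in Ioi (0 : ℝ), ∫⁻ y : Ed d, kE d α τ x y * ENNReal.ofReal (Dop d α φ (s + τ, y)) := by
    rw [← lint_rho (f := fun q => kE d α q.1 x q.2 * ENNReal.ofReal (Dop d α φ (s + q.1, q.2)))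
      (mk.mul mD.ennreal_ofReal)]
    refine lintegral_congr_ae ?_
    filter_upwards [rhoM_pos d] with q hq
    exact ENNReal.ofReal_mul (relKernel_nonneg h0 h2 hq _ _)
  have e2 : ∫⁻ q, ENNReal.ofReal (-(relKernel d α 1 q.1 x q.2 * Dop d α φ (s + q.1, q.2))) ∂(rhoM d) =
      ∫⁻ τ in Ioi (0 : ℝ), ∫⁻ y : Ed d, kE d α τ x y * ENNReal.ofReal (-Dop d α φ (s + τ, y)) := by
    rw [← lint_rho (f := fun q => kE d α q.1 x q.2 * ENNReal.ofReal (-Dop d α φ (s + q.1, q.2)))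
      (mk.mul mD.neg.ennreal_ofReal)]
    refine lintegral_congr_ae ?_
    filter_upwards [rhoM_pos d] with q hq
    rw [← mul_neg]
    exact ENNReal.ofReal_mul (relKernel_nonneg h0 h2 hq _ _)
  have hi' : Integrable (fun q : ℝ × Ed d => relKernel d α 1 q.1 x q.2 *
    Dop d α φ (s + q.1, q.2)) (rhoM d) := hi
  have he' : ∫ q : ℝ × Ed d, relKernel d α 1 q.1 x q.2 * Dop d α φ (s + q.1, q.2)
    ∂(rhoM d) = -φ (s, x) := he
  rw [integral_eq_lintegral_pos_part_sub_lintegral_neg_part hi', e1, e2] at he'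
  have f1 := hi'.lintegral_lt_top
  have f2 := hi'.neg.lintegral_lt_top
  simp only [Pi.neg_apply] at f2
  rw [e1] at f1
  rw [e2] at f2
  generalize (∫⁻ τ in Ioi (0 : ℝ), ∫⁻ y : Ed d, kE d α τ x y *
    ENNReal.ofReal (Dop d α φ (s + τ, y))) = A at *
  generalize (∫⁻ τ in Ioi (0 : ℝ), ∫⁻ y : Ed d, kE d α τ x y *
    ENNReal.ofReal (-Dop d α φ (s + τ, y))) = B at *
  rw [← ENNReal.toReal_eq_toReal_iff' (by simp [f1.ne]) (by simp [f2.ne]),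
    ENNReal.toReal_add f1.ne ENNReal.ofReal_ne_top, ENNReal.toReal_add f2.ne ENNReal.ofReal_ne_top,
    ENNReal.toReal_ofReal', ENNReal.toReal_ofReal']
  rcases le_total 0 (φ (s, x)) with h | h
  · rw [max_eq_left h, max_eq_right (by linarith)]; linarith
  · rw [max_eq_right h, max_eq_left (by linarith)]; linarith

lemma balance_succ (hd : 0 < d) (h0 : 0 < α) (h2 : α < 2)
    {φ : ℝ × Ed d → ℝ} (hφ : ContDiff ℝ (⊤ : ℕ∞) φ) (hφc : HasCompactSupport φ)
    (s : ℝ) (x : Ed d) (n : ℕ) :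
    (∫⁻ q, RL d α δ x (n + 1) q.1 q.2 * ENNReal.ofReal (Dop d α φ (s + q.1, q.2)) ∂(rhoM d)) +
      (∫⁻ q, RL d α δ x n q.1 q.2 * (VE d α δ q.2 * ENNReal.ofReal (φ (s + q.1, q.2))) ∂(rhoM d)) =
    (∫⁻ q, RL d α δ x (n + 1) q.1 q.2 * ENNReal.ofReal (-Dop d α φ (s + q.1, q.2)) ∂(rhoM d)) +
      ∫⁻ q, RL d α δ x n q.1 q.2 * (VE d α δ q.2 * ENNReal.ofReal (-φ (s + q.1, q.2))) ∂(rhoM d) := by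
  have msh : Measurable fun q : ℝ × Ed d => ((s + q.1, q.2) : ℝ × Ed d) := by fun_prop
  have mD : Measurable fun q : ℝ × Ed d => Dop d α φ (s + q.1, q.2) := (Dop_meas α hφ).comp msh
  have mφ : Measurable fun q : ℝ × Ed d => φ (s + q.1, q.2) := hφ.continuous.measurable.comp msh
  have mV : Measurable fun q : ℝ × Ed d => VE d α δ q.2 := (VE_meas d α δ).comp measurable_snd
  have mR := RL_meas d α δ x n
  have gen : ∀ (D : ℝ × Ed d → ENNReal) (f : ℝ × Ed d → ENNReal), Measurable D →
      Measurable (fun q : ℝ × Ed d => f (s + q.1, q.2)) →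
      (∫⁻ q, RL d α δ x (n + 1) q.1 q.2 * D (s + q.1, q.2) ∂(rhoM d)) +
      (∫⁻ q, RL d α δ x n q.1 q.2 * (VE d α δ q.2 * f (s + q.1, q.2)) ∂(rhoM d)) =
      ∫⁻ t in Ioi (0 : ℝ), ∫⁻ z : Ed d, RL d α δ x n t z * VE d α δ z *
        ((∫⁻ τ in Ioi (0 : ℝ), ∫⁻ y : Ed d, kE d α τ z y * D (s + t + τ, y)) + f (s + t, z)) := by
    intro D f hD hf
    have hD' : Measurable fun q : ℝ × Ed d => D (s + q.1, q.2) := hD.comp msh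
    have m1 : Measurable fun q : ℝ × Ed d => RL d α δ x (n + 1) q.1 q.2 * D (s + q.1, q.2) :=
      (RL_meas d α δ x (n + 1)).mul hD'
    have m2 : Measurable fun q : ℝ × Ed d => RL d α δ x n q.1 q.2 *
      (VE d α δ q.2 * f (s + q.1, q.2)) := mR.mul (mV.mul hf)
    rw [lint_rho m1, lint_rho m2]
    have hT := RR_T1 (μ := (volume : Measure (Ed d))) (x := x) (kE_meas d α) (VE_meas d α δ) n
      (g := fun t y => D (s + t, y)) hD'
    have hT' : ∫⁻ t in Ioi (0 : ℝ), ∫⁻ z : Ed d, RL d α δ x (n + 1) t z * D (s + t, z) =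
      ∫⁻ t in Ioi (0 : ℝ), ∫⁻ z : Ed d, RL d α δ x n t z * VE d α δ z *
        (∫⁻ τ in Ioi (0 : ℝ), ∫⁻ y : Ed d, kE d α τ z y * D (s + (t + τ), y)) := hT
    rw [hT']
    have m3 : Measurable fun t => ∫⁻ z : Ed d, RL d α δ x n t z * (VE d α δ z * f (s + t, z)) :=
      m2.lintegral_prod_right'
    rw [← lintegral_add_right _ m3]
    refine lintegral_congr fun t => ?_
    have m4 : Measurable fun z => RL d α δ x n t z * (VE d α δ z * f (s + t, z)) :=
      m2.comp measurable_prodMk_left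
    rw [← lintegral_add_right _ m4]
    refine lintegral_congr fun z => ?_
    rw [mul_add, mul_assoc _ _ (f (s + t, z))]
    simp only [add_assoc]
  have g1 := gen (fun q => ENNReal.ofReal (Dop d α φ q)) (fun q => ENNReal.ofReal (φ q))
    (Dop_meas α hφ).ennreal_ofReal mφ.ennreal_ofReal
  have g2 := gen (fun q => ENNReal.ofReal (-Dop d α φ q)) (fun q => ENNReal.ofReal (-φ q))
    (Dop_meas α hφ).neg.ennreal_ofReal mφ.neg.ennreal_ofReal
  rw [g1, g2]
  refine lintegral_congr fun t => lintegral_congr fun z => ?_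
  rw [free_balance hd h0 h2 hφ hφc (s + t) z]

lemma balance_zero (hd : 0 < d) (h0 : 0 < α) (h2 : α < 2)
    {φ : ℝ × Ed d → ℝ} (hφ : ContDiff ℝ (⊤ : ℕ∞) φ) (hφc : HasCompactSupport φ)
    (s : ℝ) (x : Ed d) :
    (∫⁻ q, RL d α δ x 0 q.1 q.2 * ENNReal.ofReal (Dop d α φ (s + q.1, q.2)) ∂(rhoM d)) +
      ENNReal.ofReal (φ (s, x)) =
    (∫⁻ q, RL d α δ x 0 q.1 q.2 * ENNReal.ofReal (-Dop d α φ (s + q.1, q.2)) ∂(rhoM d)) +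
      ENNReal.ofReal (-φ (s, x)) := by
  have msh : Measurable fun q : ℝ × Ed d => ((s + q.1, q.2) : ℝ × Ed d) := by fun_prop
  have mD : Measurable fun q : ℝ × Ed d => Dop d α φ (s + q.1, q.2) := (Dop_meas α hφ).comp msh
  have m1 : Measurable fun q : ℝ × Ed d => RL d α δ x 0 q.1 q.2 *
    ENNReal.ofReal (Dop d α φ (s + q.1, q.2)) := (RL_meas d α δ x 0).mul mD.ennreal_ofReal
  have m2 : Measurable fun q : ℝ × Ed d => RL d α δ x 0 q.1 q.2 *
    ENNReal.ofReal (-Dop d α φ (s + q.1, q.2)) := (RL_meas d α δ x 0).mul mD.neg.ennreal_ofReal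
  rw [lint_rho m1, lint_rho m2]
  exact free_balance hd h0 h2 hφ hφc s x

lemma lint_SL (x : Ed d) {f : ℝ × Ed d → ENNReal} (hf : Measurable f) :
    ∫⁻ q, SL d α δ x q * f q ∂(rhoM d) = ∑' n, ∫⁻ q, RL d α δ x n q.1 q.2 * f q ∂(rhoM d) := by
  have ms : ∀ n, Measurable fun q : ℝ × Ed d => RL d α δ x n q.1 q.2 * f q := fun n =>
    (RL_meas d α δ x n).mul hf
  rw [← lintegral_tsum fun n => (ms n).aemeasurable]
  refine lintegral_congr fun q => ?_
  unfold SL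
  rw [ENNReal.tsum_mul_right]

lemma balance (hd : 0 < d) (h0 : 0 < α) (h2 : α < 2)
    {φ : ℝ × Ed d → ℝ} (hφ : ContDiff ℝ (⊤ : ℕ∞) φ) (hφc : HasCompactSupport φ)
    (s : ℝ) (x : Ed d) :
    (∫⁻ q, SL d α δ x q * ENNReal.ofReal (Dop d α φ (s + q.1, q.2)) ∂(rhoM d)) +
      (∫⁻ q, SL d α δ x q * (VE d α δ q.2 * ENNReal.ofReal (φ (s + q.1, q.2))) ∂(rhoM d)) +
      ENNReal.ofReal (φ (s, x)) =
    (∫⁻ q, SL d α δ x q * ENNReal.ofReal (-Dop d α φ (s + q.1, q.2)) ∂(rhoM d)) +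
      (∫⁻ q, SL d α δ x q * (VE d α δ q.2 * ENNReal.ofReal (-φ (s + q.1, q.2))) ∂(rhoM d)) +
      ENNReal.ofReal (-φ (s, x)) := by
  have msh : Measurable fun q : ℝ × Ed d => ((s + q.1, q.2) : ℝ × Ed d) := by fun_prop
  have mD : Measurable fun q : ℝ × Ed d => Dop d α φ (s + q.1, q.2) := (Dop_meas α hφ).comp msh
  have mφ : Measurable fun q : ℝ × Ed d => φ (s + q.1, q.2) := hφ.continuous.measurable.comp msh
  have mV : Measurable fun q : ℝ × Ed d => VE d α δ q.2 := (VE_meas d α δ).comp measurable_snd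
  rw [lint_SL x mD.ennreal_ofReal,
    lint_SL x (f := fun q => ENNReal.ofReal (-Dop d α φ (s + q.1, q.2))) mD.neg.ennreal_ofReal,
    lint_SL x (f := fun q => VE d α δ q.2 * ENNReal.ofReal (φ (s + q.1, q.2)))
      (mV.mul mφ.ennreal_ofReal),
    lint_SL x (f := fun q => VE d α δ q.2 * ENNReal.ofReal (-φ (s + q.1, q.2)))
      (mV.mul mφ.neg.ennreal_ofReal)]
  have key : ∀ (a b a' b' : ℕ → ENNReal) (c c' : ENNReal), a 0 + c = a' 0 + c' →
      (∀ n, a (n + 1) + b n = a' (n + 1) + b' n) →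
      (∑' n, a n) + (∑' n, b n) + c = (∑' n, a' n) + (∑' n, b' n) + c' := by
    intro a b a' b' c c' hz hs
    rw [tsum_eq_zero_add' (f := a) ENNReal.summable, tsum_eq_zero_add' (f := a') ENNReal.summable]
    have : ∑' n, a (n + 1) + ∑' n, b n = ∑' n, a' (n + 1) + ∑' n, b' n := by
      rw [← ENNReal.tsum_add, ← ENNReal.tsum_add]
      exact tsum_congr hs
    calc _ = (a 0 + c) + (∑' n, a (n + 1) + ∑' n, b n) := by ring
      _ = (a' 0 + c') + (∑' n, a' (n + 1) + ∑' n, b' n) := by rw [hz, this]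
      _ = _ := by ring
  exact key _ _ _ _ _ _ (balance_zero hd h0 h2 hφ hφc s x)
    (fun n => balance_succ hd h0 h2 hφ hφc s x n)

end Assembly


section Final

variable {d : ℕ} {α δ : ℝ}

lemma SL_integrable (hd : 0 < d) (h0 : 0 < α) (h2 : α < 2) (hδ0 : 0 < δ) (hδ : δ < d - α) {x : Ed d}
    (hx : x ≠ 0) {G : ℝ × Ed d → ℝ} (hG : Measurable G)
    (hfin : ∫⁻ q, SL d α δ x q * ENNReal.ofReal |G q| ∂(rhoM d) < ⊤) :
    Integrable (fun q => (SL d α δ x q).toReal * G q) (rhoM d) ∧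
    ∫ q, (SL d α δ x q).toReal * G q ∂(rhoM d) =
      (∫⁻ q, SL d α δ x q * ENNReal.ofReal (G q) ∂(rhoM d)).toReal -
      (∫⁻ q, SL d α δ x q * ENNReal.ofReal (-G q) ∂(rhoM d)).toReal := by
  have hae := pert_ae_prod hd h0 h2 hδ0 hδ hx
  have hm : Measurable fun q => (SL d α δ x q).toReal * G q := (SL_meas d α δ x).ennreal_toReal.mul hG
  have gen : ∀ f : ℝ × Ed d → ℝ, ∫⁻ q, ENNReal.ofReal ((SL d α δ x q).toReal * f q) ∂(rhoM d) =
      ∫⁻ q, SL d α δ x q * ENNReal.ofReal (f q) ∂(rhoM d) := by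
    intro f
    refine lintegral_congr_ae ?_
    filter_upwards [hae] with q hq
    rw [ENNReal.ofReal_mul ENNReal.toReal_nonneg, ENNReal.ofReal_toReal hq.1]
  have hi : Integrable (fun q => (SL d α δ x q).toReal * G q) (rhoM d) := by
    refine ⟨hm.aestronglyMeasurable, ?_⟩
    rw [hasFiniteIntegral_iff_norm]
    refine lt_of_le_of_lt (le_of_eq ?_) hfin
    rw [← gen]
    refine lintegral_congr fun q => ?_
    rw [norm_mul, Real.norm_eq_abs, Real.norm_eq_abs, abs_of_nonneg ENNReal.toReal_nonneg]
  refine ⟨hi, ?_⟩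
  rw [integral_eq_lintegral_pos_part_sub_lintegral_neg_part hi, gen]
  have := gen (fun q => -G q)
  simp only [mul_neg] at this
  rw [this]

lemma fin_D (hd : 0 < d) (h0 : 0 < α) (h2 : α < 2) (hδ0 : 0 < δ) (hδ : δ < d - α) {x : Ed d}
    (hx : x ≠ 0) {φ : ℝ × Ed d → ℝ} (hφ : ContDiff ℝ (⊤ : ℕ∞) φ) (hφc : HasCompactSupport φ)
    (s : ℝ) :
    ∫⁻ q, SL d α δ x q * ENNReal.ofReal |Dop d α φ (s + q.1, q.2)| ∂(rhoM d) < ⊤ := by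
  obtain ⟨C, R, hC0, hR0, hC, hR, -, -⟩ := Dop_bdd hd h0 h2 hφ hφc
  have msh : Measurable fun q : ℝ × Ed d => ((s + q.1, q.2) : ℝ × Ed d) := by fun_prop
  have mD : Measurable fun q : ℝ × Ed d => Dop d α φ (s + q.1, q.2) := (Dop_meas α hφ).comp msh
  set T : ℝ := max (R - s) 0 + 1 with hT
  have hT0 : 0 < T := by positivity
  obtain ⟨M, hM0, hM⟩ := RL_F3 hd h0 h2 hδ0 hδ hx hT0
  have mm : Measurable fun q : ℝ × Ed d => SL d α δ x q * ENNReal.ofReal |Dop d α φ (s + q.1, q.2)| :=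
    (SL_meas d α δ x).mul mD.norm.ennreal_ofReal
  rw [lint_rho mm]
  calc _ ≤ ∫⁻ t in Ioi (0 : ℝ), (Ioo 0 T).indicator
        (fun _ => ENNReal.ofReal C * ENNReal.ofReal M) t := by
        refine setLIntegral_mono' measurableSet_Ioi fun t ht => ?_
        by_cases htR : |s + t| ≤ R
        · have ht2 : t ∈ Ioo 0 T := by
            refine ⟨ht, ?_⟩
            have := le_max_left (R - s) 0
            rw [abs_le] at htR; linarith [htR.2]
          rw [indicator_of_mem ht2]
          have mS : Measurable fun z : Ed d => SL d α δ x (t, z) :=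
            (SL_meas d α δ x).comp measurable_prodMk_left
          calc _ ≤ ∫⁻ z : Ed d, ENNReal.ofReal C * SL d α δ x (t, z) := by
                refine lintegral_mono fun z => ?_
                rw [mul_comm]
                exact mul_le_mul_left (ENNReal.ofReal_le_ofReal (hC _)) _
            _ = ENNReal.ofReal C * ∑' n, ∫⁻ z : Ed d, RL d α δ x n t z := by
                rw [lintegral_const_mul _ mS]
                have mR : ∀ n, Measurable fun z : Ed d => RL d α δ x n t z := fun n =>
                  (RL_meas d α δ x n).comp measurable_prodMk_left
                rw [← lintegral_tsum fun n => (mR n).aemeasurable]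
                rfl
            _ ≤ _ := mul_le_mul_right (hM t ht2) _
        · have : ∀ z : Ed d, Dop d α φ (s + t, z) = 0 := fun z => hR _ (not_le.1 htR)
          simp [this]
    _ ≤ ∫⁻ t, (Ioo 0 T).indicator (fun _ => ENNReal.ofReal C * ENNReal.ofReal M) t :=
        lintegral_mono' Measure.restrict_le_self le_rfl
    _ < ⊤ := by
        rw [lintegral_indicator measurableSet_Ioo]
        simp only [lintegral_const, Measure.restrict_apply_univ]
        exact ENNReal.mul_lt_top (ENNReal.mul_lt_top ENNReal.ofReal_lt_top ENNReal.ofReal_lt_top)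
          measure_Ioo_lt_top

lemma fin_V (hd : 0 < d) (h0 : 0 < α) (h2 : α < 2) (hδ0 : 0 < δ) (hδ : δ < d - α) {x : Ed d}
    (hx : x ≠ 0) {φ : ℝ × Ed d → ℝ} (hφ : ContDiff ℝ (⊤ : ℕ∞) φ) (hφc : HasCompactSupport φ)
    (s : ℝ) :
    ∫⁻ q, SL d α δ x q * (VE d α δ q.2 * ENNReal.ofReal |φ (s + q.1, q.2)|) ∂(rhoM d) < ⊤ := by
  obtain ⟨C, R, hC0, hR0, -, -, hR1, hR2, hC⟩ := Dop_bdd hd h0 h2 hφ hφc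
  have msh : Measurable fun q : ℝ × Ed d => ((s + q.1, q.2) : ℝ × Ed d) := by fun_prop
  have mφ : Measurable fun q : ℝ × Ed d => φ (s + q.1, q.2) := hφ.continuous.measurable.comp msh
  have mV : Measurable fun q : ℝ × Ed d => VE d α δ q.2 := (VE_meas d α δ).comp measurable_snd
  have mVφ : Measurable fun q : ℝ × Ed d => VE d α δ q.2 * ENNReal.ofReal |φ (s + q.1, q.2)| :=
    mV.mul mφ.norm.ennreal_ofReal
  set T : ℝ := max (R - s) 0 + 1 with hT
  have hT0 : 0 < T := by positivity
  have hF2 := RL_F2 hd h0 h2 hδ0 hδ hx hT0 R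
  rw [lint_SL x mVφ]
  let B : Ed d → ENNReal := (Metric.closedBall (0 : Ed d) R).indicator (fun _ => 1)
  have hBm : Measurable B := measurable_const.indicator Metric.isClosed_closedBall.measurableSet
  have key : ∀ n, ∫⁻ q, RL d α δ x n q.1 q.2 * (VE d α δ q.2 *
      ENNReal.ofReal |φ (s + q.1, q.2)|) ∂(rhoM d) ≤ ENNReal.ofReal C *
      ∫⁻ t in Ioo 0 T, ∫⁻ z, RL d α δ x n t z * VE d α δ z * B z := by
    intro n
    have mm : Measurable fun q : ℝ × Ed d => RL d α δ x n q.1 q.2 * (VE d α δ q.2 *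
      ENNReal.ofReal |φ (s + q.1, q.2)|) := (RL_meas d α δ x n).mul mVφ
    have m2 : Measurable fun q : ℝ × Ed d => RL d α δ x n q.1 q.2 * VE d α δ q.2 * B q.2 :=
      ((RL_meas d α δ x n).mul mV).mul (hBm.comp measurable_snd)
    have m3 : Measurable fun t : ℝ => ∫⁻ z, RL d α δ x n t z * VE d α δ z * B z :=
      m2.lintegral_prod_right'
    rw [lint_rho mm, ← lintegral_const_mul _ m3]
    calc _ ≤ ∫⁻ t in Ioi (0 : ℝ), (Ioo 0 T).indicator (fun t => ENNReal.ofReal C *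
          ∫⁻ z, RL d α δ x n t z * VE d α δ z * B z) t := by
          refine setLIntegral_mono' measurableSet_Ioi fun t ht => ?_
          by_cases htR : |s + t| ≤ R
          · have ht2 : t ∈ Ioo 0 T := by
              refine ⟨ht, ?_⟩
              have := le_max_left (R - s) 0
              rw [abs_le] at htR; linarith [htR.2]
            rw [indicator_of_mem ht2]
            have m4 : Measurable fun z : Ed d => RL d α δ x n t z * VE d α δ z * B z :=
              m2.comp measurable_prodMk_left
            rw [← lintegral_const_mul _ m4]
            refine lintegral_mono fun z => ?_
            by_cases hz : ‖z‖ ≤ R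
            · have hB1 : B z = 1 := by
                simp only [B]; rw [indicator_of_mem]; simpa using hz
              rw [hB1, mul_one, ← mul_assoc, mul_comm]
              exact mul_le_mul_left (ENNReal.ofReal_le_ofReal (hC _)) _
            · have : φ (s + t, z) = 0 := hR2 _ (not_le.1 hz)
              simp [this]
          · have : ∀ z : Ed d, φ (s + t, z) = 0 := fun z => hR1 _ (not_le.1 htR)
            simp [this]
      _ = _ := by
          rw [lintegral_indicator measurableSet_Ioo, Measure.restrict_restrict measurableSet_Ioo,
            inter_eq_left.2 Ioo_subset_Ioi_self]
  refine lt_of_le_of_lt (ENNReal.tsum_le_tsum key) ?_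
  rw [ENNReal.tsum_mul_left]
  exact ENNReal.mul_lt_top ENNReal.ofReal_lt_top (lt_top_iff_ne_top.2 hF2)

lemma final_rho (hd : 0 < d) (h0 : 0 < α) (h2 : α < 2) (hδ0 : 0 < δ) (hδ : δ < d - α) {x : Ed d}
    (hx : x ≠ 0) {φ : ℝ × Ed d → ℝ} (hφ : ContDiff ℝ (⊤ : ℕ∞) φ) (hφc : HasCompactSupport φ)
    (s : ℝ) :
    Integrable (fun q : ℝ × Ed d => pert d (relKernel d α 1) (Vbeta d α δ) q.1 x q.2 *
      (Dop d α φ (s + q.1, q.2) + Vbeta d α δ q.2 * φ (s + q.1, q.2))) (rhoM d) ∧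
    ∫ q : ℝ × Ed d, pert d (relKernel d α 1) (Vbeta d α δ) q.1 x q.2 *
      (Dop d α φ (s + q.1, q.2) + Vbeta d α δ q.2 * φ (s + q.1, q.2)) ∂(rhoM d) = -φ (s, x) := by
  have msh : Measurable fun q : ℝ × Ed d => ((s + q.1, q.2) : ℝ × Ed d) := by fun_prop
  have mD : Measurable fun q : ℝ × Ed d => Dop d α φ (s + q.1, q.2) := (Dop_meas α hφ).comp msh
  have mφ : Measurable fun q : ℝ × Ed d => φ (s + q.1, q.2) := hφ.continuous.measurable.comp msh
  have mV : Measurable fun q : ℝ × Ed d => Vbeta d α δ q.2 := (Vbeta_meas d α δ).comp measurable_snd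
  have mVφ : Measurable fun q : ℝ × Ed d => Vbeta d α δ q.2 * φ (s + q.1, q.2) := mV.mul mφ
  have fD := fin_D hd h0 h2 hδ0 hδ hx hφ hφc s
  have fV := fin_V hd h0 h2 hδ0 hδ hx hφ hφc s
  have hV0 := fun z => Vbeta_nonneg (d := d) h0 hδ z
  have eV : ∀ f : ℝ × Ed d → ℝ, ∀ q : ℝ × Ed d, VE d α δ q.2 * ENNReal.ofReal (f q) =
      ENNReal.ofReal (Vbeta d α δ q.2 * f q) := fun f q => (ENNReal.ofReal_mul (hV0 q.2)).symm
  have fV' : ∫⁻ q, SL d α δ x q * ENNReal.ofReal |Vbeta d α δ q.2 * φ (s + q.1, q.2)| ∂(rhoM d)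
      < ⊤ := by
    refine lt_of_le_of_lt (le_of_eq ?_) fV
    refine lintegral_congr fun q => ?_
    rw [abs_mul, abs_of_nonneg (hV0 q.2), ENNReal.ofReal_mul (hV0 q.2)]
    rfl
  obtain ⟨iD, vD⟩ := SL_integrable hd h0 h2 hδ0 hδ hx mD fD
  obtain ⟨iV, vV⟩ := SL_integrable hd h0 h2 hδ0 hδ hx mVφ fV'
  have hbal := balance (δ := δ) hd h0 h2 hφ hφc s x
  have e1 : ∫⁻ q, SL d α δ x q * (VE d α δ q.2 * ENNReal.ofReal (φ (s + q.1, q.2))) ∂(rhoM d) =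
      ∫⁻ q, SL d α δ x q * ENNReal.ofReal (Vbeta d α δ q.2 * φ (s + q.1, q.2)) ∂(rhoM d) :=
    lintegral_congr fun q => by rw [eV (fun q => φ (s + q.1, q.2))]
  have e2 : ∫⁻ q, SL d α δ x q * (VE d α δ q.2 * ENNReal.ofReal (-φ (s + q.1, q.2))) ∂(rhoM d) =
      ∫⁻ q, SL d α δ x q * ENNReal.ofReal (-(Vbeta d α δ q.2 * φ (s + q.1, q.2))) ∂(rhoM d) :=
    lintegral_congr fun q => by rw [eV (fun q => -φ (s + q.1, q.2)), mul_neg]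
  rw [e1, e2] at hbal
  have fin : ∀ G H : ℝ × Ed d → ℝ, (∀ q, H q ≤ |G q|) →
      ∫⁻ q, SL d α δ x q * ENNReal.ofReal |G q| ∂(rhoM d) < ⊤ →
      ∫⁻ q, SL d α δ x q * ENNReal.ofReal (H q) ∂(rhoM d) ≠ ⊤ := by
    intro G H hGH hG
    refine (lt_of_le_of_lt (lintegral_mono fun q => ?_) hG).ne
    exact mul_le_mul_right (ENNReal.ofReal_le_ofReal (hGH q)) _
  have q1 := fin _ (fun q => Dop d α φ (s + q.1, q.2)) (fun q => le_abs_self _) fD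
  have q2 := fin _ (fun q => -Dop d α φ (s + q.1, q.2)) (fun q => neg_le_abs _) fD
  have q3 := fin _ (fun q => Vbeta d α δ q.2 * φ (s + q.1, q.2)) (fun q => le_abs_self _) fV'
  have q4 := fin _ (fun q => -(Vbeta d α δ q.2 * φ (s + q.1, q.2))) (fun q => neg_le_abs _) fV'
  have hsum : ∫ q, ((SL d α δ x q).toReal * Dop d α φ (s + q.1, q.2) +
      (SL d α δ x q).toReal * (Vbeta d α δ q.2 * φ (s + q.1, q.2))) ∂(rhoM d) = -φ (s, x) := by
    rw [integral_add iD iV, vD, vV]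
    generalize (∫⁻ q, SL d α δ x q * ENNReal.ofReal (Dop d α φ (s + q.1, q.2)) ∂(rhoM d)) = A at *
    generalize (∫⁻ q, SL d α δ x q * ENNReal.ofReal (-Dop d α φ (s + q.1, q.2)) ∂(rhoM d)) = A' at *
    generalize (∫⁻ q, SL d α δ x q * ENNReal.ofReal (Vbeta d α δ q.2 * φ (s + q.1, q.2))
      ∂(rhoM d)) = B at *
    generalize (∫⁻ q, SL d α δ x q * ENNReal.ofReal (-(Vbeta d α δ q.2 * φ (s + q.1, q.2)))
      ∂(rhoM d)) = B' at *
    have hb := congrArg ENNReal.toReal hbal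
    rw [ENNReal.toReal_add (ENNReal.add_ne_top.2 ⟨q1, q3⟩) ENNReal.ofReal_ne_top,
      ENNReal.toReal_add (ENNReal.add_ne_top.2 ⟨q2, q4⟩) ENNReal.ofReal_ne_top,
      ENNReal.toReal_add q1 q3, ENNReal.toReal_add q2 q4,
      ENNReal.toReal_ofReal', ENNReal.toReal_ofReal'] at hb
    rcases le_total 0 (φ (s, x)) with h | h
    · rw [max_eq_left h, max_eq_right (by linarith)] at hb; linarith
    · rw [max_eq_right h, max_eq_left (by linarith)] at hb; linarith
  have hae : (fun q : ℝ × Ed d => (SL d α δ x q).toReal * Dop d α φ (s + q.1, q.2) +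
      (SL d α δ x q).toReal * (Vbeta d α δ q.2 * φ (s + q.1, q.2))) =ᵐ[rhoM d]
      fun q : ℝ × Ed d => pert d (relKernel d α 1) (Vbeta d α δ) q.1 x q.2 *
      (Dop d α φ (s + q.1, q.2) + Vbeta d α δ q.2 * φ (s + q.1, q.2)) := by
    filter_upwards [pert_ae_prod hd h0 h2 hδ0 hδ hx] with q hq
    rw [hq.2, mul_add]
  refine ⟨(iD.add iV).congr hae, ?_⟩
  rw [← integral_congr_ae hae, hsum]

lemma shift_mp (d : ℕ) (s : ℝ) : MeasurePreserving
    ((MeasurableEquiv.addLeft s).prodCongr (MeasurableEquiv.refl (Ed d))) (rhoM d)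
    ((volume.restrict (Ioi s)).prod (volume : Measure (Ed d))) := by
  have h1 : MeasurePreserving (fun t : ℝ => s + t) volume volume := measurePreserving_add_left volume s
  have h2 := h1.restrict_preimage (measurableSet_Ioi (a := s))
  have h3 : (fun t : ℝ => s + t) ⁻¹' Ioi s = Ioi 0 := by ext t; simp
  rw [h3] at h2
  exact h2.prod (MeasurePreserving.id (volume : Measure (Ed d)))

end Final
/-- `p̃` is a weak solution (fundamental solution) of `∂_t u = -(-Δ+1)^{α/2}u + V_δ u`
(Proposition 1.1). -/
theorem stmt_1 (d : ℕ) (α δ : ℝ) (hα : α ∈ Ioo 0 (min 2 (d : ℝ)))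
    (hδ : δ ∈ Ioo 0 ((d : ℝ) - α)) (s : ℝ) (x : Ed d) (hx : x ≠ 0)
    (φ : ℝ × Ed d → ℝ) (hφ : ContDiff ℝ (⊤ : ℕ∞) φ) (hφc : HasCompactSupport φ) :
    IntegrableOn
      (fun uz : ℝ × Ed d =>
        pert d (relKernel d α 1) (Vbeta d α δ) (uz.1 - s) x uz.2 *
          (deriv (fun u : ℝ => φ (u, uz.2)) uz.1 - relFracOp d α φ uz.1 uz.2 +
            Vbeta d α δ uz.2 * φ uz))
      (Ioi s ×ˢ (univ : Set (Ed d))) ∧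
    (∫ u in Ioi s, ∫ z : Ed d,
        pert d (relKernel d α 1) (Vbeta d α δ) (u - s) x z *
          (deriv (fun u' : ℝ => φ (u', z)) u - relFracOp d α φ u z +
            Vbeta d α δ z * φ (u, z))) = -φ (s, x) := by
  have h0 : 0 < α := hα.1
  have h2 : α < 2 := hα.2.trans_le (min_le_left _ _)
  have hd : 0 < d := by
    have h3 : (0 : ℝ) < d := h0.trans (hα.2.trans_le (min_le_right _ _))
    exact_mod_cast h3
  obtain ⟨hi, hv⟩ := final_rho hd h0 h2 hδ.1 hδ.2 hx hφ hφc s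
  set F : ℝ × Ed d → ℝ := fun uz : ℝ × Ed d =>
        pert d (relKernel d α 1) (Vbeta d α δ) (uz.1 - s) x uz.2 *
          (deriv (fun u : ℝ => φ (u, uz.2)) uz.1 - relFracOp d α φ uz.1 uz.2 +
            Vbeta d α δ uz.2 * φ uz) with hF
  have mp := shift_mp d s
  have hcomp : F ∘ ((MeasurableEquiv.addLeft s).prodCongr (MeasurableEquiv.refl (Ed d))) =
      fun q : ℝ × Ed d => pert d (relKernel d α 1) (Vbeta d α δ) q.1 x q.2 *
      (Dop d α φ (s + q.1, q.2) + Vbeta d α δ q.2 * φ (s + q.1, q.2)) := by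
    funext q
    have e : ((MeasurableEquiv.addLeft s).prodCongr (MeasurableEquiv.refl (Ed d))) q =
      (s + q.1, q.2) := rfl
    simp only [Function.comp, e, hF, relFracOp_eq hd h0 h2 hφ hφc, Dop, dphi, add_sub_cancel_left]
  have hi2 : Integrable F ((volume.restrict (Ioi s)).prod (volume : Measure (Ed d))) := by
    rw [← mp.integrable_comp_emb (MeasurableEquiv.measurableEmbedding _), hcomp]
    exact hi
  have hv2 : ∫ q, F q ∂((volume.restrict (Ioi s)).prod (volume : Measure (Ed d))) = -φ (s, x) := by
    rw [← mp.integral_comp (MeasurableEquiv.measurableEmbedding _), ← hv]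
    exact congrArg (fun f => ∫ q, f q ∂(rhoM d)) hcomp
  refine ⟨?_, ?_⟩
  · have hr : (volume.restrict (Ioi s)).prod (volume : Measure (Ed d)) =
        (volume : Measure (ℝ × Ed d)).restrict (Ioi s ×ˢ univ) := by
      rw [Measure.volume_eq_prod, ← Measure.prod_restrict, Measure.restrict_univ]
    rw [IntegrableOn, ← hr]
    exact hi2
  · rw [← hv2, integral_prod _ hi2]
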